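/- Under the hypotheses of the quantitative convergence theorem (conditions (cond1), (cond2), |U| = 1, Σ₀ Lipschitz, the smallness conditions ρ ≥ A₁^{2/(1−α)}, ε₀A₁ρ^{α/2} ≤ 1, ε₁A₁ ≤ 1, v* a bounded C^{2,α} classical solution of the exploratory HJB equation and v^n the policy iteration sequence), with C, C' > 0 as in that theorem, one has for all n ≥ 1: ‖D(v^n − v*)‖_∞ ≤ (C·2^{−n} + C'·ε₀²/ρ)^{1/(d+2)} and ‖v^n − v*‖_∞ ≤ ρ^{−1/(d+2)} (C·2^{−n} + C'·ε₀²/ρ)^{1/(d+2) + d/(d+2)²}. -/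

import Mathlib

open MeasureTheory Real Metric
noncomputable section

/-- First-order partial derivative `∂v/∂xᵢ`. -/
def pd1 (d : ℕ) (v : EuclideanSpace ℝ (Fin d) → ℝ) (x : EuclideanSpace ℝ (Fin d))
    (i : Fin d) : ℝ :=
  fderiv ℝ v x (EuclideanSpace.single i 1)

/-- Second-order partial derivative `∂²v/∂xᵢ∂xⱼ`. -/
def pd2 (d : ℕ) (v : EuclideanSpace ℝ (Fin d) → ℝ) (x : EuclideanSpace ℝ (Fin d))
    (i j : Fin d) : ℝ :=
  fderiv ℝ (fun y => fderiv ℝ v y (EuclideanSpace.single j 1)) x (EuclideanSpace.single i 1)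

/-- The exponent `(1/λ)(r(x,u) + b(x,u)·p + (1/2) tr(Σ(x,u) X))` of the Gibbs density. -/
def gibbsExponent (d l : ℕ) (lam : ℝ)
    (r : EuclideanSpace ℝ (Fin d) → EuclideanSpace ℝ (Fin l) → ℝ)
    (b : EuclideanSpace ℝ (Fin d) → EuclideanSpace ℝ (Fin l) → Fin d → ℝ)
    (S : EuclideanSpace ℝ (Fin d) → EuclideanSpace ℝ (Fin l) → Matrix (Fin d) (Fin d) ℝ)
    (x : EuclideanSpace ℝ (Fin d)) (p : Fin d → ℝ) (X : Matrix (Fin d) (Fin d) ℝ)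
    (u : EuclideanSpace ℝ (Fin l)) : ℝ :=
  (1 / lam) * (r x u + ∑ i, b x u i * p i + (1 / 2) * ∑ i, ∑ j, S x u i j * X j i)

/-- The Gibbs density `Γ(x,p,X)(u)`. -/
def gibbsDensity (d l : ℕ) (lam : ℝ) (U : Set (EuclideanSpace ℝ (Fin l)))
    (r : EuclideanSpace ℝ (Fin d) → EuclideanSpace ℝ (Fin l) → ℝ)
    (b : EuclideanSpace ℝ (Fin d) → EuclideanSpace ℝ (Fin l) → Fin d → ℝ)
    (S : EuclideanSpace ℝ (Fin d) → EuclideanSpace ℝ (Fin l) → Matrix (Fin d) (Fin d) ℝ)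
    (x : EuclideanSpace ℝ (Fin d)) (p : Fin d → ℝ) (X : Matrix (Fin d) (Fin d) ℝ)
    (u : EuclideanSpace ℝ (Fin l)) : ℝ :=
  Real.exp (gibbsExponent d l lam r b S x p X u) /
    ∫ u' in U, Real.exp (gibbsExponent d l lam r b S x p X u')

/-- The Hessian matrix of `v` at `x`. -/
def hessian (d : ℕ) (v : EuclideanSpace ℝ (Fin d) → ℝ) (x : EuclideanSpace ℝ (Fin d)) :
    Matrix (Fin d) (Fin d) ℝ :=
  Matrix.of fun i j => pd2 d v x i j

/-- The policy `π(x,·) = Γ(x, Dv(x), D²v(x))` obtained from a value function `v`. -/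
def gibbsPolicy (d l : ℕ) (lam : ℝ) (U : Set (EuclideanSpace ℝ (Fin l)))
    (r : EuclideanSpace ℝ (Fin d) → EuclideanSpace ℝ (Fin l) → ℝ)
    (b : EuclideanSpace ℝ (Fin d) → EuclideanSpace ℝ (Fin l) → Fin d → ℝ)
    (S : EuclideanSpace ℝ (Fin d) → EuclideanSpace ℝ (Fin l) → Matrix (Fin d) (Fin d) ℝ)
    (v : EuclideanSpace ℝ (Fin d) → ℝ)
    (x : EuclideanSpace ℝ (Fin d)) (u : EuclideanSpace ℝ (Fin l)) : ℝ :=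
  gibbsDensity d l lam U r b S x (fun i => pd1 d v x i) (hessian d v x) u


/-- The exploratory (entropy-regularized) Hamiltonian
`F(x,p,X) = λ ln ∫_U exp[(1/λ)(r + b·p + (1/2) tr(Σ X))] du`. -/
def expF (d l : ℕ) (lam : ℝ) (U : Set (EuclideanSpace ℝ (Fin l)))
    (r : EuclideanSpace ℝ (Fin d) → EuclideanSpace ℝ (Fin l) → ℝ)
    (b : EuclideanSpace ℝ (Fin d) → EuclideanSpace ℝ (Fin l) → Fin d → ℝ)
    (S : EuclideanSpace ℝ (Fin d) → EuclideanSpace ℝ (Fin l) → Matrix (Fin d) (Fin d) ℝ)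
    (x : EuclideanSpace ℝ (Fin d)) (p : Fin d → ℝ) (X : Matrix (Fin d) (Fin d) ℝ) : ℝ :=
  lam * Real.log (∫ u in U, Real.exp (gibbsExponent d l lam r b S x p X u))

open ProbabilityTheory

/-- The standard Gaussian measure on `ℝ^d`. -/
abbrev gs (d : ℕ) : Measure (EuclideanSpace ℝ (Fin d)) := stdGaussian (EuclideanSpace ℝ (Fin d))

lemma integrable_gaussian_weight (d : ℕ) {b : ℝ} (hb : 0 < b) :
    Integrable (fun z : EuclideanSpace ℝ (Fin d) => Real.exp (-b * ‖z‖ ^ 2)) := by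
  have h := (GaussianFourier.integrable_cexp_neg_mul_sq_norm_add
    (V := EuclideanSpace ℝ (Fin d)) (b := (b : ℂ)) (by simpa using hb) 0 0).re
  refine h.congr (Filter.Eventually.of_forall fun z => ?_)
  have : (-(b : ℂ) * ((‖z‖ : ℝ) : ℂ) ^ 2 + 0 * ((inner ℝ (0 : EuclideanSpace ℝ (Fin d)) z : ℝ) : ℂ))
      = ((-b * ‖z‖ ^ 2 : ℝ) : ℂ) := by push_cast; ring
  simp only [this]
  exact Complex.exp_ofReal_re _

/-- Normalising constant of the standard Gaussian density. -/
def gaussConst (d : ℕ) : ℝ := ((2 * π) ^ ((d : ℝ) / 2))⁻¹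

lemma gaussConst_pos (d : ℕ) : 0 < gaussConst d := by unfold gaussConst; positivity

/-- The standard Gaussian measure has the usual density. -/
lemma gs_eq_withDensity (d : ℕ) : gs d = (volume : Measure (EuclideanSpace ℝ (Fin d))).withDensity
    (fun z => ENNReal.ofReal (gaussConst d * Real.exp (-(1 / 2) * ‖z‖ ^ 2))) := by
  have hgi := (integrable_gaussian_weight d (b := 1 / 2) (by norm_num)).const_mul (gaussConst d)
  have : IsFiniteMeasure ((volume : Measure (EuclideanSpace ℝ (Fin d))).withDensity
    (fun z => ENNReal.ofReal (gaussConst d * Real.exp (-(1 / 2) * ‖z‖ ^ 2)))) :=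
    isFiniteMeasure_withDensity_ofReal hgi.2
  refine Measure.ext_of_charFun ?_
  ext t
  rw [charFun_stdGaussian, charFun_apply,
    integral_withDensity_eq_integral_toReal_smul (by fun_prop)
      (Filter.Eventually.of_forall fun _ => ENNReal.ofReal_lt_top)]
  have key := GaussianFourier.integral_cexp_neg_mul_sq_norm_add
    (V := EuclideanSpace ℝ (Fin d)) (b := (1 / 2 : ℂ)) (by norm_num) Complex.I t
  have e1 : ∀ z : EuclideanSpace ℝ (Fin d),
      (ENNReal.ofReal (gaussConst d * Real.exp (-(1 / 2) * ‖z‖ ^ 2))).toReal •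
        Complex.exp (((inner ℝ z t : ℝ) : ℂ) * Complex.I) = (gaussConst d : ℂ) *
        Complex.exp (-(1 / 2 : ℂ) * ((‖z‖ : ℝ) : ℂ) ^ 2 + Complex.I * ((inner ℝ t z : ℝ) : ℂ)) := by
    intro z
    rw [ENNReal.toReal_ofReal (mul_nonneg (gaussConst_pos d).le (Real.exp_pos _).le),
      Complex.real_smul, Complex.exp_add, real_inner_comm]
    push_cast
    rw [mul_assoc, mul_comm Complex.I]
  simp_rw [e1]
  rw [integral_const_mul, key, gaussConst]
  have e2 : ((π : ℂ) / (1 / 2 : ℂ)) ^ ((Module.finrank ℝ (EuclideanSpace ℝ (Fin d)) : ℂ) / 2)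
      = (((2 * π) ^ ((d : ℝ) / 2) : ℝ) : ℂ) := by
    rw [Complex.ofReal_cpow (by positivity)]
    simp only [finrank_euclideanSpace_fin]
    push_cast
    congr 1
    ring
  have hp : (((2 * π) ^ ((d : ℝ) / 2) : ℝ) : ℂ) ≠ 0 := by
    exact_mod_cast (by positivity : (2 * π) ^ ((d : ℝ) / 2) ≠ 0)
  rw [e2]
  rw [Complex.ofReal_inv, ← mul_assoc, inv_mul_cancel₀ hp, one_mul, Complex.I_sq]
  congr 1
  ring

lemma integral_gs (d : ℕ) (f : EuclideanSpace ℝ (Fin d) → ℝ) :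
    ∫ z, f z ∂(gs d) = gaussConst d * ∫ z, Real.exp (-(1 / 2) * ‖z‖ ^ 2) * f z := by
  rw [gs_eq_withDensity, integral_withDensity_eq_integral_toReal_smul (by fun_prop)
      (Filter.Eventually.of_forall fun _ => ENNReal.ofReal_lt_top), ← integral_const_mul]
  congr 1
  ext z
  rw [ENNReal.toReal_ofReal (mul_nonneg (gaussConst_pos d).le (Real.exp_pos _).le), smul_eq_mul,
    mul_assoc]

lemma integrable_gs_iff (d : ℕ) (f : EuclideanSpace ℝ (Fin d) → ℝ) :
    Integrable f (gs d) ↔ Integrable (fun z => Real.exp (-(1 / 2) * ‖z‖ ^ 2) * f z) := by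
  rw [gs_eq_withDensity, integrable_withDensity_iff_integrable_smul' (by fun_prop)
      (Filter.Eventually.of_forall fun _ => ENNReal.ofReal_lt_top)]
  have e : ∀ z : EuclideanSpace ℝ (Fin d),
      (ENNReal.ofReal (gaussConst d * Real.exp (-(1 / 2) * ‖z‖ ^ 2))).toReal • f z =
      gaussConst d * (Real.exp (-(1 / 2) * ‖z‖ ^ 2) * f z) := by
    intro z
    rw [ENNReal.toReal_ofReal (mul_nonneg (gaussConst_pos d).le (Real.exp_pos _).le), smul_eq_mul,
      mul_assoc]
  simp_rw [e]
  exact integrable_const_mul_iff (gaussConst_pos d).ne'.isUnit _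

lemma integrable_gs_norm_pow (d n : ℕ) : Integrable (fun z => ‖z‖ ^ n) (gs d) :=
  (IsGaussian.memLp_id (gs d) n (by simp)).integrable_norm_pow'

/-- Continuous functions of polynomial growth are Gaussian integrable. -/
lemma integrable_gs_of_poly {d : ℕ} {V : Type*} [NormedAddCommGroup V]
    {f : EuclideanSpace ℝ (Fin d) → V} (hf : AEStronglyMeasurable f (gs d)) {C : ℝ} {n : ℕ}
    (h : ∀ z, ‖f z‖ ≤ C * (1 + ‖z‖) ^ n) : Integrable f (gs d) := by
  have : Integrable (fun z : EuclideanSpace ℝ (Fin d) => C * (1 + ‖z‖) ^ n) (gs d) := by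
    simp_rw [add_comm (1 : ℝ), add_pow, one_pow, mul_one]
    refine Integrable.const_mul (integrable_finsetSum _ fun i _ => ?_) C
    exact (integrable_gs_norm_pow d i).mul_const _
  exact this.mono' hf (Filter.Eventually.of_forall h)

lemma hasFDerivAt_gauss_weight {d : ℕ} (z : EuclideanSpace ℝ (Fin d)) :
    HasFDerivAt (fun z : EuclideanSpace ℝ (Fin d) => Real.exp (-(1 / 2) * ‖z‖ ^ 2))
      (-(Real.exp (-(1 / 2) * ‖z‖ ^ 2)) • innerSL ℝ z) z := by
  have h1 := ((hasStrictFDerivAt_norm_sq z).hasFDerivAt.const_mul (-(1 / 2 : ℝ))).exp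
  refine h1.congr_fderiv ?_
  ext v
  simp

/-- Stein's identity. -/
lemma stein {d : ℕ} {f : EuclideanSpace ℝ (Fin d) → ℝ}
    {f' : EuclideanSpace ℝ (Fin d) → (EuclideanSpace ℝ (Fin d) →L[ℝ] ℝ)}
    (hf : ∀ z, HasFDerivAt f (f' z) z) (i : Fin d)
    (h0 : Integrable f (gs d)) (h1 : Integrable (fun z => z i * f z) (gs d))
    (h2 : Integrable (fun z => f' z (EuclideanSpace.single i 1)) (gs d)) :
    ∫ z, f' z (EuclideanSpace.single i 1) ∂(gs d) = ∫ z, z i * f z ∂(gs d) := by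
  rw [integrable_gs_iff] at h0 h1 h2
  rw [integral_gs, integral_gs]
  congr 1
  have hin : ∀ z : EuclideanSpace ℝ (Fin d),
      (-(Real.exp (-(1 / 2) * ‖z‖ ^ 2)) • innerSL ℝ z) (EuclideanSpace.single i (1 : ℝ)) =
        -(Real.exp (-(1 / 2) * ‖z‖ ^ 2) * z i) := by
    intro z
    simp [EuclideanSpace.inner_single_right]
  have := integral_mul_fderiv_eq_neg_fderiv_mul_of_integrable (𝕜 := ℝ)
    (μ := (volume : Measure (EuclideanSpace ℝ (Fin d))))
    (f := fun z : EuclideanSpace ℝ (Fin d) => Real.exp (-(1 / 2) * ‖z‖ ^ 2)) (g := f)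
    (v := EuclideanSpace.single i 1)
    (by
      refine h1.neg.congr (Filter.Eventually.of_forall fun z => ?_)
      simp only [(hasFDerivAt_gauss_weight z).fderiv, hin, Pi.neg_apply]; ring)
    (by
      refine h2.congr (Filter.Eventually.of_forall fun z => ?_)
      simp only [(hf z).fderiv])
    h0 (fun z _ => (hasFDerivAt_gauss_weight z).differentiableAt)
    (fun z _ => (hf z).differentiableAt)
  simp only [(hf _).fderiv, (hasFDerivAt_gauss_weight _).fderiv, hin] at this
  rw [this, ← integral_neg]
  congr 1
  ext z
  ring

/-- Sums of scaled independent Gaussians are Gaussian. -/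
lemma integral_gs_add {d : ℕ} {V : Type*} [NormedAddCommGroup V] [NormedSpace ℝ V]
    {f : EuclideanSpace ℝ (Fin d) → V} (hf : Continuous f) {M : ℝ} (hM : ∀ z, ‖f z‖ ≤ M)
    {s t : ℝ} (hs : 0 ≤ s) (ht : 0 ≤ t) :
    ∫ z, ∫ z', f (√s • z + √t • z') ∂(gs d) ∂(gs d) = ∫ z, f (√(s + t) • z) ∂(gs d) := by
  have hmap : ((gs d).prod (gs d)).map (fun p => √s • p.1 + √t • p.2) =
      (gs d).map (fun z => √(s + t) • z) := by
    have := Measure.isFiniteMeasure_map ((gs d).prod (gs d)) (fun p => √s • p.1 + √t • p.2)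
    have := Measure.isFiniteMeasure_map (gs d) (fun z => √(s + t) • z)
    refine Measure.ext_of_charFun ?_
    ext v
    have e2 : charFun ((gs d).map (fun z => √(s + t) • z)) v = charFun (gs d) (√(s + t) • v) := by
      rw [charFun_apply, integral_map (by fun_prop) (by fun_prop), charFun_apply]
      simp [inner_smul_left, inner_smul_right]
    have e1 : charFun (((gs d).prod (gs d)).map (fun p => √s • p.1 + √t • p.2)) v =
        charFun (gs d) (√s • v) * charFun (gs d) (√t • v) := by
      rw [charFun_apply, integral_map (by fun_prop) (by fun_prop), charFun_apply, charFun_apply,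
        ← integral_prod_mul]
      congr 1
      ext p
      rw [← Complex.exp_add]
      congr 1
      simp only [inner_add_left, inner_smul_left, inner_smul_right]
      push_cast
      simp
      ring
    rw [e1, e2, charFun_stdGaussian, charFun_stdGaussian, charFun_stdGaussian, ← Complex.exp_add]
    congr 1
    simp only [norm_smul, Real.norm_eq_abs]
    push_cast
    simp only [mul_pow, ← Complex.ofReal_pow, sq_abs, Real.sq_sqrt hs, Real.sq_sqrt ht,
      Real.sq_sqrt (add_nonneg hs ht)]
    push_cast
    ring
  have hi : Integrable (fun p : EuclideanSpace ℝ (Fin d) × EuclideanSpace ℝ (Fin d) =>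
      f (√s • p.1 + √t • p.2)) ((gs d).prod (gs d)) :=
    Integrable.of_bound (by fun_prop) M (Filter.Eventually.of_forall fun _ => hM _)
  rw [integral_integral (f := fun z z' => f (√s • z + √t • z')) hi,
    ← integral_map (μ := (gs d).prod (gs d)) (φ := fun p => √s • p.1 + √t • p.2) (by fun_prop)
      (by fun_prop), hmap, integral_map (by fun_prop) (by fun_prop)]

/-- Gaussian averages along a linear map which expands after inversion. -/
lemma integral_gs_comp_le {d : ℕ} {f : EuclideanSpace ℝ (Fin d) → ℝ}
    (hf : Continuous f) {M : ℝ} (hM : ∀ z, |f z| ≤ M) (h0 : ∀ z, 0 ≤ f z)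
    (L : EuclideanSpace ℝ (Fin d) ≃L[ℝ] EuclideanSpace ℝ (Fin d)) (hL : ∀ z, ‖L z‖ ≤ ‖z‖) :
    ∫ z, f (L z) ∂(gs d) ≤
      |LinearMap.det ((L : EuclideanSpace ℝ (Fin d) →L[ℝ] EuclideanSpace ℝ (Fin d)) :
        EuclideanSpace ℝ (Fin d) →ₗ[ℝ] EuclideanSpace ℝ (Fin d))|⁻¹ * ∫ z, f z ∂(gs d) := by
  have hb : ∀ g : EuclideanSpace ℝ (Fin d) → EuclideanSpace ℝ (Fin d), Continuous g →
      Integrable (fun z => f (g z)) (gs d) := fun g hg =>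
    Integrable.of_bound (by fun_prop) M (Filter.Eventually.of_forall fun _ => hM _)
  have h1 := (integrable_gs_iff d _).1 (hb (fun z => L z) L.continuous)
  have h2 := (integrable_gs_iff d _).1 (hb (fun z => z) continuous_id)
  have hdet : LinearMap.det ((L : EuclideanSpace ℝ (Fin d) →L[ℝ] EuclideanSpace ℝ (Fin d)) :
        EuclideanSpace ℝ (Fin d) →ₗ[ℝ] EuclideanSpace ℝ (Fin d)) ≠ 0 :=
    (LinearEquiv.isUnit_det' L.toLinearEquiv).ne_zero
  rw [integral_gs, integral_gs]
  have key : ∫ z, Real.exp (-(1 / 2) * ‖z‖ ^ 2) * f (L z) ≤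
      |LinearMap.det ((L : EuclideanSpace ℝ (Fin d) →L[ℝ] EuclideanSpace ℝ (Fin d)) :
        EuclideanSpace ℝ (Fin d) →ₗ[ℝ] EuclideanSpace ℝ (Fin d))|⁻¹ *
        ∫ z, Real.exp (-(1 / 2) * ‖z‖ ^ 2) * f z := by
    have hmap := Measure.map_linearMap_addHaar_eq_smul_addHaar
      (volume : Measure (EuclideanSpace ℝ (Fin d))) hdet
    have e : ∫ z, Real.exp (-(1 / 2) * ‖L z‖ ^ 2) * f (L z) =
      |LinearMap.det ((L : EuclideanSpace ℝ (Fin d) →L[ℝ] EuclideanSpace ℝ (Fin d)) :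
        EuclideanSpace ℝ (Fin d) →ₗ[ℝ] EuclideanSpace ℝ (Fin d))|⁻¹ *
        ∫ z, Real.exp (-(1 / 2) * ‖z‖ ^ 2) * f z := by
      have := integral_map (μ := (volume : Measure (EuclideanSpace ℝ (Fin d))))
        (φ := fun z => L z) (by fun_prop)
        (f := fun z => Real.exp (-(1 / 2) * ‖z‖ ^ 2) * f z) (by fun_prop)
      rw [← this]
      have h3 : Measure.map (fun z => L z) (volume : Measure (EuclideanSpace ℝ (Fin d))) = _ := hmap
      rw [h3, integral_smul_measure, ENNReal.toReal_ofReal (abs_nonneg _), abs_inv, smul_eq_mul]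
    rw [← e]
    refine integral_mono h1 ?_ fun z => ?_
    · have hcomp : Integrable ((fun z => Real.exp (-(1 / 2) * ‖z‖ ^ 2) * f z) ∘ (fun z => L z)) := by
        refine Integrable.comp_measurable ?_ (by fun_prop)
        have h3 : Measure.map (fun z => L z) (volume : Measure (EuclideanSpace ℝ (Fin d))) = _ :=
          hmap
        rw [h3]
        exact h2.smul_measure ENNReal.ofReal_ne_top
      exact hcomp
    · refine mul_le_mul_of_nonneg_right (Real.exp_le_exp.2 ?_) (h0 _)
      have := pow_le_pow_left₀ (norm_nonneg _) (hL z) 2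
      linarith
  calc _ ≤ gaussConst d * _ := mul_le_mul_of_nonneg_left key (gaussConst_pos d).le
    _ = _ := by ring

/-- A quadratic weight is absorbed by doubling the variance. -/
lemma integral_gs_weight_le {d : ℕ} {f : EuclideanSpace ℝ (Fin d) → ℝ}
    (hf : Continuous f) {M : ℝ} (hM : ∀ z, |f z| ≤ M) (h0 : ∀ z, 0 ≤ f z) :
    ∫ z, (1 + ‖z‖ ^ 2) * f z ∂(gs d) ≤ 4 * √2 ^ d * ∫ z, f (√2 • z) ∂(gs d) := by
  have hb : Integrable (fun z => f (√2 • z)) (gs d) :=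
    Integrable.of_bound (by fun_prop) M (Filter.Eventually.of_forall fun _ => hM _)
  have h2 := (integrable_gs_iff d _).1 hb
  have h1 : Integrable (fun z => (1 + ‖z‖ ^ 2) * f z) (gs d) := by
    refine integrable_gs_of_poly (by fun_prop) (C := M) (n := 2) fun z => ?_
    rw [Real.norm_eq_abs, abs_mul, abs_of_nonneg (by positivity : 0 ≤ 1 + ‖z‖ ^ 2), mul_comm]
    have := norm_nonneg z
    exact mul_le_mul (hM z) (by nlinarith) (by positivity) ((abs_nonneg _).trans (hM z))
  have h1' := (integrable_gs_iff d _).1 h1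
  rw [integral_gs, integral_gs]
  have hs2 : (0 : ℝ) < √2 := by positivity
  set g : EuclideanSpace ℝ (Fin d) → ℝ :=
    fun z => Real.exp (-(1 / 2) * ‖(√2)⁻¹ • z‖ ^ 2) * f z with hg
  have hgc : ∀ z, g (√2 • z) = Real.exp (-(1 / 2) * ‖z‖ ^ 2) * f (√2 • z) := by
    intro z
    simp only [hg, smul_smul, inv_mul_cancel₀ hs2.ne', one_smul]
  have hgi : Integrable g := by
    have := h2
    simp_rw [← hgc] at this
    exact (integrable_comp_smul_iff volume g hs2.ne').1 this
  have e : ∫ z, g z = √2 ^ d * ∫ z, Real.exp (-(1 / 2) * ‖z‖ ^ 2) * f (√2 • z) := by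
    simp_rw [← hgc]
    rw [Measure.integral_comp_smul, finrank_euclideanSpace_fin, smul_eq_mul, abs_inv,
      abs_of_pos (by positivity : 0 < √2 ^ d), mul_inv_cancel_left₀ (by positivity)]
  have key : ∫ z, Real.exp (-(1 / 2) * ‖z‖ ^ 2) * ((1 + ‖z‖ ^ 2) * f z) ≤
      4 * ∫ z, g z := by
    rw [← integral_const_mul]
    refine integral_mono h1' (hgi.const_mul 4) fun z => ?_
    simp only [hg]
    rw [← mul_assoc, ← mul_assoc]
    refine mul_le_mul_of_nonneg_right ?_ (h0 z)
    rw [norm_smul, mul_pow, norm_inv, Real.norm_eq_abs, abs_of_pos hs2, inv_pow,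
      Real.sq_sqrt (by norm_num)]
    have : -(1 / 2) * ‖z‖ ^ 2 = -(1 / 2) * (2⁻¹ * ‖z‖ ^ 2) + (-(‖z‖ ^ 2 / 4)) := by ring
    rw [this, Real.exp_add, mul_assoc, mul_comm (4 : ℝ)]
    refine mul_le_mul_of_nonneg_left ?_ (Real.exp_pos _).le
    rw [Real.exp_neg, inv_mul_le_iff₀ (Real.exp_pos _)]
    have := Real.add_one_le_exp (‖z‖ ^ 2 / 4)
    linarith
  calc _ ≤ gaussConst d * (4 * ∫ z, g z) := mul_le_mul_of_nonneg_left key (gaussConst_pos d).le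
    _ = _ := by rw [e]; ring

/-- The heat operator with generator half the Laplacian. -/
def heat {d : ℕ} {V : Type*} [NormedAddCommGroup V] [NormedSpace ℝ V] (s : ℝ)
    (f : EuclideanSpace ℝ (Fin d) → V) (x : EuclideanSpace ℝ (Fin d)) : V :=
  ∫ z, f (x + √s • z) ∂(gs d)

lemma hasFDerivAt_comp_add {E F : Type*} [NormedAddCommGroup E] [NormedSpace ℝ E]
    [NormedAddCommGroup F] [NormedSpace ℝ F] {f : E → F} {f' : E →L[ℝ] F} {x a : E}
    (h : HasFDerivAt f f' (x + a)) : HasFDerivAt (fun y => f (y + a)) f' x := by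
  simpa [Function.comp_def] using h.comp x ((hasFDerivAt_id x).add_const a)

lemma integrable_gs_of_bound {d : ℕ} {V : Type*} [NormedAddCommGroup V]
    {f : EuclideanSpace ℝ (Fin d) → V} {M : ℝ} (hf : Continuous f) (hM : ∀ z, ‖f z‖ ≤ M) :
    Integrable f (gs d) :=
  Integrable.of_bound (by fun_prop) M (Filter.Eventually.of_forall hM)

section heat

variable {d : ℕ} {V : Type*} [NormedAddCommGroup V] [NormedSpace ℝ V]
  {f : EuclideanSpace ℝ (Fin d) → V} {M s t : ℝ}

lemma heat_norm_le (hM : ∀ z, ‖f z‖ ≤ M) (x : EuclideanSpace ℝ (Fin d)) :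
    ‖heat s f x‖ ≤ M := by
  have := norm_integral_le_of_norm_le_const (μ := gs d)
    (Filter.Eventually.of_forall fun z => hM (x + √s • z))
  simpa [heat] using this

lemma heat_continuous (hf : Continuous f) (hM : ∀ z, ‖f z‖ ≤ M) : Continuous (heat s f) := by
  refine continuous_of_dominated (bound := fun _ => M) (fun x => by fun_prop)
    (fun x => Filter.Eventually.of_forall fun z => hM _) (integrable_const _)
    (Filter.Eventually.of_forall fun z => by fun_prop)

lemma heat_hasFDerivAt {f' : EuclideanSpace ℝ (Fin d) → EuclideanSpace ℝ (Fin d) →L[ℝ] V}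
    (hf : ∀ y, HasFDerivAt f (f' y) y) (hc : Continuous f') (hM : ∀ z, ‖f z‖ ≤ M)
    (hM' : ∀ z, ‖f' z‖ ≤ M) (x : EuclideanSpace ℝ (Fin d)) :
    HasFDerivAt (heat s f) (heat s f' x) x := by
  have hfc : Continuous f := continuous_iff_continuousAt.2 fun y => (hf y).continuousAt
  refine hasFDerivAt_integral_of_dominated_of_fderiv_le (s := Set.univ) (bound := fun _ => M)
    (F := fun x z => f (x + √s • z)) (F' := fun x z => f' (x + √s • z)) Filter.univ_mem
    (Filter.Eventually.of_forall fun y => by fun_prop)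
    (integrable_gs_of_bound (by fun_prop) fun z => hM _) (by fun_prop)
    (Filter.Eventually.of_forall fun z y _ => hM' _) (integrable_const _)
    (Filter.Eventually.of_forall fun z y _ => ?_)
  exact hasFDerivAt_comp_add (hf _)

lemma heat_heat (hf : Continuous f) (hM : ∀ z, ‖f z‖ ≤ M) (hs : 0 ≤ s) (ht : 0 ≤ t)
    (x : EuclideanSpace ℝ (Fin d)) : heat s (heat t f) x = heat (s + t) f x := by
  have := integral_gs_add (f := fun z => f (x + z)) (by fun_prop) (fun z => hM _) hs ht
  simpa only [heat, add_assoc] using this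

lemma heat_zero [CompleteSpace V] (x : EuclideanSpace ℝ (Fin d)) : heat 0 f x = f x := by
  simp [heat]

end heat

lemma heat_mono {d : ℕ} {f g : EuclideanSpace ℝ (Fin d) → ℝ} {M s : ℝ} (hf : Continuous f)
    (hg : Continuous g) (hM : ∀ z, ‖f z‖ ≤ M) (hM' : ∀ z, ‖g z‖ ≤ M) (h : ∀ z, f z ≤ g z)
    (x : EuclideanSpace ℝ (Fin d)) : heat s f x ≤ heat s g x :=
  integral_mono (integrable_gs_of_bound (by fun_prop) fun _ => hM _)
    (integrable_gs_of_bound (by fun_prop) fun _ => hM' _) fun _ => h _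

/-- The Cauchy–Schwarz inequality for integrals. -/
lemma sq_integral_mul_le {Ω : Type*} [MeasurableSpace Ω] {μ : Measure Ω} {f g : Ω → ℝ}
    (hf : Integrable (fun z => f z ^ 2) μ) (hg : Integrable (fun z => g z ^ 2) μ)
    (hfg : Integrable (fun z => f z * g z) μ) :
    (∫ z, f z * g z ∂μ) ^ 2 ≤ (∫ z, f z ^ 2 ∂μ) * ∫ z, g z ^ 2 ∂μ := by
  have h : ∀ c : ℝ, 0 ≤ (∫ z, g z ^ 2 ∂μ) * (c * c) + (2 * ∫ z, f z * g z ∂μ) * c +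
      ∫ z, f z ^ 2 ∂μ := by
    intro c
    have h1 : 0 ≤ ∫ z, (f z + c * g z) ^ 2 ∂μ := integral_nonneg fun z => sq_nonneg _
    have h2 : ∀ z, (f z + c * g z) ^ 2 = f z ^ 2 + (2 * c * (f z * g z) + c ^ 2 * g z ^ 2) :=
      fun z => by ring
    simp_rw [h2] at h1
    have h3 : Integrable (fun z => 2 * c * (f z * g z) + c ^ 2 * g z ^ 2) μ :=
      (hfg.const_mul _).add (hg.const_mul _)
    rw [integral_add hf h3, integral_add (hfg.const_mul _) (hg.const_mul _), integral_const_mul,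
      integral_const_mul] at h1
    linarith
  have := discrim_le_zero h
  unfold discrim at this
  linarith

lemma sq_heat_le {d : ℕ} {f : EuclideanSpace ℝ (Fin d) → ℝ} {M s : ℝ} (hf : Continuous f)
    (hM : ∀ z, |f z| ≤ M) (x : EuclideanSpace ℝ (Fin d)) :
    (heat s f x) ^ 2 ≤ heat s (fun y => f y ^ 2) x := by
  have hi : Integrable (fun z => f (x + √s • z)) (gs d) :=
    integrable_gs_of_bound (by fun_prop) fun z => hM _
  have hi2 : Integrable (fun z => f (x + √s • z) ^ 2) (gs d) :=
    integrable_gs_of_bound (M := M ^ 2) (by fun_prop) fun z => by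
      rw [norm_pow]; exact pow_le_pow_left₀ (norm_nonneg _) (hM _) 2
  have := sq_integral_mul_le (μ := gs d) (f := fun _ => (1 : ℝ)) (g := fun z => f (x + √s • z))
    (by simp) hi2 (by simpa using hi)
  simpa [heat] using this

/-- Twice continuously differentiable functions bounded by `M` with their derivatives. -/
structure CB2 (d : ℕ) (u : EuclideanSpace ℝ (Fin d) → ℝ) (M : ℝ) : Prop where
  contDiff : ContDiff ℝ 2 u
  le : ∀ x, |u x| ≤ M
  fderiv_le : ∀ x, ‖fderiv ℝ u x‖ ≤ M
  fderiv2_le : ∀ x, ‖fderiv ℝ (fderiv ℝ u) x‖ ≤ M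

namespace CB2

variable {d : ℕ} {u : EuclideanSpace ℝ (Fin d) → ℝ} {M : ℝ}

lemma nonneg (h : CB2 d u M) : 0 ≤ M := (abs_nonneg _).trans (h.le 0)

lemma continuous (h : CB2 d u M) : Continuous u := h.contDiff.continuous

lemma contDiff_fderiv (h : CB2 d u M) : ContDiff ℝ 1 (fderiv ℝ u) :=
  h.contDiff.fderiv_right (by norm_num)

lemma continuous_fderiv (h : CB2 d u M) : Continuous (fderiv ℝ u) := h.contDiff_fderiv.continuous

lemma continuous_fderiv2 (h : CB2 d u M) : Continuous (fderiv ℝ (fderiv ℝ u)) :=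
  h.contDiff_fderiv.continuous_fderiv (by norm_num)

lemma hasFDerivAt (h : CB2 d u M) (x) : HasFDerivAt u (fderiv ℝ u x) x :=
  (h.contDiff.differentiable (by norm_num) x).hasFDerivAt

lemma hasFDerivAt_fderiv (h : CB2 d u M) (x) :
    HasFDerivAt (fderiv ℝ u) (fderiv ℝ (fderiv ℝ u) x) x :=
  (h.contDiff_fderiv.differentiable (by norm_num) x).hasFDerivAt

lemma hasFDerivAt_pd1 (h : CB2 d u M) (x) (i : Fin d) :
    HasFDerivAt (fun y => pd1 d u y i)
      ((fderiv ℝ (fderiv ℝ u) x).flip (EuclideanSpace.single i 1)) x := by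
  have := (h.hasFDerivAt_fderiv x).clm_apply
    (hasFDerivAt_const (EuclideanSpace.single i (1 : ℝ)) x)
  refine this.congr_fderiv ?_
  ext v; simp

lemma pd2_eq (h : CB2 d u M) (x) (i j : Fin d) : pd2 d u x i j =
    fderiv ℝ (fderiv ℝ u) x (EuclideanSpace.single i 1) (EuclideanSpace.single j 1) := by
  have := (h.hasFDerivAt_pd1 x j).fderiv
  unfold pd2
  unfold pd1 at this
  rw [this]; rfl

lemma pd2_symm (h : CB2 d u M) (x) (i j : Fin d) : pd2 d u x i j = pd2 d u x j i := by
  rw [h.pd2_eq, h.pd2_eq]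
  exact second_derivative_symmetric (fun y => h.hasFDerivAt y) (h.hasFDerivAt_fderiv x) _ _

lemma continuous_pd1 (h : CB2 d u M) (i : Fin d) : Continuous (fun x => pd1 d u x i) :=
  h.continuous_fderiv.clm_apply continuous_const

lemma continuous_pd2 (h : CB2 d u M) (i j : Fin d) : Continuous (fun x => pd2 d u x i j) := by
  simp_rw [h.pd2_eq]
  exact (h.continuous_fderiv2.clm_apply continuous_const).clm_apply continuous_const

lemma pd1_le (h : CB2 d u M) (x) (i : Fin d) : |pd1 d u x i| ≤ M := by
  have := (fderiv ℝ u x).le_opNorm (EuclideanSpace.single i 1)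
  simp only [PiLp.norm_single, norm_one, mul_one] at this
  exact this.trans (h.fderiv_le x)

lemma pd2_le (h : CB2 d u M) (x) (i j : Fin d) : |pd2 d u x i j| ≤ M := by
  rw [h.pd2_eq]
  have h1 := (fderiv ℝ (fderiv ℝ u) x).le_opNorm₂ (EuclideanSpace.single i 1)
    (EuclideanSpace.single j 1)
  simp only [PiLp.norm_single, norm_one, mul_one] at h1
  exact h1.trans (h.fderiv2_le x)

lemma of_hasFDerivAt {u' : EuclideanSpace ℝ (Fin d) → EuclideanSpace ℝ (Fin d) →L[ℝ] ℝ}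
    {u'' : EuclideanSpace ℝ (Fin d) →
      EuclideanSpace ℝ (Fin d) →L[ℝ] EuclideanSpace ℝ (Fin d) →L[ℝ] ℝ}
    (h1 : ∀ x, HasFDerivAt u (u' x) x) (h2 : ∀ x, HasFDerivAt u' (u'' x) x)
    (hc : Continuous u'') (b0 : ∀ x, |u x| ≤ M) (b1 : ∀ x, ‖u' x‖ ≤ M)
    (b2 : ∀ x, ‖u'' x‖ ≤ M) : CB2 d u M := by
  have e1 : fderiv ℝ u = u' := funext fun x => (h1 x).fderiv
  have e2 : fderiv ℝ u' = u'' := funext fun x => (h2 x).fderiv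
  have c1 : ContDiff ℝ 1 u' := contDiff_one_iff_fderiv.2 ⟨fun x => (h2 x).differentiableAt, e2 ▸ hc⟩
  refine ⟨?_, b0, by rwa [e1], by rwa [e1, e2]⟩
  rw [show (2 : WithTop ℕ∞) = 1 + 1 by norm_num, contDiff_succ_iff_fderiv]
  exact ⟨fun x => (h1 x).differentiableAt, by simp, e1 ▸ c1⟩

lemma heat (h : CB2 d u M) (s : ℝ) : CB2 d (heat s u) M :=
  of_hasFDerivAt (u' := _root_.heat s (fderiv ℝ u)) (u'' := _root_.heat s (fderiv ℝ (fderiv ℝ u)))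
    (fun x => heat_hasFDerivAt h.hasFDerivAt h.continuous_fderiv h.le h.fderiv_le x)
    (fun x => heat_hasFDerivAt h.hasFDerivAt_fderiv h.continuous_fderiv2 h.fderiv_le h.fderiv2_le x)
    (heat_continuous h.continuous_fderiv2 h.fderiv2_le) (heat_norm_le (V := ℝ) h.le)
    (heat_norm_le h.fderiv_le) (heat_norm_le h.fderiv2_le)

lemma fderiv_heat (h : CB2 d u M) (s : ℝ) :
    fderiv ℝ (_root_.heat s u) = _root_.heat s (fderiv ℝ u) :=
  funext fun x =>
    (heat_hasFDerivAt h.hasFDerivAt h.continuous_fderiv h.le h.fderiv_le x).fderiv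

lemma pd1_heat (h : CB2 d u M) (s : ℝ) (x) (i : Fin d) :
    pd1 d (_root_.heat s u) x i = _root_.heat s (fun y => pd1 d u y i) x := by
  unfold pd1
  rw [h.fderiv_heat]
  unfold _root_.heat
  rw [ContinuousLinearMap.integral_apply]
  exact integrable_gs_of_bound (by have := h.continuous_fderiv; fun_prop) fun _ => h.fderiv_le _

lemma pd2_heat (h : CB2 d u M) (s : ℝ) (x) (i j : Fin d) :
    pd2 d (_root_.heat s u) x i j = _root_.heat s (fun y => pd2 d u y i j) x := by
  have hc := h.continuous_fderiv2
  rw [(h.heat s).pd2_eq, h.fderiv_heat,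
    (heat_hasFDerivAt h.hasFDerivAt_fderiv hc h.fderiv_le h.fderiv2_le x).fderiv]
  simp_rw [h.pd2_eq]
  unfold _root_.heat
  rw [ContinuousLinearMap.integral_apply, ContinuousLinearMap.integral_apply]
  · refine integrable_gs_of_bound (by fun_prop) (M := M) fun z => ?_
    refine ((fderiv ℝ (fderiv ℝ u) (x + √s • z)).le_opNorm _).trans ?_
    simp only [PiLp.norm_single, norm_one, mul_one]
    exact h.fderiv2_le _
  · exact integrable_gs_of_bound (by fun_prop) fun _ => h.fderiv2_le _

end CB2

/-- The Laplacian. -/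
def lap (d : ℕ) (u : EuclideanSpace ℝ (Fin d) → ℝ) (x : EuclideanSpace ℝ (Fin d)) : ℝ :=
  ∑ i, pd2 d u x i i

lemma abs_apply_le_norm {d : ℕ} (z : EuclideanSpace ℝ (Fin d)) (i : Fin d) : |z i| ≤ ‖z‖ :=
  PiLp.norm_apply_le z i

lemma integral_gs_coord_mul {d : ℕ} {f : EuclideanSpace ℝ (Fin d) → ℝ}
    {f' : EuclideanSpace ℝ (Fin d) → EuclideanSpace ℝ (Fin d) →L[ℝ] ℝ}
    (hf : ∀ y, HasFDerivAt f (f' y) y) (hc : Continuous f') {M : ℝ} (hM : ∀ z, ‖f z‖ ≤ M)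
    (hM' : ∀ z, ‖f' z‖ ≤ M) (x : EuclideanSpace ℝ (Fin d)) (s : ℝ) (i : Fin d) :
    ∫ z, z i * f (x + √s • z) ∂(gs d) =
      √s * ∫ z, f' (x + √s • z) (EuclideanSpace.single i 1) ∂(gs d) := by
  have hfc : Continuous f := continuous_iff_continuousAt.2 fun y => (hf y).continuousAt
  have hM0 : 0 ≤ M := (norm_nonneg _).trans (hM 0)
  have := stein (f := fun z => f (x + √s • z)) (f' := fun z => √s • f' (x + √s • z))
    (fun z => by
      have h1 : HasFDerivAt (fun z : EuclideanSpace ℝ (Fin d) => x + √s • z)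
        (√s • ContinuousLinearMap.id ℝ _) z := ((hasFDerivAt_id z).const_smul √s).const_add x
      refine ((hf (x + √s • z)).comp z h1).congr_fderiv ?_
      ext v; simp) i
    (integrable_gs_of_bound (by fun_prop) fun _ => hM _)
    (integrable_gs_of_poly (C := M) (n := 1) (by fun_prop) fun z => by
      rw [norm_mul, mul_comm]
      have := abs_apply_le_norm z i
      exact mul_le_mul (hM _) (by rw [pow_one, Real.norm_eq_abs]; linarith) (norm_nonneg _) hM0)
    (integrable_gs_of_bound (M := √s * M) (by fun_prop) fun z => by
      rw [_root_.smul_apply, norm_smul, Real.norm_eq_abs,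
        abs_of_nonneg (Real.sqrt_nonneg s)]
      refine mul_le_mul_of_nonneg_left ?_ (Real.sqrt_nonneg s)
      refine ((f' _).le_opNorm _).trans ?_
      simpa using hM' _)
  rw [← this, ← integral_const_mul]
  rfl

namespace CB2

variable {d : ℕ} {u : EuclideanSpace ℝ (Fin d) → ℝ} {M : ℝ}

lemma heat_pd1 (h : CB2 d u M) {s : ℝ} (hs : 0 < s) (x) (i : Fin d) :
    _root_.heat s (fun y => pd1 d u y i) x = (√s)⁻¹ * ∫ z, z i * u (x + √s • z) ∂(gs d) := by
  rw [integral_gs_coord_mul h.hasFDerivAt h.continuous_fderiv h.le h.fderiv_le,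
    inv_mul_cancel_left₀ (Real.sqrt_pos.2 hs).ne']
  rfl

lemma heat_pd2 (h : CB2 d u M) {s : ℝ} (hs : 0 < s) (x) (i j : Fin d) :
    _root_.heat s (fun y => pd2 d u y i j) x =
      s⁻¹ * ∫ z, (z i * z j - if i = j then 1 else 0) * u (x + √s • z) ∂(gs d) := by
  have hM0 := h.nonneg
  have hsq := Real.sqrt_pos.2 hs
  have hcu := h.continuous
  have hc1 := h.continuous_pd1 j
  have hc2 := h.continuous_fderiv
  have e1 := integral_gs_coord_mul (h.hasFDerivAt_pd1 · j)
    (f' := fun x => (fderiv ℝ (fderiv ℝ u) x).flip (EuclideanSpace.single j 1))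
    (by
      have := h.continuous_fderiv2
      exact ((ContinuousLinearMap.flipₗᵢ ℝ _ _ _).continuous.comp this).clm_apply continuous_const)
    (M := M) (h.pd1_le · j) (fun z => by
      refine ((fderiv ℝ (fderiv ℝ u) z).flip.le_opNorm _).trans ?_
      simpa [ContinuousLinearMap.opNorm_flip] using h.fderiv2_le z) x s i
  simp only [ContinuousLinearMap.flip_apply, ← h.pd2_eq] at e1
  have hder : ∀ z : EuclideanSpace ℝ (Fin d), HasFDerivAt (fun z : EuclideanSpace ℝ (Fin d) =>
      z i * u (x + √s • z)) (z i • (√s • fderiv ℝ u (x + √s • z)) +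
        u (x + √s • z) • EuclideanSpace.proj i) z := fun z => by
    have h1 : HasFDerivAt (fun z : EuclideanSpace ℝ (Fin d) => x + √s • z)
        (√s • ContinuousLinearMap.id ℝ _) z := ((hasFDerivAt_id z).const_smul √s).const_add x
    have h2 : HasFDerivAt (fun z : EuclideanSpace ℝ (Fin d) => z i)
      (EuclideanSpace.proj i : EuclideanSpace ℝ (Fin d) →L[ℝ] ℝ) z :=
        (EuclideanSpace.proj i : EuclideanSpace ℝ (Fin d) →L[ℝ] ℝ).hasFDerivAt
    refine (h2.mul ((h.hasFDerivAt (x + √s • z)).comp z h1)).congr_fderiv ?_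
    ext v; simp
  have hz1 : Integrable (fun z => z i * u (x + √s • z)) (gs d) :=
    integrable_gs_of_poly (C := M) (n := 1) (by fun_prop) fun z => by
      rw [norm_mul, mul_comm]
      have := abs_apply_le_norm z i
      exact mul_le_mul (h.le _) (by rw [pow_one, Real.norm_eq_abs]; linarith) (norm_nonneg _) hM0
  have hz2 : Integrable (fun z => z i * pd1 d u (x + √s • z) j) (gs d) :=
    integrable_gs_of_poly (C := M) (n := 1) (by fun_prop) fun z => by
      rw [norm_mul, mul_comm]
      have := abs_apply_le_norm z i
      exact mul_le_mul (h.pd1_le _ _) (by rw [pow_one, Real.norm_eq_abs]; linarith)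
        (norm_nonneg _) hM0
  have hz0 : Integrable (fun z => u (x + √s • z)) (gs d) :=
    integrable_gs_of_bound (by fun_prop) fun _ => h.le _
  have hz3 : Integrable (fun z => z j * (z i * u (x + √s • z))) (gs d) :=
    integrable_gs_of_poly (C := M) (n := 2) (by fun_prop) fun z => by
      rw [norm_mul, norm_mul, ← mul_assoc, mul_comm, pow_two]
      have h1 := abs_apply_le_norm z i
      have h2 := abs_apply_le_norm z j
      refine mul_le_mul (h.le _) (mul_le_mul ?_ ?_ (norm_nonneg _) (by positivity)) ?_ hM0
      · rw [Real.norm_eq_abs]; linarith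
      · rw [Real.norm_eq_abs]; linarith
      · positivity
  have hval : ∀ z : EuclideanSpace ℝ (Fin d), (z i • (√s • fderiv ℝ u (x + √s • z)) +
        u (x + √s • z) • (EuclideanSpace.proj i : EuclideanSpace ℝ (Fin d) →L[ℝ] ℝ))
          (EuclideanSpace.single j 1) =
        √s * (z i * pd1 d u (x + √s • z) j) + (if i = j then 1 else 0) * u (x + √s • z) := by
    intro z
    simp [pd1, PiLp.single_apply]
    ring
  have e2 := stein hder j hz1 hz3 (by
    simp_rw [hval]
    exact (hz2.const_mul _).add (hz0.const_mul _))
  simp_rw [hval] at e2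
  rw [integral_add (hz2.const_mul _) (hz0.const_mul _), integral_const_mul, e1, ← mul_assoc,
    Real.mul_self_sqrt hs.le] at e2
  have e3 : ∫ z, (z i * z j - if i = j then 1 else 0) * u (x + √s • z) ∂(gs d) =
      ∫ z, z j * (z i * u (x + √s • z)) ∂(gs d) -
        ∫ z, (if i = j then 1 else 0) * u (x + √s • z) ∂(gs d) := by
    rw [← integral_sub hz3 (hz0.const_mul _)]
    congr 1; ext z; ring
  rw [e3, ← e2, add_sub_cancel_right, inv_mul_cancel_left₀ hs.ne']
  rfl

lemma continuous_lap (h : CB2 d u M) : Continuous (lap d u) :=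
  continuous_finsetSum _ fun i _ => h.continuous_pd2 i i

lemma abs_lap_le (h : CB2 d u M) (x) : |lap d u x| ≤ d * M := by
  refine (Finset.abs_sum_le_sum_abs _ _).trans ?_
  refine (Finset.sum_le_sum fun i _ => h.pd2_le x i i).trans ?_
  simp

lemma heat_lap (h : CB2 d u M) (s : ℝ) (x) :
    lap d (_root_.heat s u) x = _root_.heat s (lap d u) x := by
  unfold lap _root_.heat
  rw [integral_finsetSum]
  · exact Finset.sum_congr rfl fun i _ => h.pd2_heat s x i i
  · intro i _
    have := h.continuous_pd2 i i
    exact integrable_gs_of_bound (by fun_prop) fun _ => h.pd2_le _ _ _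

/-- The heat equation. -/
lemma hasDerivAt_heat (h : CB2 d u M) {s : ℝ} (hs : 0 < s) (x) :
    HasDerivAt (fun s => _root_.heat s u x) (1 / 2 * _root_.heat s (lap d u) x) s := by
  have hM0 := h.nonneg
  have hcu := h.continuous
  have hc1 := h.continuous_fderiv
  have hsq := Real.sqrt_pos.2 hs
  have key := (hasDerivAt_integral_of_dominated_loc_of_deriv_le (μ := gs d)
    (F := fun s z => u (x + √s • z))
    (F' := fun s z => 1 / (2 * √s) * fderiv ℝ u (x + √s • z) z) (x₀ := s) (s := Set.Ioi (s / 2))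
    (bound := fun z => 1 / (2 * √(s / 2)) * (M * ‖z‖)) (Ioi_mem_nhds (by linarith))
    (Filter.Eventually.of_forall fun y => by fun_prop)
    (integrable_gs_of_bound (by fun_prop) fun _ => h.le _) (by fun_prop)
    (Filter.Eventually.of_forall fun z t ht => by
      rw [norm_mul]
      refine mul_le_mul ?_ ?_ (norm_nonneg _) (by positivity)
      · rw [Real.norm_eq_abs, abs_of_nonneg (by positivity)]
        have : 0 < √(s / 2) := Real.sqrt_pos.2 (by linarith)
        have := Real.sqrt_le_sqrt (le_of_lt ht)
        gcongr
      · exact ((fderiv ℝ u _).le_opNorm z).trans (by have := h.fderiv_le (x + √t • z); gcongr))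
    (by simpa using ((integrable_gs_norm_pow d 1).const_mul M).const_mul (1 / (2 * √(s / 2))))
    (Filter.Eventually.of_forall fun z t ht => by
      have ht0 : t ≠ 0 := by have : s / 2 < t := ht; linarith
      have h1 : HasDerivAt (fun t : ℝ => x + √t • z) ((1 / (2 * √t)) • z) t :=
        ((Real.hasDerivAt_sqrt ht0).smul_const z).const_add x
      have := (h.hasFDerivAt (x + √t • z)).comp_hasDerivAt t h1
      simpa [Function.comp_def] using this)).2
  refine key.congr_deriv ?_
  rw [integral_const_mul]
  have hexp : ∀ z : EuclideanSpace ℝ (Fin d), fderiv ℝ u (x + √s • z) z =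
      ∑ i, z i * pd1 d u (x + √s • z) i := by
    intro z
    have := congrArg (fderiv ℝ u (x + √s • z)) ((EuclideanSpace.basisFun (Fin d) ℝ).sum_repr z)
    rw [← this, map_sum]
    simp [pd1]
  have hi : ∀ i ∈ Finset.univ, Integrable (fun z : EuclideanSpace ℝ (Fin d) =>
      z i * pd1 d u (x + √s • z) i) (gs d) := fun i _ =>
    integrable_gs_of_poly (C := M) (n := 1) (by have := h.continuous_pd1 i; fun_prop) fun z => by
      rw [norm_mul, mul_comm]
      have := abs_apply_le_norm z i
      exact mul_le_mul (h.pd1_le _ _) (by rw [pow_one, Real.norm_eq_abs]; linarith)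
        (norm_nonneg _) hM0
  simp_rw [hexp]
  rw [integral_finsetSum _ hi, ← h.heat_lap, lap, Finset.mul_sum, Finset.mul_sum]
  refine Finset.sum_congr rfl fun i _ => ?_
  have e1 := integral_gs_coord_mul (h.hasFDerivAt_pd1 · i)
    (f' := fun x => (fderiv ℝ (fderiv ℝ u) x).flip (EuclideanSpace.single i 1))
    (by
      have := h.continuous_fderiv2
      exact ((ContinuousLinearMap.flipₗᵢ ℝ _ _ _).continuous.comp this).clm_apply continuous_const)
    (M := M) (h.pd1_le · i) (fun z => by
      refine ((fderiv ℝ (fderiv ℝ u) z).flip.le_opNorm _).trans ?_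
      simpa [ContinuousLinearMap.opNorm_flip] using h.fderiv2_le z) x s i
  simp only [ContinuousLinearMap.flip_apply, ← h.pd2_eq] at e1
  rw [e1, h.pd2_heat, _root_.heat]
  field_simp

end CB2

/-- The residual of the equation `u - Δu / 2 = f`. -/
def res (d : ℕ) (u : EuclideanSpace ℝ (Fin d) → ℝ) (x : EuclideanSpace ℝ (Fin d)) : ℝ :=
  u x - 1 / 2 * lap d u x

namespace CB2

variable {d : ℕ} {u : EuclideanSpace ℝ (Fin d) → ℝ} {M : ℝ}

lemma continuous_res (h : CB2 d u M) : Continuous (res d u) :=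
  h.continuous.sub (continuous_const.mul h.continuous_lap)

lemma abs_res_le (h : CB2 d u M) (x) : |res d u x| ≤ (1 + d) * M := by
  have h1 := abs_le.1 (h.le x)
  have h2 := abs_le.1 (h.abs_lap_le x)
  have h3 : 0 ≤ d * M := mul_nonneg (Nat.cast_nonneg d) h.nonneg
  unfold res
  exact abs_le.2 ⟨by linarith, by linarith⟩

lemma heat_res (h : CB2 d u M) (s : ℝ) (x) :
    res d (_root_.heat s u) x = _root_.heat s (res d u) x := by
  have hc := h.continuous
  have hl := h.continuous_lap
  rw [res, h.heat_lap]
  unfold _root_.heat res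
  rw [integral_sub (integrable_gs_of_bound (by fun_prop) fun _ => h.le _)
    ((integrable_gs_of_bound (by fun_prop) fun _ => h.abs_lap_le _).const_mul _),
    integral_const_mul]

lemma hasDerivAt_exp_heat (h : CB2 d u M) {b r : ℝ} (hb : 0 < b + r) (x) :
    HasDerivAt (fun r => Real.exp (-r) * _root_.heat (b + r) u x)
      (-(Real.exp (-r) * _root_.heat (b + r) (res d u) x)) r := by
  have h1 : HasDerivAt (fun r => _root_.heat (b + r) u x)
      (1 / 2 * _root_.heat (b + r) (lap d u) x) r := by
    simpa using (h.hasDerivAt_heat hb x).comp_const_add b r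
  have h2 : HasDerivAt (fun r : ℝ => Real.exp (-r)) (-Real.exp (-r)) r := by
    simpa using (hasDerivAt_neg r).exp
  refine (h2.mul h1).congr_deriv ?_
  rw [← h.heat_res, res, h.heat_lap]
  ring

/-- Weighted averages of the heat flow change in time at a rate given by the residual. -/
lemma weight_heat_sub_le (h : CB2 d u M) {w : EuclideanSpace ℝ (Fin d) → ℝ} (hw : Continuous w)
    {c W : ℝ} {n : ℕ} (hwb : ∀ z, |w z| ≤ c * (1 + ‖z‖) ^ n) (hW0 : 0 ≤ W)
    (hW : ∫ z, w z ^ 2 ∂(gs d) ≤ W ^ 2) {a b r K : ℝ} (ha : 0 ≤ a) (hb : 0 < b) (hr : 0 ≤ r)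
    (hK0 : 0 ≤ K) (x : EuclideanSpace ℝ (Fin d))
    (hK : ∀ r', 0 ≤ r' → r' ≤ r → _root_.heat (a + b + r') (fun y => res d u y ^ 2) x ≤ K ^ 2) :
    |∫ z, w z * _root_.heat b u (x + √a • z) ∂(gs d) -
      Real.exp (-r) * ∫ z, w z * _root_.heat (b + r) u (x + √a • z) ∂(gs d)| ≤ W * K * r := by
  set R := (1 + d) * M with hR
  have hR0 : 0 ≤ R := mul_nonneg (by positivity) h.nonneg
  have hRc := h.continuous_res
  have hRb : ∀ z, ‖res d u z‖ ≤ R := h.abs_res_le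
  have hwi : Integrable w (gs d) := integrable_gs_of_poly (by fun_prop) hwb
  have hwi2 : Integrable (fun z => w z ^ 2) (gs d) :=
    integrable_gs_of_poly (C := c ^ 2) (n := n * 2) (by fun_prop) fun z => by
      rw [norm_pow, pow_mul, ← mul_pow]
      exact pow_le_pow_left₀ (norm_nonneg _) (hwb z) 2
  have hcu : ∀ t, Continuous (_root_.heat t u) := fun t => (h.heat t).continuous
  have hcR : ∀ t, Continuous (_root_.heat t (res d u)) := fun t => heat_continuous hRc hRb
  have hder : ∀ t, 0 ≤ t → HasDerivAt
      (fun r => ∫ z, w z * (Real.exp (-r) * _root_.heat (b + r) u (x + √a • z)) ∂(gs d))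
      (∫ z, w z * -(Real.exp (-t) * _root_.heat (b + t) (res d u) (x + √a • z)) ∂(gs d)) t := by
    intro t ht
    refine (hasDerivAt_integral_of_dominated_loc_of_deriv_le (s := Set.Ioi (-b))
      (F := fun r z => w z * (Real.exp (-r) * _root_.heat (b + r) u (x + √a • z)))
      (F' := fun t z => w z * -(Real.exp (-t) * _root_.heat (b + t) (res d u) (x + √a • z)))
      (bound := fun z => |w z| * (Real.exp b * R)) (Ioi_mem_nhds (by linarith))
      (Filter.Eventually.of_forall fun y => by have := hcu (b + y); fun_prop) ?_
      (by have := hcR (b + t); fun_prop)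
      (Filter.Eventually.of_forall fun z y hy => ?_) (hwi.abs.mul_const _)
      (Filter.Eventually.of_forall fun z y hy => ?_)).2
    · refine hwi.mul_bdd (c := Real.exp (-t) * M) (by have := hcu (b + t); fun_prop)
        (Filter.Eventually.of_forall fun z => ?_)
      rw [norm_mul, Real.norm_eq_abs, Real.abs_exp]
      exact mul_le_mul_of_nonneg_left ((h.heat _).le _) (Real.exp_pos _).le
    · rw [norm_mul, norm_neg, norm_mul, Real.norm_eq_abs, Real.norm_eq_abs, Real.abs_exp]
      have h1 : Real.exp (-y) ≤ Real.exp b := Real.exp_le_exp.2 (by have : -b < y := hy; linarith)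
      have h2 := heat_norm_le (s := b + y) hRb (x + √a • z)
      gcongr
    · exact (h.hasDerivAt_exp_heat (by have : -b < y := hy; linarith) _).const_mul _
  have hbound : ∀ t, 0 ≤ t → t ≤ r →
      |∫ z, w z * -(Real.exp (-t) * _root_.heat (b + t) (res d u) (x + √a • z)) ∂(gs d)| ≤
        W * K := by
    intro t ht htr
    have hg : Continuous (fun z => _root_.heat (b + t) (res d u) (x + √a • z)) := by
      have := hcR (b + t); fun_prop
    have hgb : ∀ z, ‖_root_.heat (b + t) (res d u) (x + √a • z)‖ ≤ R := fun z =>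
      heat_norm_le hRb _
    have hR2 : ∀ z, ‖res d u z ^ 2‖ ≤ R ^ 2 := fun z => by
      rw [norm_pow]; exact pow_le_pow_left₀ (norm_nonneg _) (hRb z) 2
    have e : ∀ z, w z * -(Real.exp (-t) * _root_.heat (b + t) (res d u) (x + √a • z)) =
        (-Real.exp (-t)) * (w z * _root_.heat (b + t) (res d u) (x + √a • z)) := fun z => by ring
    simp_rw [e]
    rw [integral_const_mul, abs_mul, abs_neg, Real.abs_exp]
    have hcs := sq_integral_mul_le (μ := gs d) hwi2
      (integrable_gs_of_bound (M := R ^ 2) (by fun_prop) fun z => by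
        rw [norm_pow]; exact pow_le_pow_left₀ (norm_nonneg _) (hgb z) 2)
      (hwi.mul_bdd (by fun_prop) (Filter.Eventually.of_forall hgb))
    have h2 : ∫ z, _root_.heat (b + t) (res d u) (x + √a • z) ^ 2 ∂(gs d) ≤ K ^ 2 := by
      have h3 : _root_.heat a (fun y => _root_.heat (b + t) (res d u) y ^ 2) x ≤
          _root_.heat a (_root_.heat (b + t) (fun y => res d u y ^ 2)) x := by
        refine heat_mono (M := R ^ 2) (by have := hcR (b + t); fun_prop)
          (heat_continuous (by fun_prop) hR2) (fun z => ?_) (fun z => heat_norm_le hR2 z)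
          (fun z => sq_heat_le hRc hRb z) x
        rw [norm_pow]; exact pow_le_pow_left₀ (norm_nonneg _) (heat_norm_le hRb z) 2
      rw [heat_heat (by fun_prop) hR2 ha (by linarith), ← add_assoc] at h3
      exact h3.trans (hK t ht htr)
    have h4 : |∫ z, w z * _root_.heat (b + t) (res d u) (x + √a • z) ∂(gs d)| ≤ W * K := by
      refine abs_le_of_sq_le_sq ?_ (by positivity)
      rw [mul_pow]
      refine hcs.trans (mul_le_mul hW h2 (integral_nonneg fun z => sq_nonneg _) (by positivity))
    have h5 : Real.exp (-t) ≤ 1 := Real.exp_le_one_iff.2 (by linarith)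
    calc _ ≤ 1 * (W * K) := mul_le_mul h5 h4 (abs_nonneg _) zero_le_one
      _ = _ := one_mul _
  have := norm_image_sub_le_of_norm_deriv_le_segment' (a := 0) (b := r)
    (fun t ht => (hder t ht.1).hasDerivWithinAt) (fun t ht => hbound t ht.1 ht.2.le) r
    ⟨hr, le_rfl⟩
  rw [Real.norm_eq_abs, abs_sub_comm, sub_zero] at this
  convert this using 2
  congr 1
  · simp
  · rw [← integral_const_mul]
    congr 1; ext z; ring

end CB2

lemma le_of_contraction {ι : Type*} {φ : ι → ℝ} {B K : ℝ} (hB : ∀ i, φ i ≤ B)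
    (h : ∀ i, ∃ j, φ i ≤ 6 / 7 * φ j + K) (i : ι) : φ i ≤ 7 * K := by
  have : Nonempty ι := ⟨i⟩
  have hbdd : BddAbove (Set.range φ) := ⟨B, by rintro _ ⟨j, rfl⟩; exact hB j⟩
  have h1 : ⨆ i, φ i ≤ 6 / 7 * (⨆ i, φ i) + K := ciSup_le fun i => by
    obtain ⟨j, hj⟩ := h i
    have := le_ciSup hbdd j
    linarith
  have := le_ciSup hbdd i
  linarith

lemma sqrt_sqrt_two_mul (s : ℝ) : 7 / 6 * √√s ≤ √√(2 * s) := by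
  have h2 : (7 / 6 : ℝ) ≤ √√2 := by
    refine Real.le_sqrt_of_sq_le (Real.le_sqrt_of_sq_le ?_)
    norm_num
  rw [Real.sqrt_mul (by norm_num), Real.sqrt_mul (by positivity)]
  exact mul_le_mul_of_nonneg_right h2 (by positivity)

lemma sqrt_sqrt_pos {s : ℝ} (hs : 0 < s) : 0 < √√s := Real.sqrt_pos.2 (Real.sqrt_pos.2 hs)

lemma sqrt_sqrt_pow {s : ℝ} (hs : 0 ≤ s) : √√s ^ 4 = s := by
  rw [show (4 : ℕ) = 2 * 2 by norm_num, pow_mul, Real.sq_sqrt (Real.sqrt_nonneg s), Real.sq_sqrt hs]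

lemma sqrt_sqrt_le_exp {s : ℝ} (hs : 0 ≤ s) : √√s ≤ Real.exp s := by
  have h1 := sqrt_sqrt_pow hs
  have h2 : √√s ≤ 1 + s := by
    nlinarith [sq_nonneg (√√s ^ 2 - 1 / 2), sq_nonneg (√√s - 1 / 2)]
  have := Real.add_one_le_exp s
  linarith

lemma abs_le_of_doubling {A : ℝ → ℝ} {B K : ℝ} (hB : ∀ s, 0 < s → |A s| ≤ B)
    (h : ∀ s, 0 < s → |A s - Real.exp (-s) * A (2 * s)| ≤ K * (√√s)⁻¹ * Real.exp s)
    {s : ℝ} (hs : 0 < s) : |A s| ≤ 7 * K * (√√s)⁻¹ * Real.exp s := by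
  have := le_of_contraction (ι := Set.Ioi (0 : ℝ))
    (φ := fun s => √√(s : ℝ) * Real.exp (-(s : ℝ)) * |A s|) (B := B) (K := K) (fun s => ?_)
    (fun s => ⟨⟨2 * s, by have : (0 : ℝ) < s := s.2; simp [this]⟩, ?_⟩) ⟨s, hs⟩
  · have hq := sqrt_sqrt_pos hs
    simp only at this
    rw [Real.exp_neg, mul_assoc, mul_comm] at this
    rw [mul_assoc, ← div_eq_inv_mul, ← mul_div_assoc, le_div_iff₀ hq, ← div_le_iff₀ (Real.exp_pos _),
      div_eq_inv_mul, ← mul_assoc]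
    exact this
  · have hs : (0 : ℝ) < s := s.2
    have h1 : √√(s : ℝ) * Real.exp (-(s : ℝ)) ≤ 1 := by
      rw [Real.exp_neg, ← div_eq_mul_inv, div_le_one (Real.exp_pos _)]
      exact sqrt_sqrt_le_exp hs.le
    calc _ ≤ 1 * |A s| := mul_le_mul_of_nonneg_right h1 (abs_nonneg _)
      _ ≤ _ := by rw [one_mul]; exact hB s hs
  · have hs : (0 : ℝ) < s := s.2
    have hq := sqrt_sqrt_pos hs
    have h1 := h s hs
    have h2 : |A s| ≤ Real.exp (-(s : ℝ)) * |A (2 * s)| + K * (√√(s : ℝ))⁻¹ * Real.exp s := by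
      have := abs_sub_abs_le_abs_sub (A s) (Real.exp (-(s : ℝ)) * A (2 * s))
      rw [abs_mul, Real.abs_exp] at this
      linarith
    have h3 := sqrt_sqrt_two_mul (s : ℝ)
    have h4 : Real.exp (-(2 * s : ℝ)) = Real.exp (-(s : ℝ)) * Real.exp (-(s : ℝ)) := by
      rw [← Real.exp_add]; congr 1; ring
    simp only
    rw [h4]
    calc √√(s : ℝ) * Real.exp (-(s : ℝ)) * |A s|
        ≤ √√(s : ℝ) * Real.exp (-(s : ℝ)) *
          (Real.exp (-(s : ℝ)) * |A (2 * s)| + K * (√√(s : ℝ))⁻¹ * Real.exp s) :=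
          mul_le_mul_of_nonneg_left h2 (by positivity)
      _ = √√(s : ℝ) * (Real.exp (-(s : ℝ)) * Real.exp (-(s : ℝ)) * |A (2 * s)|) +
          K * (√√(s : ℝ) * (√√(s : ℝ))⁻¹) * (Real.exp (-(s : ℝ)) * Real.exp s) := by ring
      _ ≤ (6 / 7 * √√(2 * s : ℝ)) * (Real.exp (-(s : ℝ)) * Real.exp (-(s : ℝ)) * |A (2 * s)|) +
          K * (√√(s : ℝ) * (√√(s : ℝ))⁻¹) * (Real.exp (-(s : ℝ)) * Real.exp s) := by
          gcongr; linarith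
      _ = _ := by
          rw [mul_inv_cancel₀ hq.ne', ← Real.exp_add (-(s : ℝ)) s, neg_add_cancel, Real.exp_zero]; ring

lemma abs_sub_le_of_doubling {A : ℝ → ℝ} {B K : ℝ} (hB : ∀ s, 0 ≤ s → |A s| ≤ B) (hK : 0 ≤ K)
    (hB' : ∀ s, 0 ≤ s → |A 0 - A s| ≤ B * √s)
    (h : ∀ s, 0 < s → s ≤ 1 → |A s - Real.exp (-s) * A (2 * s)| ≤ K * √√s)
    {s : ℝ} (hs : 0 < s) (hs1 : s ≤ 1) : |A 0 - Real.exp (-s) * A s| ≤ 7 * K * √√s := by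
  have hB0 : 0 ≤ B := (abs_nonneg _).trans (hB 0 le_rfl)
  have := le_of_contraction (ι := Set.Ioc (0 : ℝ) 1)
    (φ := fun s => |A 0 - Real.exp (-(s : ℝ)) * A s| / √√(s : ℝ)) (B := 2 * B) (K := K)
    (fun s => ?_) (fun s => ⟨⟨s / 2, by have := s.2.1; constructor <;> linarith [s.2.2]⟩, ?_⟩)
    ⟨s, hs, hs1⟩
  · rwa [div_le_iff₀ (sqrt_sqrt_pos hs)] at this
  · have hs : (0 : ℝ) < s := s.2.1
    have hq := sqrt_sqrt_pos hs
    have h1 : (√√(s : ℝ)) ≤ 1 := by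
      rw [Real.sqrt_le_one, Real.sqrt_le_one]; exact s.2.2
    have h4 : √(s : ℝ) = √√(s : ℝ) * √√(s : ℝ) := (Real.mul_self_sqrt (Real.sqrt_nonneg _)).symm
    have h5 := sqrt_sqrt_pow hs.le
    have h6 := Real.add_one_le_exp (-(s : ℝ))
    have h7 : Real.exp (-(s : ℝ)) ≤ 1 := Real.exp_le_one_iff.2 (by linarith)
    rw [div_le_iff₀ hq]
    have e : A 0 - Real.exp (-(s : ℝ)) * A s = (A 0 - A s) + (1 - Real.exp (-(s : ℝ))) * A s := by
      ring
    rw [e]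
    refine (abs_add_le _ _).trans ?_
    rw [abs_mul, abs_of_nonneg (by linarith : 0 ≤ 1 - Real.exp (-(s : ℝ)))]
    have h8 := hB' s hs.le
    have h9 : (1 - Real.exp (-(s : ℝ))) * |A s| ≤ s * B :=
      mul_le_mul (by linarith) (hB s hs.le) (abs_nonneg _) hs.le
    have h10 : √(s : ℝ) ≤ √√(s : ℝ) := h4.le.trans (mul_le_of_le_one_left hq.le h1)
    have h11 : (s : ℝ) ≤ √√(s : ℝ) := by
      calc (s : ℝ) = √√(s : ℝ) ^ 4 := h5.symm
        _ ≤ √√(s : ℝ) ^ 1 := pow_le_pow_of_le_one hq.le h1 (by norm_num)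
        _ = _ := pow_one _
    nlinarith
  · have hs : (0 : ℝ) < s / 2 := by linarith [s.2.1]
    have hq := sqrt_sqrt_pos s.2.1
    have hq' := sqrt_sqrt_pos hs
    have h1 := h (s / 2) hs (by linarith [s.2.2])
    rw [mul_div_cancel₀ _ (by norm_num : (2 : ℝ) ≠ 0)] at h1
    have h3 := sqrt_sqrt_two_mul (s / 2 : ℝ)
    rw [mul_div_cancel₀ _ (by norm_num : (2 : ℝ) ≠ 0)] at h3
    have e : A 0 - Real.exp (-(s : ℝ)) * A s = (A 0 - Real.exp (-(s / 2 : ℝ)) * A (s / 2)) +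
        Real.exp (-(s / 2 : ℝ)) * (A (s / 2) - Real.exp (-(s / 2 : ℝ)) * A s) := by
      have : Real.exp (-(s : ℝ)) = Real.exp (-(s / 2 : ℝ)) * Real.exp (-(s / 2 : ℝ)) := by
        rw [← Real.exp_add]; congr 1; ring
      rw [this]; ring
    have h7 : Real.exp (-(s / 2 : ℝ)) ≤ 1 := Real.exp_le_one_iff.2 (by linarith)
    have h8 : Real.exp (-(s / 2 : ℝ)) * |A (s / 2) - Real.exp (-(s / 2 : ℝ)) * A s| ≤
        K * √√(s : ℝ) := by
      calc _ ≤ 1 * (K * √√(s / 2 : ℝ)) := mul_le_mul h7 h1 (abs_nonneg _) zero_le_one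
        _ ≤ 1 * (K * √√(s : ℝ)) := by gcongr; linarith [s.2.1]
        _ = _ := one_mul _
    have h9 : |A 0 - Real.exp (-(s : ℝ)) * A s| ≤
        |A 0 - Real.exp (-(s / 2 : ℝ)) * A (s / 2)| + K * √√(s : ℝ) := by
      rw [e]
      refine (abs_add_le _ _).trans ?_
      rw [abs_mul, Real.abs_exp]
      linarith
    set D := |A 0 - Real.exp (-(s / 2 : ℝ)) * A (s / 2)| with hD
    have hD0 : 0 ≤ D := abs_nonneg _
    simp only
    rw [div_le_iff₀ hq]
    refine h9.trans ?_
    rw [add_mul]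
    gcongr
    have e2 : 6 / 7 * (D / √√(s / 2 : ℝ)) * √√(s : ℝ) = (6 / 7 * D * √√(s : ℝ)) / √√(s / 2 : ℝ) := by
      ring
    rw [e2, le_div_iff₀ hq']
    nlinarith

/-- The constant `(E (1 + |z|)⁴)^{1/2}`. -/
def gaussW (d : ℕ) : ℝ := √(∫ z : EuclideanSpace ℝ (Fin d), (1 + ‖z‖) ^ 4 ∂(gs d))

lemma gaussW_sq (d : ℕ) :
    gaussW d ^ 2 = ∫ z : EuclideanSpace ℝ (Fin d), (1 + ‖z‖) ^ 4 ∂(gs d) :=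
  Real.sq_sqrt (integral_nonneg fun z => by positivity)

lemma gaussW_pos (d : ℕ) : 0 < gaussW d := by
  refine Real.sqrt_pos.2 (lt_of_lt_of_le one_pos ?_)
  have : ∫ _ : EuclideanSpace ℝ (Fin d), (1 : ℝ) ∂(gs d) ≤
      ∫ z : EuclideanSpace ℝ (Fin d), (1 + ‖z‖) ^ 4 ∂(gs d) := by
    refine integral_mono (integrable_const _) (integrable_gs_of_poly (C := 1) (n := 4)
      (by fun_prop) fun z => ?_) fun z => ?_
    · rw [one_mul, norm_pow, Real.norm_eq_abs, abs_of_nonneg (by positivity)]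
    · exact one_le_pow₀ (by linarith [norm_nonneg z])
  simpa using this

/-- Growth condition on the heat flow of the squared residual. -/
def ResBound (d : ℕ) (u : EuclideanSpace ℝ (Fin d) → ℝ) (N : ℝ) : Prop :=
  ∀ x s, 0 < s → heat s (fun y => res d u y ^ 2) x ≤
    N ^ 2 * (1 + ‖x‖ ^ 2) * (√s)⁻¹ * Real.exp (s / 2)

namespace CB2

variable {d : ℕ} {u : EuclideanSpace ℝ (Fin d) → ℝ} {M N : ℝ}

lemma weight_doubling (h : CB2 d u M) (hN : ResBound d u N) (hN0 : 0 ≤ N)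
    {w : EuclideanSpace ℝ (Fin d) → ℝ} (hw : Continuous w) (hwb : ∀ z, |w z| ≤ (1 + ‖z‖) ^ 2)
    (x : EuclideanSpace ℝ (Fin d)) {s : ℝ} (hs : 0 < s) :
    |∫ z, w z * _root_.heat (s / 2) u (x + √(s / 2) • z) ∂(gs d) -
      Real.exp (-s) * ∫ z, w z * _root_.heat (s / 2 + s) u (x + √(s / 2) • z) ∂(gs d)| ≤
      gaussW d * (N * √(1 + ‖x‖ ^ 2) * (√√s)⁻¹ * Real.exp (s / 2)) * s := by
  refine h.weight_heat_sub_le hw (c := 1) (n := 2) (by simpa using hwb) (gaussW_pos d).le ?_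
    (by positivity) (by positivity) hs.le (by positivity) x ?_
  · rw [gaussW_sq]
    refine integral_mono ?_ ?_ fun z => ?_
    · refine integrable_gs_of_poly (C := 1) (n := 4) (by fun_prop) fun z => ?_
      rw [one_mul, norm_pow, show (4 : ℕ) = 2 * 2 by norm_num, pow_mul]
      exact pow_le_pow_left₀ (norm_nonneg _) (hwb z) 2
    · refine integrable_gs_of_poly (C := 1) (n := 4) (by fun_prop) fun z => ?_
      rw [one_mul, norm_pow, Real.norm_eq_abs, abs_of_nonneg (by positivity)]
    · simp only
      rw [show (4 : ℕ) = 2 * 2 by norm_num, pow_mul, ← sq_abs]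
      exact pow_le_pow_left₀ (abs_nonneg _) (hwb z) 2
  · intro r h0 hr
    rw [add_halves]
    refine (hN x (s + r) (by linarith)).trans ?_
    have e : (N * √(1 + ‖x‖ ^ 2) * (√√s)⁻¹ * Real.exp (s / 2)) ^ 2 =
        N ^ 2 * (1 + ‖x‖ ^ 2) * (√s)⁻¹ * Real.exp s := by
      rw [mul_pow, mul_pow, mul_pow, Real.sq_sqrt (by positivity), inv_pow,
        Real.sq_sqrt (by positivity), ← Real.exp_nat_mul]
      congr 2; push_cast; ring
    rw [e]
    have hs' : 0 < √s := Real.sqrt_pos.2 hs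
    have h1 : (√(s + r))⁻¹ ≤ (√s)⁻¹ := inv_anti₀ hs' (Real.sqrt_le_sqrt (by linarith))
    have h2 : Real.exp ((s + r) / 2) ≤ Real.exp s := Real.exp_le_exp.2 (by linarith)
    gcongr

lemma heat_half {f : EuclideanSpace ℝ (Fin d) → ℝ} (hf : Continuous f) (hM : ∀ z, ‖f z‖ ≤ M)
    {s : ℝ} (hs : 0 < s) (x : EuclideanSpace ℝ (Fin d)) :
    _root_.heat (s / 2) (_root_.heat (s / 2) f) x = _root_.heat s f x ∧
    _root_.heat (s / 2) (_root_.heat (s / 2 + s) f) x = _root_.heat (2 * s) f x := by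
  rw [heat_heat hf hM (by positivity) (by positivity),
    heat_heat hf hM (by positivity) (by positivity)]
  constructor
  · congr 1; ring
  · congr 1; ring

lemma doubling0 (h : CB2 d u M) (hN : ResBound d u N) (hN0 : 0 ≤ N)
    (x : EuclideanSpace ℝ (Fin d)) {s : ℝ} (hs : 0 < s) :
    |_root_.heat s u x - Real.exp (-s) * _root_.heat (2 * s) u x| ≤
      gaussW d * (N * √(1 + ‖x‖ ^ 2) * (√√s)⁻¹ * Real.exp (s / 2)) * s := by
  have := h.weight_doubling hN hN0 (w := fun _ => 1) (by fun_prop)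
    (fun z => by rw [abs_one]; exact one_le_pow₀ (by linarith [norm_nonneg z])) x hs
  simp only [one_mul] at this
  obtain ⟨h1, h2⟩ := heat_half h.continuous h.le hs x
  rw [← h1, ← h2]
  exact this

lemma doubling1 (h : CB2 d u M) (hN : ResBound d u N) (hN0 : 0 ≤ N)
    (x : EuclideanSpace ℝ (Fin d)) (i : Fin d) {s : ℝ} (hs : 0 < s) :
    |_root_.heat s (fun y => pd1 d u y i) x -
      Real.exp (-s) * _root_.heat (2 * s) (fun y => pd1 d u y i) x| ≤ (√(s / 2))⁻¹ *
      (gaussW d * (N * √(1 + ‖x‖ ^ 2) * (√√s)⁻¹ * Real.exp (s / 2)) * s) := by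
  have := h.weight_doubling hN hN0 (w := fun z => z i) (by fun_prop)
    (fun z => by nlinarith [abs_apply_le_norm z i, norm_nonneg z]) x hs
  obtain ⟨h1, h2⟩ := heat_half (h.continuous_pd1 i) (h.pd1_le · i) hs x
  have h3 : ∀ t, _root_.heat t (fun y => pd1 d u y i) =
      fun y => pd1 d (_root_.heat t u) y i := fun t => funext fun y => (h.pd1_heat t y i).symm
  rw [← h1, ← h2, h3, h3, (h.heat _).heat_pd1 (by positivity),
    (h.heat _).heat_pd1 (by positivity), mul_left_comm, ← mul_sub, abs_mul,
    abs_of_nonneg (by positivity : 0 ≤ (√(s / 2))⁻¹)]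
  exact mul_le_mul_of_nonneg_left this (by positivity)

lemma doubling2 (h : CB2 d u M) (hN : ResBound d u N) (hN0 : 0 ≤ N)
    (x : EuclideanSpace ℝ (Fin d)) (i j : Fin d) {s : ℝ} (hs : 0 < s) :
    |_root_.heat s (fun y => pd2 d u y i j) x -
      Real.exp (-s) * _root_.heat (2 * s) (fun y => pd2 d u y i j) x| ≤ (s / 2)⁻¹ *
      (gaussW d * (N * √(1 + ‖x‖ ^ 2) * (√√s)⁻¹ * Real.exp (s / 2)) * s) := by
  have := h.weight_doubling hN hN0 (w := fun z => z i * z j - if i = j then 1 else 0)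
    (by fun_prop) (fun z => by
      have h1 := abs_apply_le_norm z i
      have h2 := abs_apply_le_norm z j
      have h3 : |z i * z j| ≤ ‖z‖ * ‖z‖ := by
        rw [abs_mul]; exact mul_le_mul h1 h2 (abs_nonneg _) (norm_nonneg _)
      have h4 : |(if i = j then 1 else 0 : ℝ)| ≤ 1 := by split_ifs <;> simp
      refine (abs_sub _ _).trans ?_
      nlinarith [norm_nonneg z]) x hs
  obtain ⟨h1, h2⟩ := heat_half (h.continuous_pd2 i j) (h.pd2_le · i j) hs x
  have h3 : ∀ t, _root_.heat t (fun y => pd2 d u y i j) =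
      fun y => pd2 d (_root_.heat t u) y i j := fun t => funext fun y => (h.pd2_heat t y i j).symm
  rw [← h1, ← h2, h3, h3, (h.heat _).heat_pd2 (by positivity),
    (h.heat _).heat_pd2 (by positivity), mul_left_comm, ← mul_sub, abs_mul,
    abs_of_nonneg (by positivity : 0 ≤ (s / 2)⁻¹)]
  exact mul_le_mul_of_nonneg_left this (by positivity)

end CB2

lemma abs_sub_heat_le {d : ℕ} {f : EuclideanSpace ℝ (Fin d) → ℝ}
    {f' : EuclideanSpace ℝ (Fin d) → EuclideanSpace ℝ (Fin d) →L[ℝ] ℝ} {M : ℝ}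
    (hf : ∀ y, HasFDerivAt f (f' y) y) (hM : ∀ z, ‖f z‖ ≤ M)
    (hM' : ∀ z, ‖f' z‖ ≤ M) (x : EuclideanSpace ℝ (Fin d)) (s : ℝ) :
    |f x - heat s f x| ≤ M * (∫ z, ‖z‖ ∂(gs d)) * √s := by
  have hfc : Continuous f := continuous_iff_continuousAt.2 fun y => (hf y).continuousAt
  have e : f x - heat s f x = ∫ z, (f x - f (x + √s • z)) ∂(gs d) := by
    rw [integral_sub (integrable_const _) (integrable_gs_of_bound (M := M) (by fun_prop) fun _ => hM _)]
    simp [heat]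
  rw [e, ← Real.norm_eq_abs]
  refine (norm_integral_le_of_norm_le (μ := gs d) (((integrable_gs_norm_pow d 1).const_mul M).mul_const √s)
    (Filter.Eventually.of_forall fun z => ?_)).trans ?_
  · have := Convex.norm_image_sub_le_of_norm_hasFDerivWithin_le (𝕜 := ℝ) (f := f) (f' := f')
      (C := M) (s := Set.univ) (fun y _ => (hf y).hasFDerivWithinAt) (fun y _ => hM' y) convex_univ
      (Set.mem_univ (x + √s • z)) (Set.mem_univ x)
    refine this.trans (le_of_eq ?_)
    rw [sub_add_cancel_left, norm_neg, norm_smul, Real.norm_eq_abs,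
      abs_of_nonneg (Real.sqrt_nonneg s)]
    ring
  · rw [integral_mul_const, integral_const_mul]
    simp

lemma doubling_rate_le {s : ℝ} (hs : 0 < s) :
    (√√s)⁻¹ * Real.exp (s / 2) * s ≤ 4 * (√√s)⁻¹ * Real.exp s ∧
    (√(s / 2))⁻¹ * ((√√s)⁻¹ * Real.exp (s / 2) * s) ≤ 4 * (√√s)⁻¹ * Real.exp s ∧
    (s / 2)⁻¹ * ((√√s)⁻¹ * Real.exp (s / 2) * s) ≤ 4 * (√√s)⁻¹ * Real.exp s ∧
    (s ≤ 1 → (√√s)⁻¹ * Real.exp (s / 2) * s ≤ 4 * √√s ∧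
      (√(s / 2))⁻¹ * ((√√s)⁻¹ * Real.exp (s / 2) * s) ≤ 4 * √√s) := by
  have hq := sqrt_sqrt_pos hs
  have hs' : 0 < √s := Real.sqrt_pos.2 hs
  have hq2 : √√s ^ 2 = √s := Real.sq_sqrt hs'.le
  have hs2 : √s ^ 2 = s := Real.sq_sqrt hs.le
  have he : Real.exp s = Real.exp (s / 2) * Real.exp (s / 2) := by
    rw [← Real.exp_add]; congr 1; ring
  have he1 := Real.add_one_le_exp (s / 2)
  have hep := Real.exp_pos (s / 2)
  have h2 : (√(s / 2))⁻¹ ≤ 2 * (√s)⁻¹ := by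
    rw [Real.sqrt_div hs.le, inv_div, div_eq_mul_inv]
    gcongr
    rw [Real.sqrt_le_iff]; norm_num
  have hs3 : (√s)⁻¹ * s = √s := by
    rw [inv_mul_eq_iff_eq_mul₀ hs'.ne', ← pow_two, hs2]
  have hs4 : √s ≤ 2 * Real.exp (s / 2) := by nlinarith
  have h5 : (√(s / 2))⁻¹ * ((√√s)⁻¹ * Real.exp (s / 2) * s) ≤
      2 * ((√√s)⁻¹ * Real.exp (s / 2) * √s) := by
    calc _ ≤ 2 * (√s)⁻¹ * ((√√s)⁻¹ * Real.exp (s / 2) * s) := by gcongr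
      _ = 2 * ((√√s)⁻¹ * Real.exp (s / 2) * ((√s)⁻¹ * s)) := by ring
      _ = _ := by rw [hs3]
  refine ⟨?_, ?_, ?_, fun h1 => ?_⟩
  · rw [he]
    calc _ ≤ (√√s)⁻¹ * Real.exp (s / 2) * (4 * Real.exp (s / 2)) := by gcongr; linarith
      _ = _ := by ring
  · refine h5.trans ?_
    rw [he]
    calc _ ≤ 2 * ((√√s)⁻¹ * Real.exp (s / 2) * (2 * Real.exp (s / 2))) := by gcongr
      _ = _ := by ring
  · rw [he]
    calc _ = 2 * ((√√s)⁻¹ * Real.exp (s / 2)) * (s⁻¹ * s) := by rw [inv_div]; ring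
      _ = (√√s)⁻¹ * Real.exp (s / 2) * 2 := by rw [inv_mul_cancel₀ hs.ne']; ring
      _ ≤ (√√s)⁻¹ * Real.exp (s / 2) * (4 * Real.exp (s / 2)) := by gcongr; linarith
      _ = _ := by ring
  · have he2 : Real.exp (s / 2) ≤ 2 := by
      have h3 : Real.exp (s / 2) ≤ Real.exp (1 / 2) := Real.exp_le_exp.2 (by linarith)
      have h4 : Real.exp (1 / 2) ^ 2 ≤ 2 ^ 2 := by
        rw [← Real.exp_nat_mul]
        have := Real.exp_one_lt_d9
        norm_num
        linarith
      have := abs_le_of_sq_le_sq h4 (by norm_num)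
      rw [Real.abs_exp] at this
      linarith
    have h6 : (√√s)⁻¹ * √s = √√s := by
      rw [inv_mul_eq_iff_eq_mul₀ hq.ne', ← pow_two, hq2]
    have h7 : 2 * ((√√s)⁻¹ * Real.exp (s / 2) * √s) ≤ 4 * √√s := by
      calc _ = 2 * (Real.exp (s / 2) * ((√√s)⁻¹ * √s)) := by ring
        _ ≤ 2 * (2 * √√s) := by rw [h6]; gcongr
        _ = _ := by ring
    refine ⟨?_, h5.trans h7⟩
    have h8 : s ≤ √s := by
      rw [← hs2]
      have : √s ≤ 1 := Real.sqrt_le_one.2 h1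
      rw [Real.sqrt_sq hs'.le]
      nlinarith
    calc _ ≤ 2 * ((√√s)⁻¹ * Real.exp (s / 2) * √s) := by
            have : (√√s)⁻¹ * Real.exp (s / 2) * s ≤ (√√s)⁻¹ * Real.exp (s / 2) * √s := by gcongr
            have : 0 ≤ (√√s)⁻¹ * Real.exp (s / 2) * √s := by positivity
            linarith
      _ ≤ _ := h7

namespace CB2

variable {d : ℕ} {u : EuclideanSpace ℝ (Fin d) → ℝ} {M N : ℝ}

lemma abs_heat_pd2_le (h : CB2 d u M) (hN : ResBound d u N) (hN0 : 0 ≤ N)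
    (x : EuclideanSpace ℝ (Fin d)) (i j : Fin d) {s : ℝ} (hs : 0 < s) :
    |_root_.heat s (fun y => pd2 d u y i j) x| ≤
      28 * gaussW d * (N * √(1 + ‖x‖ ^ 2)) * (√√s)⁻¹ * Real.exp s := by
  have hW := gaussW_pos d
  have := abs_le_of_doubling (A := fun s => _root_.heat s (fun y => pd2 d u y i j) x) (B := M)
    (K := 4 * gaussW d * (N * √(1 + ‖x‖ ^ 2))) (fun s _ => heat_norm_le (V := ℝ) (h.pd2_le · i j) x)
    (fun s hs => by
      refine (h.doubling2 hN hN0 x i j hs).trans ?_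
      have := (doubling_rate_le hs).2.2.1
      calc _ = gaussW d * (N * √(1 + ‖x‖ ^ 2)) *
            ((s / 2)⁻¹ * ((√√s)⁻¹ * Real.exp (s / 2) * s)) := by ring
        _ ≤ gaussW d * (N * √(1 + ‖x‖ ^ 2)) * (4 * (√√s)⁻¹ * Real.exp s) := by gcongr
        _ = _ := by ring) hs
  refine this.trans (le_of_eq ?_)
  ring

lemma abs_heat_le (h : CB2 d u M) (hN : ResBound d u N) (hN0 : 0 ≤ N)
    (x : EuclideanSpace ℝ (Fin d)) {s : ℝ} (hs : 0 < s) :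
    |_root_.heat s u x| ≤
      28 * gaussW d * (N * √(1 + ‖x‖ ^ 2)) * (√√s)⁻¹ * Real.exp s := by
  have hW := gaussW_pos d
  have := abs_le_of_doubling (A := fun s => _root_.heat s u x) (B := M)
    (K := 4 * gaussW d * (N * √(1 + ‖x‖ ^ 2))) (fun s _ => heat_norm_le (V := ℝ) h.le x)
    (fun s hs => by
      refine (h.doubling0 hN hN0 x hs).trans ?_
      have := (doubling_rate_le hs).1
      calc _ = gaussW d * (N * √(1 + ‖x‖ ^ 2)) * ((√√s)⁻¹ * Real.exp (s / 2) * s) := by ring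
        _ ≤ gaussW d * (N * √(1 + ‖x‖ ^ 2)) * (4 * (√√s)⁻¹ * Real.exp s) := by gcongr
        _ = _ := by ring) hs
  refine this.trans (le_of_eq ?_)
  ring

lemma abs_heat_pd1_le (h : CB2 d u M) (hN : ResBound d u N) (hN0 : 0 ≤ N)
    (x : EuclideanSpace ℝ (Fin d)) (i : Fin d) {s : ℝ} (hs : 0 < s) :
    |_root_.heat s (fun y => pd1 d u y i) x| ≤
      28 * gaussW d * (N * √(1 + ‖x‖ ^ 2)) * (√√s)⁻¹ * Real.exp s := by
  have hW := gaussW_pos d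
  have := abs_le_of_doubling (A := fun s => _root_.heat s (fun y => pd1 d u y i) x) (B := M)
    (K := 4 * gaussW d * (N * √(1 + ‖x‖ ^ 2))) (fun s _ => heat_norm_le (V := ℝ) (h.pd1_le · i) x)
    (fun s hs => by
      refine (h.doubling1 hN hN0 x i hs).trans ?_
      have := (doubling_rate_le hs).2.1
      calc _ = gaussW d * (N * √(1 + ‖x‖ ^ 2)) *
            ((√(s / 2))⁻¹ * ((√√s)⁻¹ * Real.exp (s / 2) * s)) := by ring
        _ ≤ gaussW d * (N * √(1 + ‖x‖ ^ 2)) * (4 * (√√s)⁻¹ * Real.exp s) := by gcongr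
        _ = _ := by ring) hs
  refine this.trans (le_of_eq ?_)
  ring

lemma abs_sub_exp_heat_le (h : CB2 d u M) (hN : ResBound d u N) (hN0 : 0 ≤ N)
    (x : EuclideanSpace ℝ (Fin d)) {s : ℝ} (hs : 0 < s) (hs1 : s ≤ 1) :
    |u x - Real.exp (-s) * _root_.heat s u x| ≤
      28 * gaussW d * (N * √(1 + ‖x‖ ^ 2)) * √√s := by
  have hW := gaussW_pos d
  have hm : 0 ≤ ∫ z : EuclideanSpace ℝ (Fin d), ‖z‖ ∂(gs d) := integral_nonneg fun z => norm_nonneg _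
  have hM0 := h.nonneg
  have := abs_sub_le_of_doubling (A := fun s => _root_.heat s u x)
    (B := M * (1 + ∫ z, ‖z‖ ∂(gs d)))
    (K := 4 * gaussW d * (N * √(1 + ‖x‖ ^ 2)))
    (fun s _ => (heat_norm_le (V := ℝ) h.le x).trans (by nlinarith)) (by positivity)
    (fun s _ => by
      rw [heat_zero]
      refine (abs_sub_heat_le h.hasFDerivAt h.le h.fderiv_le x s).trans ?_
      gcongr; linarith)
    (fun s hs hs1 => by
      refine (h.doubling0 hN hN0 x hs).trans ?_
      have := ((doubling_rate_le hs).2.2.2 hs1).1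
      calc _ = gaussW d * (N * √(1 + ‖x‖ ^ 2)) * ((√√s)⁻¹ * Real.exp (s / 2) * s) := by ring
        _ ≤ gaussW d * (N * √(1 + ‖x‖ ^ 2)) * (4 * √√s) := by gcongr
        _ = _ := by ring) hs hs1
  simp only [heat_zero] at this
  refine this.trans (le_of_eq ?_)
  ring

lemma abs_pd1_sub_exp_heat_le (h : CB2 d u M) (hN : ResBound d u N) (hN0 : 0 ≤ N)
    (x : EuclideanSpace ℝ (Fin d)) (i : Fin d) {s : ℝ} (hs : 0 < s) (hs1 : s ≤ 1) :
    |pd1 d u x i - Real.exp (-s) * _root_.heat s (fun y => pd1 d u y i) x| ≤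
      28 * gaussW d * (N * √(1 + ‖x‖ ^ 2)) * √√s := by
  have hW := gaussW_pos d
  have hm : 0 ≤ ∫ z : EuclideanSpace ℝ (Fin d), ‖z‖ ∂(gs d) := integral_nonneg fun z => norm_nonneg _
  have hM0 := h.nonneg
  have := abs_sub_le_of_doubling (A := fun s => _root_.heat s (fun y => pd1 d u y i) x)
    (B := M * (1 + ∫ z, ‖z‖ ∂(gs d)))
    (K := 4 * gaussW d * (N * √(1 + ‖x‖ ^ 2)))
    (fun s _ => (heat_norm_le (V := ℝ) (h.pd1_le · i) x).trans (by nlinarith)) (by positivity)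
    (fun s _ => by
      rw [heat_zero]
      refine (abs_sub_heat_le (h.hasFDerivAt_pd1 · i) (h.pd1_le · i) (fun z => ?_) x s).trans ?_
      · refine ((fderiv ℝ (fderiv ℝ u) z).flip.le_opNorm _).trans ?_
        simpa [ContinuousLinearMap.opNorm_flip] using h.fderiv2_le z
      gcongr; linarith)
    (fun s hs hs1 => by
      refine (h.doubling1 hN hN0 x i hs).trans ?_
      have := ((doubling_rate_le hs).2.2.2 hs1).2
      calc _ = gaussW d * (N * √(1 + ‖x‖ ^ 2)) *
            ((√(s / 2))⁻¹ * ((√√s)⁻¹ * Real.exp (s / 2) * s)) := by ring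
        _ ≤ gaussW d * (N * √(1 + ‖x‖ ^ 2)) * (4 * √√s) := by gcongr
        _ = _ := by ring) hs hs1
  simp only [heat_zero] at this
  refine this.trans (le_of_eq ?_)
  ring

lemma abs_le_resBound (h : CB2 d u M) (hN : ResBound d u N) (hN0 : 0 ≤ N)
    (x : EuclideanSpace ℝ (Fin d)) : |u x| ≤ 56 * gaussW d * (N * √(1 + ‖x‖ ^ 2)) := by
  have h1 := h.abs_sub_exp_heat_le hN hN0 x one_pos le_rfl
  have h2 := h.abs_heat_le hN hN0 x one_pos
  simp only [Real.sqrt_one, inv_one, mul_one] at h1 h2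
  have h3 : |Real.exp (-1) * _root_.heat 1 u x| ≤ 28 * gaussW d * (N * √(1 + ‖x‖ ^ 2)) := by
    rw [abs_mul, Real.abs_exp, Real.exp_neg, inv_mul_le_iff₀ (Real.exp_pos _), mul_comm]
    exact h2
  have h4 := abs_add_le (u x - Real.exp (-1) * _root_.heat 1 u x) (Real.exp (-1) * _root_.heat 1 u x)
  rw [sub_add_cancel] at h4
  linarith

lemma abs_pd1_le_resBound (h : CB2 d u M) (hN : ResBound d u N) (hN0 : 0 ≤ N)
    (x : EuclideanSpace ℝ (Fin d)) (i : Fin d) :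
    |pd1 d u x i| ≤ 56 * gaussW d * (N * √(1 + ‖x‖ ^ 2)) := by
  have h1 := h.abs_pd1_sub_exp_heat_le hN hN0 x i one_pos le_rfl
  have h2 := h.abs_heat_pd1_le hN hN0 x i one_pos
  simp only [Real.sqrt_one, inv_one, mul_one] at h1 h2
  set A := _root_.heat 1 (fun y => pd1 d u y i) x
  have h3 : |Real.exp (-1) * A| ≤ 28 * gaussW d * (N * √(1 + ‖x‖ ^ 2)) := by
    rw [abs_mul, Real.abs_exp, Real.exp_neg, inv_mul_le_iff₀ (Real.exp_pos _), mul_comm]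
    exact h2
  have h4 := abs_add_le (pd1 d u x i - Real.exp (-1) * A) (Real.exp (-1) * A)
  rw [sub_add_cancel] at h4
  linarith

end CB2

lemma integral_gs_coord_mul_mul {d : ℕ} {p q : EuclideanSpace ℝ (Fin d) → ℝ}
    {p' q' : EuclideanSpace ℝ (Fin d) → EuclideanSpace ℝ (Fin d) →L[ℝ] ℝ} {P Q : ℝ}
    (hp : ∀ y, HasFDerivAt p (p' y) y) (hq : ∀ y, HasFDerivAt q (q' y) y)
    (hcp : Continuous p') (hcq : Continuous q') (bp : ∀ z, |p z| ≤ P) (bq : ∀ z, |q z| ≤ Q)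
    (bp' : ∀ z, ‖p' z‖ ≤ P) (bq' : ∀ z, ‖q' z‖ ≤ Q) (t : ℝ) (i : Fin d) :
    ∫ z, z i * (p (√t • z) * q (√t • z)) ∂(gs d) =
      √t * ∫ z, (p (√t • z) * q' (√t • z) (EuclideanSpace.single i 1) +
        q (√t • z) * p' (√t • z) (EuclideanSpace.single i 1)) ∂(gs d) := by
  have hpc : Continuous p := continuous_iff_continuousAt.2 fun y => (hp y).continuousAt
  have hqc : Continuous q := continuous_iff_continuousAt.2 fun y => (hq y).continuousAt
  have hP : 0 ≤ P := (abs_nonneg _).trans (bp 0)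
  have hQ : 0 ≤ Q := (abs_nonneg _).trans (bq 0)
  have := integral_gs_coord_mul (f := fun y => p y * q y) (f' := fun y => p y • q' y + q y • p' y)
    (fun y => (hp y).mul (hq y)) (by fun_prop) (M := P * Q + Q * P)
    (fun z => by
      rw [norm_mul]
      have : ‖p z‖ * ‖q z‖ ≤ P * Q := mul_le_mul (bp z) (bq z) (norm_nonneg _) hP
      nlinarith)
    (fun z => by
      refine (norm_add_le _ _).trans ?_
      rw [norm_smul, norm_smul]
      exact add_le_add (mul_le_mul (bp z) (bq' z) (norm_nonneg _) hP)
        (mul_le_mul (bq z) (bp' z) (norm_nonneg _) hQ)) 0 t i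
  simpa using this

namespace CB2

variable {d : ℕ} {u w : EuclideanSpace ℝ (Fin d) → ℝ} {M N : ℝ}

lemma norm_flip_le (h : CB2 d u M) (x : EuclideanSpace ℝ (Fin d)) (i : Fin d) :
    ‖(fderiv ℝ (fderiv ℝ u) x).flip (EuclideanSpace.single i 1)‖ ≤ M := by
  refine ((fderiv ℝ (fderiv ℝ u) x).flip.le_opNorm _).trans ?_
  simpa [ContinuousLinearMap.opNorm_flip] using h.fderiv2_le x

lemma abs_pd1_sub_le (h : CB2 d u M) (i : Fin d) (x y : EuclideanSpace ℝ (Fin d)) :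
    |pd1 d u x i - pd1 d u y i| ≤ M * ‖x - y‖ :=
  Convex.norm_image_sub_le_of_norm_hasFDerivWithin_le (𝕜 := ℝ) (f := fun x => pd1 d u x i)
    (f' := fun x => (fderiv ℝ (fderiv ℝ u) x).flip (EuclideanSpace.single i 1))
    (C := M) (s := Set.univ) (fun y _ => (h.hasFDerivAt_pd1 y i).hasFDerivWithinAt)
    (fun y _ => h.norm_flip_le y i) convex_univ (Set.mem_univ _) (Set.mem_univ _)

lemma integral_diffQuot (h : CB2 d u M) (t : ℝ) (i j : Fin d) {e : ℝ} (he : 0 < e) :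
    ∫ z, (z j * (pd1 d u (√t • z) i * (e⁻¹ *
        (pd1 d u (√t • z + e • EuclideanSpace.single j 1) i - pd1 d u (√t • z) i))) -
      z i * (pd1 d u (√t • z) i * (e⁻¹ *
        (pd1 d u (√t • z + e • EuclideanSpace.single j 1) j - pd1 d u (√t • z) j))) -
      √t * (pd2 d u (√t • z) i j * (e⁻¹ *
        (pd1 d u (√t • z + e • EuclideanSpace.single j 1) i - pd1 d u (√t • z) i)) -
        pd2 d u (√t • z) i i * (e⁻¹ *
        (pd1 d u (√t • z + e • EuclideanSpace.single j 1) j - pd1 d u (√t • z) j)))) ∂(gs d)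
      = 0 := by
  have hM := h.nonneg
  set a : EuclideanSpace ℝ (Fin d) := e • EuclideanSpace.single j 1 with ha
  set q : Fin d → EuclideanSpace ℝ (Fin d) → ℝ :=
    fun k y => e⁻¹ * (pd1 d u (y + a) k - pd1 d u y k) with hq
  set q' : Fin d → EuclideanSpace ℝ (Fin d) → EuclideanSpace ℝ (Fin d) →L[ℝ] ℝ :=
    fun k y => e⁻¹ • ((fderiv ℝ (fderiv ℝ u) (y + a)).flip (EuclideanSpace.single k 1) -
      (fderiv ℝ (fderiv ℝ u) y).flip (EuclideanSpace.single k 1)) with hq'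
  have hc2 := h.continuous_fderiv2
  have hc1 := h.continuous_pd1
  have hcp := h.continuous_pd2
  have hfl : ∀ k, Continuous fun y => (fderiv ℝ (fderiv ℝ u) y).flip
      (EuclideanSpace.single k (1 : ℝ)) := fun k =>
    ((ContinuousLinearMap.flipₗᵢ ℝ _ _ ℝ).continuous.comp hc2).clm_apply continuous_const
  have hqd : ∀ k y, HasFDerivAt (q k) (q' k y) y := fun k y =>
    ((hasFDerivAt_comp_add (h.hasFDerivAt_pd1 (y + a) k)).sub (h.hasFDerivAt_pd1 y k)).const_mul _
  have hqc : ∀ k, Continuous (q' k) := fun k => by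
    have h1 := hfl k
    have h2 : Continuous fun y => (fderiv ℝ (fderiv ℝ u) (y + a)).flip
      (EuclideanSpace.single k (1 : ℝ)) := h1.comp (continuous_id.add continuous_const)
    exact (h2.sub h1).const_smul e⁻¹
  have hqc0 : ∀ k, Continuous (q k) := fun k =>
    continuous_iff_continuousAt.2 fun y => (hqd k y).continuousAt
  have hqb : ∀ k y, |q k y| ≤ e⁻¹ * (M + M) := fun k y => by
    simp only [hq]
    rw [abs_mul, abs_of_pos (inv_pos.2 he)]
    gcongr
    exact (abs_sub _ _).trans (add_le_add (h.pd1_le _ _) (h.pd1_le _ _))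
  have hqb' : ∀ k y, ‖q' k y‖ ≤ e⁻¹ * (M + M) := fun k y => by
    simp only [hq']
    rw [norm_smul, Real.norm_eq_abs, abs_of_pos (inv_pos.2 he)]
    gcongr
    exact (norm_sub_le _ _).trans (add_le_add (h.norm_flip_le _ _) (h.norm_flip_le _ _))
  have hA := fun k m => integral_gs_coord_mul_mul (h.hasFDerivAt_pd1 · i) (hqd k) (hfl i) (hqc k)
    (h.pd1_le · i) (hqb k) (h.norm_flip_le · i) (hqb' k) t m
  have h1 := hA i j
  have h2 := hA j i
  have e1 : ∀ y, q' i y (EuclideanSpace.single j 1) = q' j y (EuclideanSpace.single i 1) := by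
    intro y
    simp only [hq', _root_.smul_apply, _root_.sub_apply, ContinuousLinearMap.flip_apply]
    rw [← h.pd2_eq, ← h.pd2_eq, ← h.pd2_eq, ← h.pd2_eq, h.pd2_symm _ i j, h.pd2_symm _ i j]
  have e2 : ∀ y (m : Fin d), (fderiv ℝ (fderiv ℝ u) y).flip (EuclideanSpace.single i 1)
      (EuclideanSpace.single m 1) = pd2 d u y i m := fun y m => by
    rw [ContinuousLinearMap.flip_apply, ← h.pd2_eq, h.pd2_symm]
  simp only [e2, e1] at h1 h2
  have hz : ∀ m : Fin d, Continuous fun z : EuclideanSpace ℝ (Fin d) => z m := fun m => by fun_prop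
  have iA : ∀ k m, Integrable (fun z : EuclideanSpace ℝ (Fin d) =>
      z m * (pd1 d u (√t • z) i * q k (√t • z))) (gs d) := fun k m => by
    have := hqc0 k
    have := hc1 i
    refine integrable_gs_of_poly (C := M * (e⁻¹ * (M + M))) (n := 1) (by fun_prop) fun z => ?_
    rw [norm_mul, norm_mul, pow_one, mul_comm]
    gcongr
    · exact h.pd1_le _ _
    · exact hqb _ _
    · linarith [PiLp.norm_apply_le z m]
  have iP : ∀ k m, Integrable (fun z : EuclideanSpace ℝ (Fin d) =>
      q k (√t • z) * pd2 d u (√t • z) i m) (gs d) := fun k m => by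
    have := hqc0 k
    have := hcp i m
    refine integrable_gs_of_bound (M := e⁻¹ * (M + M) * M) (by fun_prop) fun z => ?_
    rw [norm_mul]
    gcongr
    · exact hqb _ _
    · exact h.pd2_le _ _ _
  have iQ : Integrable (fun z : EuclideanSpace ℝ (Fin d) =>
      pd1 d u (√t • z) i * q' j (√t • z) (EuclideanSpace.single i 1)) (gs d) := by
    have := hqc j
    have := hc1 i
    refine integrable_gs_of_bound (M := M * (e⁻¹ * (M + M) * 1)) (by fun_prop) fun z => ?_
    rw [norm_mul]
    gcongr
    · exact h.pd1_le _ _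
    · refine (ContinuousLinearMap.le_opNorm _ _).trans ?_
      simp only [PiLp.norm_single, norm_one]
      gcongr
      exact hqb' _ _
  rw [integral_add iQ (iP _ _)] at h1 h2
  have e3 : ∀ z, √t * (pd2 d u (√t • z) i j * q i (√t • z) - pd2 d u (√t • z) i i * q j (√t • z)) =
    √t * (q i (√t • z) * pd2 d u (√t • z) i j - q j (√t • z) * pd2 d u (√t • z) i i) :=
    fun z => by ring
  change ∫ z, (z j * (pd1 d u (√t • z) i * q i (√t • z)) - z i * (pd1 d u (√t • z) i * q j (√t • z)) -
    √t * (pd2 d u (√t • z) i j * q i (√t • z) - pd2 d u (√t • z) i i * q j (√t • z))) ∂(gs d) = 0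
  simp only [e3]
  have i1 : Integrable (fun z : EuclideanSpace ℝ (Fin d) =>
      z j * (pd1 d u (√t • z) i * q i (√t • z)) - z i * (pd1 d u (√t • z) i * q j (√t • z)))
      (gs d) := (iA i j).sub (iA j i)
  have i2 : Integrable (fun z : EuclideanSpace ℝ (Fin d) => √t * (q i (√t • z) *
      pd2 d u (√t • z) i j - q j (√t • z) * pd2 d u (√t • z) i i)) (gs d) :=
    ((iP i j).sub (iP j i)).const_mul _
  rw [integral_sub i1 i2,
    integral_sub (iA i j) (iA j i), integral_const_mul, integral_sub (iP i j) (iP j i), h1, h2]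
  ring

lemma tendsto_diffQuot (h : CB2 d u M) (x : EuclideanSpace ℝ (Fin d)) (j k : Fin d) :
    Filter.Tendsto (fun n : ℕ => ((n : ℝ) + 1)⁻¹⁻¹ *
      (pd1 d u (x + ((n : ℝ) + 1)⁻¹ • EuclideanSpace.single j 1) k - pd1 d u x k)) Filter.atTop
      (nhds (pd2 d u x j k)) := by
  have := (h.hasFDerivAt_pd1 x k).lim_real (EuclideanSpace.single j 1)
  have h1 := this.comp (tendsto_natCast_atTop_atTop (R := ℝ) |>.atTop_add
    (tendsto_const_nhds (x := (1 : ℝ))))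
  rw [ContinuousLinearMap.flip_apply, ← h.pd2_eq] at h1
  simpa [Function.comp_def] using h1

lemma integral_hessian_identity (h : CB2 d u M) (t : ℝ) (i j : Fin d) :
    ∫ z, (z j * (pd1 d u (√t • z) i * pd2 d u (√t • z) j i) -
      z i * (pd1 d u (√t • z) i * pd2 d u (√t • z) j j) -
      √t * (pd2 d u (√t • z) i j * pd2 d u (√t • z) j i -
        pd2 d u (√t • z) i i * pd2 d u (√t • z) j j)) ∂(gs d) = 0 := by
  have hM := h.nonneg
  have hc1 := h.continuous_pd1
  have hcp := h.continuous_pd2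
  have hq : ∀ (n : ℕ) (k : Fin d) (y : EuclideanSpace ℝ (Fin d)), |((n : ℝ) + 1)⁻¹⁻¹ *
      (pd1 d u (y + ((n : ℝ) + 1)⁻¹ • EuclideanSpace.single j 1) k - pd1 d u y k)| ≤ M := by
    intro n k y
    have hn : (0 : ℝ) < n + 1 := by positivity
    have := h.abs_pd1_sub_le k (y + ((n : ℝ) + 1)⁻¹ • EuclideanSpace.single j 1) y
    rw [add_sub_cancel_left, norm_smul, PiLp.norm_single, norm_one, mul_one, Real.norm_eq_abs,
      abs_of_pos (inv_pos.2 hn)] at this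
    rw [abs_mul, inv_inv, abs_of_pos hn]
    calc _ ≤ ((n : ℝ) + 1) * (M * ((n : ℝ) + 1)⁻¹) := by gcongr
      _ = M := by field_simp
  have key := tendsto_integral_of_dominated_convergence (μ := gs d)
    (bound := fun z => (2 * (M * M) + √t * (2 * (M * M))) * (1 + ‖z‖) ^ 1)
    (F := fun (n : ℕ) z => (z j * (pd1 d u (√t • z) i * (((n : ℝ) + 1)⁻¹⁻¹ *
        (pd1 d u (√t • z + ((n : ℝ) + 1)⁻¹ • EuclideanSpace.single j 1) i - pd1 d u (√t • z) i))) -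
      z i * (pd1 d u (√t • z) i * (((n : ℝ) + 1)⁻¹⁻¹ *
        (pd1 d u (√t • z + ((n : ℝ) + 1)⁻¹ • EuclideanSpace.single j 1) j - pd1 d u (√t • z) j))) -
      √t * (pd2 d u (√t • z) i j * (((n : ℝ) + 1)⁻¹⁻¹ *
        (pd1 d u (√t • z + ((n : ℝ) + 1)⁻¹ • EuclideanSpace.single j 1) i - pd1 d u (√t • z) i)) -
        pd2 d u (√t • z) i i * (((n : ℝ) + 1)⁻¹⁻¹ *
        (pd1 d u (√t • z + ((n : ℝ) + 1)⁻¹ • EuclideanSpace.single j 1) j -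
          pd1 d u (√t • z) j)))))
    (f := fun z => z j * (pd1 d u (√t • z) i * pd2 d u (√t • z) j i) -
      z i * (pd1 d u (√t • z) i * pd2 d u (√t • z) j j) -
      √t * (pd2 d u (√t • z) i j * pd2 d u (√t • z) j i -
        pd2 d u (√t • z) i i * pd2 d u (√t • z) j j)) (fun n => ?_) ?_ (fun n => ?_) ?_
  · simp_rw [fun n : ℕ => h.integral_diffQuot t i j (e := ((n : ℝ) + 1)⁻¹) (by positivity)] at key
    exact tendsto_nhds_unique key tendsto_const_nhds
  · have h1 := hc1 i
    have h2 := hc1 j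
    have h3 := hcp i j
    have h4 := hcp i i
    fun_prop
  · refine integrable_gs_of_poly (C := 2 * (M * M) + √t * (2 * (M * M))) (n := 1)
      (by fun_prop) fun z => ?_
    rw [Real.norm_eq_abs, abs_of_nonneg (by positivity)]
  · refine Filter.Eventually.of_forall fun z => ?_
    have b1 := hq n i (√t • z)
    have b2 := hq n j (√t • z)
    set Q1 := ((n : ℝ) + 1)⁻¹⁻¹ *
        (pd1 d u (√t • z + ((n : ℝ) + 1)⁻¹ • EuclideanSpace.single j 1) i - pd1 d u (√t • z) i)
    set Q2 := ((n : ℝ) + 1)⁻¹⁻¹ *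
        (pd1 d u (√t • z + ((n : ℝ) + 1)⁻¹ • EuclideanSpace.single j 1) j - pd1 d u (√t • z) j)
    have t1 : ‖z j * (pd1 d u (√t • z) i * Q1)‖ ≤ ‖z‖ * (M * M) := by
      rw [norm_mul, norm_mul]
      gcongr
      · exact PiLp.norm_apply_le z j
      · exact h.pd1_le _ _
      · exact b1
    have t2 : ‖z i * (pd1 d u (√t • z) i * Q2)‖ ≤ ‖z‖ * (M * M) := by
      rw [norm_mul, norm_mul]
      gcongr
      · exact PiLp.norm_apply_le z i
      · exact h.pd1_le _ _
      · exact b2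
    have t3 : ‖pd2 d u (√t • z) i j * Q1‖ ≤ M * M := by
      rw [norm_mul]
      gcongr
      · exact h.pd2_le _ _ _
      · exact b1
    have t4 : ‖pd2 d u (√t • z) i i * Q2‖ ≤ M * M := by
      rw [norm_mul]
      gcongr
      · exact h.pd2_le _ _ _
      · exact b2
    have t5 : ‖√t * (pd2 d u (√t • z) i j * Q1 - pd2 d u (√t • z) i i * Q2)‖ ≤
        √t * (2 * (M * M)) := by
      rw [norm_mul, Real.norm_eq_abs, abs_of_nonneg (Real.sqrt_nonneg t)]
      gcongr
      refine (norm_sub_le _ _).trans ?_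
      linarith
    refine (norm_sub_le _ _).trans ?_
    refine (add_le_add (norm_sub_le _ _) le_rfl).trans ?_
    have n0 := norm_nonneg z
    have : 0 ≤ √t * (2 * (M * M)) * ‖z‖ := by positivity
    have : 0 ≤ M * M := by positivity
    nlinarith
  · refine Filter.Eventually.of_forall fun z => ?_
    have h1 := h.tendsto_diffQuot (√t • z) j i
    have h2 := h.tendsto_diffQuot (√t • z) j j
    exact (((h1.const_mul _).const_mul _).sub ((h2.const_mul _).const_mul _)).sub
      (((h1.const_mul _).sub (h2.const_mul _)).const_mul _)

end CB2

/-- Squared Frobenius norm of the Hessian. -/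
def hsq (d : ℕ) (u : EuclideanSpace ℝ (Fin d) → ℝ) (x : EuclideanSpace ℝ (Fin d)) : ℝ :=
  ∑ i, ∑ j, pd2 d u x i j ^ 2

lemma sum_hessian_le {d : ℕ} (z p : Fin d → ℝ) (m : Fin d → Fin d → ℝ) {k : ℝ} (hk : 0 < k) :
    ∑ i, ∑ j, m i j ^ 2 + 2 * k * ∑ i, ∑ j, (z j * (p i * m i j) - z i * (p i * m j j) -
      k⁻¹ * (m i j * m i j - m i i * m j j)) ≤
    3 * (∑ i, m i i) ^ 2 + 2 * k ^ 2 * ((∑ i, z i ^ 2) * ∑ i, p i ^ 2) := by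
  have h1 : ∑ i, ∑ j, (2 * k * (z j * (p i * m i j))) ≤
      ∑ i, ∑ j, (m i j ^ 2 + k ^ 2 * (p i ^ 2 * z j ^ 2)) := by
    gcongr with i _ j _
    nlinarith [sq_nonneg (m i j - k * p i * z j)]
  have h2 := Finset.sum_mul_sq_le_sq_mul_sq Finset.univ z p
  have e1 : ∑ i, ∑ j, p i ^ 2 * z j ^ 2 = (∑ i, z i ^ 2) * ∑ i, p i ^ 2 := by
    rw [mul_comm, Finset.sum_mul_sum]
  have e2 : ∑ i, ∑ j, z i * (p i * m j j) = (∑ i, z i * p i) * ∑ i, m i i := by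
    rw [Finset.sum_mul_sum]; simp only [mul_assoc]
  have e3 : ∑ i, ∑ j, m i i * m j j = (∑ i, m i i) ^ 2 := by rw [pow_two, Finset.sum_mul_sum]
  have e4 : ∑ i, ∑ j, m i j * m i j = ∑ i, ∑ j, m i j ^ 2 := by simp only [pow_two]
  have e7 : ∑ i, ∑ j, (z j * (p i * m i j) - z i * (p i * m j j) -
      k⁻¹ * (m i j * m i j - m i i * m j j)) = ∑ i, ∑ j, z j * (p i * m i j) -
      ∑ i, ∑ j, z i * (p i * m j j) -
      k⁻¹ * (∑ i, ∑ j, m i j * m i j - ∑ i, ∑ j, m i i * m j j) := by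
    simp only [Finset.sum_sub_distrib, Finset.mul_sum, mul_sub]
  have e8 : ∑ i, ∑ j, (m i j ^ 2 + k ^ 2 * (p i ^ 2 * z j ^ 2)) =
      ∑ i, ∑ j, m i j ^ 2 + k ^ 2 * ∑ i, ∑ j, p i ^ 2 * z j ^ 2 := by
    simp only [Finset.sum_add_distrib, Finset.mul_sum]
  have e9 : ∑ i, ∑ j, (2 * k * (z j * (p i * m i j))) =
      2 * k * ∑ i, ∑ j, z j * (p i * m i j) := by
    simp only [Finset.mul_sum]
  rw [e8, e9, e1] at h1
  rw [e7, e2, e3, e4, mul_sub, mul_sub, mul_sub, mul_sub]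
  have e5 : 2 * k * (k⁻¹ * ∑ i, ∑ j, m i j ^ 2) = 2 * ∑ i, ∑ j, m i j ^ 2 := by field_simp
  have e6 : 2 * k * (k⁻¹ * (∑ i, m i i) ^ 2) = 2 * (∑ i, m i i) ^ 2 := by field_simp
  rw [e5, e6]
  set L := ∑ i, m i i
  set q := ∑ i, z i * p i
  have h3 : -(2 * k * (q * L)) ≤ L ^ 2 + k ^ 2 * q ^ 2 := by nlinarith [sq_nonneg (L + k * q)]
  have h4 : k ^ 2 * q ^ 2 ≤ k ^ 2 * ((∑ i, z i ^ 2) * ∑ i, p i ^ 2) := by gcongr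
  linarith

namespace CB2

variable {d : ℕ} {u w : EuclideanSpace ℝ (Fin d) → ℝ} {M M' N : ℝ}

lemma continuous_hsq (h : CB2 d u M) : Continuous (hsq d u) := by
  have := h.continuous_pd2
  unfold hsq
  fun_prop

lemma hsq_nonneg (x : EuclideanSpace ℝ (Fin d)) : 0 ≤ hsq d u x :=
  Finset.sum_nonneg fun _ _ => Finset.sum_nonneg fun _ _ => sq_nonneg _

lemma hsq_le (h : CB2 d u M) (x : EuclideanSpace ℝ (Fin d)) : hsq d u x ≤ d ^ 2 * M ^ 2 := by
  calc hsq d u x ≤ ∑ _i : Fin d, ∑ _j : Fin d, M ^ 2 := by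
        refine Finset.sum_le_sum fun i _ => Finset.sum_le_sum fun j _ => ?_
        rw [← sq_abs]
        exact pow_le_pow_left₀ (abs_nonneg _) (h.pd2_le x i j) 2
    _ = d ^ 2 * M ^ 2 := by simp; ring

lemma integral_hsq_le (h : CB2 d u M) {t : ℝ} (ht : 0 < t) :
    ∫ z, hsq d u (√t • z) ∂(gs d) ≤ 3 * ∫ z, lap d u (√t • z) ^ 2 ∂(gs d) +
      2 * t⁻¹ * ∫ z, ‖z‖ ^ 2 * ∑ i, pd1 d u (√t • z) i ^ 2 ∂(gs d) := by
  have hM := h.nonneg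
  have hc1 := h.continuous_pd1
  have hcp := h.continuous_pd2
  have hcl := h.continuous_lap
  have hch := h.continuous_hsq
  set I : Fin d → Fin d → EuclideanSpace ℝ (Fin d) → ℝ := fun i j z =>
    z j * (pd1 d u (√t • z) i * pd2 d u (√t • z) i j) -
      z i * (pd1 d u (√t • z) i * pd2 d u (√t • z) j j) -
      √t * (pd2 d u (√t • z) i j * pd2 d u (√t • z) i j -
        pd2 d u (√t • z) i i * pd2 d u (√t • z) j j) with hI
  have hI0 : ∀ i j, ∫ z, I i j z ∂(gs d) = 0 := fun i j => by
    have := h.integral_hessian_identity t i j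
    simp only [h.pd2_symm _ j i] at this
    exact this
  have hIi : ∀ i j, Integrable (I i j) (gs d) := fun i j => by
    have h1 := hc1 i
    have h3 := hcp i j
    have h4 := hcp i i
    have h5 := hcp j j
    refine integrable_gs_of_poly (C := 2 * (M * M) + √t * (2 * (M * M))) (n := 1)
      (by fun_prop) fun z => ?_
    have b0 := h.pd1_le (√t • z) i
    have b1 := h.pd2_le (√t • z) i j
    have b2 := h.pd2_le (√t • z) i i
    have b3 := h.pd2_le (√t • z) j j
    have t1 : ‖z j * (pd1 d u (√t • z) i * pd2 d u (√t • z) i j)‖ ≤ ‖z‖ * (M * M) := by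
      rw [norm_mul, norm_mul]
      gcongr
      · exact PiLp.norm_apply_le z j
      · exact b0
      · exact b1
    have t2 : ‖z i * (pd1 d u (√t • z) i * pd2 d u (√t • z) j j)‖ ≤ ‖z‖ * (M * M) := by
      rw [norm_mul, norm_mul]
      gcongr
      · exact PiLp.norm_apply_le z i
      · exact b0
      · exact b3
    have t3 : ‖pd2 d u (√t • z) i j * pd2 d u (√t • z) i j‖ ≤ M * M := by
      rw [norm_mul]
      gcongr <;> exact b1
    have t4 : ‖pd2 d u (√t • z) i i * pd2 d u (√t • z) j j‖ ≤ M * M := by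
      rw [norm_mul]
      gcongr
      · exact b2
      · exact b3
    have t5 : ‖√t * (pd2 d u (√t • z) i j * pd2 d u (√t • z) i j -
        pd2 d u (√t • z) i i * pd2 d u (√t • z) j j)‖ ≤ √t * (2 * (M * M)) := by
      rw [norm_mul, Real.norm_eq_abs, abs_of_nonneg (Real.sqrt_nonneg t)]
      gcongr
      refine (norm_sub_le _ _).trans ?_
      linarith
    refine (norm_sub_le _ _).trans ?_
    refine (add_le_add (norm_sub_le _ _) le_rfl).trans ?_
    have n0 := norm_nonneg z
    have : 0 ≤ √t * (2 * (M * M)) * ‖z‖ := by positivity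
    have : 0 ≤ M * M := by positivity
    nlinarith
  have hsI : ∫ z, ∑ i, ∑ j, I i j z ∂(gs d) = 0 := by
    rw [integral_finsetSum _ fun i _ => integrable_finsetSum _ fun j _ => hIi i j]
    refine Finset.sum_eq_zero fun i _ => ?_
    rw [integral_finsetSum _ fun j _ => hIi i j]
    exact Finset.sum_eq_zero fun j _ => hI0 i j
  have iH : Integrable (fun z => hsq d u (√t • z)) (gs d) :=
    integrable_gs_of_bound (M := d ^ 2 * M ^ 2) (by fun_prop) fun z => by
      rw [Real.norm_eq_abs, abs_of_nonneg (hsq_nonneg _)]; exact h.hsq_le _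
  have iI : Integrable (fun z => ∑ i, ∑ j, I i j z) (gs d) :=
    integrable_finsetSum _ fun i _ => integrable_finsetSum _ fun j _ => hIi i j
  have iL : Integrable (fun z => lap d u (√t • z) ^ 2) (gs d) :=
    integrable_gs_of_bound (M := (d * M) ^ 2) (by fun_prop) fun z => by
      rw [norm_pow]; exact pow_le_pow_left₀ (norm_nonneg _) (h.abs_lap_le _) 2
  have iD : Integrable (fun z : EuclideanSpace ℝ (Fin d) =>
      ‖z‖ ^ 2 * ∑ i, pd1 d u (√t • z) i ^ 2) (gs d) := by
    refine integrable_gs_of_poly (C := d * M ^ 2) (n := 2) (by fun_prop) fun z => ?_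
    have : ∑ i, pd1 d u (√t • z) i ^ 2 ≤ d * M ^ 2 := by
      calc _ ≤ ∑ _i : Fin d, M ^ 2 := by
            refine Finset.sum_le_sum fun i _ => ?_
            rw [← sq_abs]
            exact pow_le_pow_left₀ (abs_nonneg _) (h.pd1_le _ i) 2
        _ = _ := by simp
    rw [Real.norm_eq_abs, abs_of_nonneg (by positivity), mul_comm]
    gcongr
    linarith
  have key : ∫ z, (hsq d u (√t • z) + 2 * (√t)⁻¹ * ∑ i, ∑ j, I i j z) ∂(gs d) ≤
      ∫ z, (3 * lap d u (√t • z) ^ 2 +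
        2 * t⁻¹ * (‖z‖ ^ 2 * ∑ i, pd1 d u (√t • z) i ^ 2)) ∂(gs d) := by
    refine integral_mono (iH.add (iI.const_mul _)) ((iL.const_mul _).add (iD.const_mul _))
      fun z => ?_
    have := sum_hessian_le (fun i => z i) (pd1 d u (√t • z)) (pd2 d u (√t • z))
      (inv_pos.2 (Real.sqrt_pos.2 ht))
    rw [inv_inv, inv_pow, Real.sq_sqrt ht.le, ← EuclideanSpace.real_norm_sq_eq] at this
    exact this
  rw [integral_add iH (iI.const_mul _), integral_add (iL.const_mul _) (iD.const_mul _),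
    integral_const_mul, integral_const_mul, integral_const_mul, hsI] at key
  linarith

lemma sub_smul (h : CB2 d u M) (h' : CB2 d w M') {c : ℝ} (hc : |c| ≤ 1) :
    CB2 d (fun x => u x - c * w x) (M + M') ∧
    (∀ x i, pd1 d (fun x => u x - c * w x) x i = pd1 d u x i - c * pd1 d w x i) ∧
    (∀ x i j, pd2 d (fun x => u x - c * w x) x i j = pd2 d u x i j - c * pd2 d w x i j) := by
  have h1 : ∀ x, HasFDerivAt (fun x => u x - c * w x) (fderiv ℝ u x - c • fderiv ℝ w x) x :=
    fun x => (h.hasFDerivAt x).sub ((h'.hasFDerivAt x).const_mul c)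
  have h2 : ∀ x, HasFDerivAt (fun x => fderiv ℝ u x - c • fderiv ℝ w x)
      (fderiv ℝ (fderiv ℝ u) x - c • fderiv ℝ (fderiv ℝ w) x) x :=
    fun x => (h.hasFDerivAt_fderiv x).sub ((h'.hasFDerivAt_fderiv x).const_smul c)
  have hcM : ∀ a : ℝ, 0 ≤ a → |c| * a ≤ a := fun a ha => by nlinarith
  have hb : CB2 d (fun x => u x - c * w x) (M + M') := by
    refine of_hasFDerivAt h1 h2 (h.continuous_fderiv2.sub (h'.continuous_fderiv2.const_smul c))
      (fun x => ?_) (fun x => ?_) fun x => ?_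
    · refine (abs_sub _ _).trans (add_le_add (h.le x) ?_)
      rw [abs_mul]
      exact (hcM _ (abs_nonneg _)).trans (h'.le x)
    · refine (norm_sub_le _ _).trans (add_le_add (h.fderiv_le x) ?_)
      rw [norm_smul]
      exact (hcM _ (norm_nonneg _)).trans (h'.fderiv_le x)
    · have e1 : ‖fderiv ℝ (fderiv ℝ u) x - c • fderiv ℝ (fderiv ℝ w) x‖ ≤
          ‖fderiv ℝ (fderiv ℝ u) x‖ + ‖c • fderiv ℝ (fderiv ℝ w) x‖ :=
        norm_sub_le (E := EuclideanSpace ℝ (Fin d) →L[ℝ] EuclideanSpace ℝ (Fin d) →L[ℝ] ℝ) _ _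
      have e5 : ‖c • fderiv ℝ (fderiv ℝ w) x‖ ≤ |c| * ‖fderiv ℝ (fderiv ℝ w) x‖ :=
        ContinuousLinearMap.opNorm_smul_le c _
      have e2 := hcM _ (norm_nonneg (fderiv ℝ (fderiv ℝ w) x))
      have e3 := h'.fderiv2_le x
      have e4 := h.fderiv2_le x
      linarith
  refine ⟨hb, fun x i => ?_, fun x i j => ?_⟩
  · unfold pd1
    rw [(h1 x).fderiv]
    simp
  · rw [hb.pd2_eq, h.pd2_eq, h'.pd2_eq, funext fun x => (h1 x).fderiv, (h2 x).fderiv]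
    simp

end CB2

/-- The constant in the Gaussian Hessian estimate. -/
def hessC (d : ℕ) : ℝ := 576 + 784 * (48 + 4 * d + 2 * d ^ 2) * gaussW d ^ 4

lemma hessC_pos (d : ℕ) : 0 < hessC d := by
  have := gaussW_pos d
  unfold hessC
  positivity

namespace CB2

variable {d : ℕ} {u : EuclideanSpace ℝ (Fin d) → ℝ} {M N : ℝ}

lemma integral_res_sub_le (h : CB2 d u M) (hN : ResBound d u N) {t : ℝ} (ht : 0 < t)
    (ht1 : t ≤ 1) :
    ∫ z, (res d u (√t • z) - Real.exp (-t) * _root_.heat t (res d u) (√t • z)) ^ 2 ∂(gs d) ≤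
      12 * N ^ 2 * (√t)⁻¹ := by
  set R := (1 + d) * M with hR
  have hRb : ∀ z, |res d u z| ≤ R := h.abs_res_le
  have hR0 : 0 ≤ R := (abs_nonneg _).trans (hRb 0)
  have hc := h.continuous_res
  have hsq_b : ∀ z, ‖res d u z ^ 2‖ ≤ R ^ 2 := fun z => by
    rw [norm_pow]; exact pow_le_pow_left₀ (norm_nonneg _) (hRb z) 2
  have hhc : Continuous (_root_.heat t (res d u)) := heat_continuous hc hRb
  have hhb : ∀ z, |_root_.heat t (res d u) z| ≤ R := heat_norm_le (V := ℝ) hRb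
  have hqc : Continuous (_root_.heat t (fun y => res d u y ^ 2)) :=
    heat_continuous (by fun_prop) hsq_b
  have hqb : ∀ z, ‖_root_.heat t (fun y => res d u y ^ 2) z‖ ≤ R ^ 2 := heat_norm_le hsq_b
  have i1 : Integrable (fun z => res d u (√t • z) ^ 2) (gs d) :=
    integrable_gs_of_bound (by fun_prop) fun z => hsq_b _
  have i2 : Integrable (fun z => _root_.heat t (fun y => res d u y ^ 2) (√t • z)) (gs d) :=
    integrable_gs_of_bound (by fun_prop) fun z => hqb _
  have i3 : Integrable (fun z => (res d u (√t • z) -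
      Real.exp (-t) * _root_.heat t (res d u) (√t • z)) ^ 2) (gs d) :=
    integrable_gs_of_bound (M := (R + R) ^ 2) (by fun_prop) fun z => by
      rw [norm_pow]
      refine pow_le_pow_left₀ (norm_nonneg _) ((norm_sub_le _ _).trans (add_le_add (hRb _) ?_)) 2
      rw [norm_mul, Real.norm_eq_abs, Real.abs_exp]
      have h1 : Real.exp (-t) ≤ 1 := Real.exp_le_one_iff.2 (by linarith)
      calc _ ≤ 1 * R := mul_le_mul h1 (hhb _) (abs_nonneg _) zero_le_one
        _ = R := one_mul R
  have h1 : ∫ z, (res d u (√t • z) - Real.exp (-t) * _root_.heat t (res d u) (√t • z)) ^ 2 ∂(gs d) ≤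
      ∫ z, (2 * res d u (√t • z) ^ 2 + 2 * _root_.heat t (fun y => res d u y ^ 2) (√t • z))
        ∂(gs d) := by
    refine integral_mono i3 ((i1.const_mul 2).add (i2.const_mul 2)) fun z => ?_
    have hs := sq_heat_le (s := t) hc hRb (√t • z)
    have he : Real.exp (-t) ≤ 1 := Real.exp_le_one_iff.2 (by linarith)
    have he0 := Real.exp_pos (-t)
    set a := res d u (√t • z)
    set b := _root_.heat t (res d u) (√t • z)
    have h2 : (Real.exp (-t) * b) ^ 2 ≤ b ^ 2 := by
      rw [mul_pow]
      have : Real.exp (-t) ^ 2 ≤ 1 := pow_le_one₀ he0.le he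
      nlinarith [sq_nonneg b]
    change (a - Real.exp (-t) * b) ^ 2 ≤ 2 * a ^ 2 + 2 * _
    nlinarith [sq_nonneg (a + Real.exp (-t) * b)]
  rw [integral_add (i1.const_mul 2) (i2.const_mul 2), integral_const_mul, integral_const_mul] at h1
  have e1 : ∫ z, res d u (√t • z) ^ 2 ∂(gs d) = _root_.heat t (fun y => res d u y ^ 2) 0 := by
    simp [_root_.heat]
  have e2 : ∫ z, _root_.heat t (fun y => res d u y ^ 2) (√t • z) ∂(gs d) =
      _root_.heat (t + t) (fun y => res d u y ^ 2) 0 := by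
    rw [← heat_heat (by fun_prop) hsq_b ht.le ht.le 0]
    change _ = ∫ z, _root_.heat t (fun y => res d u y ^ 2) (0 + √t • z) ∂(gs d)
    simp only [zero_add]
  rw [e1, e2] at h1
  have h2 := hN 0 t ht
  have h3 := hN 0 (t + t) (by linarith)
  have hst := Real.sqrt_pos.2 ht
  have he : Real.exp 1 ≤ 3 := by linarith [Real.exp_one_lt_d9]
  have h4 : Real.exp (t / 2) ≤ 3 := (Real.exp_le_exp.2 (by linarith)).trans he
  have h5 : Real.exp ((t + t) / 2) ≤ 3 := (Real.exp_le_exp.2 (by linarith)).trans he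
  have h6 : (√(t + t))⁻¹ ≤ (√t)⁻¹ := by gcongr; linarith
  have h7 : N ^ 2 * (√t)⁻¹ * Real.exp (t / 2) ≤ N ^ 2 * (√t)⁻¹ * 3 := by gcongr
  have h8 : N ^ 2 * (√(t + t))⁻¹ * Real.exp ((t + t) / 2) ≤ N ^ 2 * (√t)⁻¹ * 3 := by gcongr
  simp only [norm_zero] at h2 h3
  norm_num at h2 h3 h8
  linarith

lemma integral_hsq_le_resBound (h : CB2 d u M) (hN : ResBound d u N) (hN0 : 0 ≤ N) {t : ℝ}
    (ht : 0 < t) (ht1 : t ≤ 1) :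
    ∫ z, hsq d u (√t • z) ∂(gs d) ≤ hessC d * N ^ 2 * (√t)⁻¹ := by
  have hM := h.nonneg
  have hst := Real.sqrt_pos.2 ht
  have hst1 : √t ≤ 1 := Real.sqrt_le_one.2 ht1
  have hq := sqrt_sqrt_pos ht
  have hq2 : √√t ^ 2 = √t := Real.sq_sqrt hst.le
  have hW := gaussW_pos d
  have he : |Real.exp (-t)| ≤ 1 := by
    rw [Real.abs_exp]; exact Real.exp_le_one_iff.2 (by linarith)
  set κ := 28 * gaussW d * N with hκ
  have hκ0 : 0 ≤ κ := by positivity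
  obtain ⟨hc, hd1, hd2⟩ := h.sub_smul (h.heat t) he
  set w := fun x => u x - Real.exp (-t) * _root_.heat t u x with hw
  have hwt : ∀ z : EuclideanSpace ℝ (Fin d), 1 + ‖√t • z‖ ^ 2 ≤ 1 + ‖z‖ ^ 2 := fun z => by
    rw [norm_smul, mul_pow, Real.norm_eq_abs, sq_abs, Real.sq_sqrt ht.le]
    nlinarith [sq_nonneg ‖z‖]
  have hw4 : ∀ z : EuclideanSpace ℝ (Fin d), 1 + ‖z‖ ^ 2 ≤ (1 + ‖z‖) ^ 4 ∧
      ‖z‖ ^ 2 * (1 + ‖z‖ ^ 2) ≤ (1 + ‖z‖) ^ 4 := fun z => by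
    have := norm_nonneg z
    constructor
    · have : (1 + ‖z‖) ^ 4 = 1 + ‖z‖ ^ 2 + (4 * ‖z‖ + 5 * ‖z‖ ^ 2 + 4 * ‖z‖ ^ 3 + ‖z‖ ^ 4) := by ring
      rw [this]
      have : 0 ≤ 4 * ‖z‖ + 5 * ‖z‖ ^ 2 + 4 * ‖z‖ ^ 3 + ‖z‖ ^ 4 := by positivity
      linarith
    · have : (1 + ‖z‖) ^ 4 = ‖z‖ ^ 2 * (1 + ‖z‖ ^ 2) + (1 + 4 * ‖z‖ + 5 * ‖z‖ ^ 2 + 4 * ‖z‖ ^ 3) := by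
        ring
      rw [this]
      have : 0 ≤ 1 + 4 * ‖z‖ + 5 * ‖z‖ ^ 2 + 4 * ‖z‖ ^ 3 := by positivity
      linarith
  have i4 : Integrable (fun z : EuclideanSpace ℝ (Fin d) => (1 + ‖z‖) ^ 4) (gs d) :=
    integrable_gs_of_poly (C := 1) (n := 4) (by fun_prop) fun z => by
      rw [Real.norm_eq_abs, abs_of_nonneg (by positivity), one_mul]
  have sqb : ∀ (a k : ℝ) (z : EuclideanSpace ℝ (Fin d)), 0 ≤ k →
      |a| ≤ 28 * gaussW d * (N * √(1 + ‖√t • z‖ ^ 2)) * k →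
      a ^ 2 ≤ κ ^ 2 * k ^ 2 * (1 + ‖z‖ ^ 2) := fun a k z hk ha => by
    have h1 : a ^ 2 ≤ (28 * gaussW d * (N * √(1 + ‖√t • z‖ ^ 2)) * k) ^ 2 := by
      rw [← sq_abs a]; exact pow_le_pow_left₀ (abs_nonneg _) ha 2
    refine h1.trans ?_
    have e : (28 * gaussW d * (N * √(1 + ‖√t • z‖ ^ 2)) * k) ^ 2 =
        κ ^ 2 * k ^ 2 * (1 + ‖√t • z‖ ^ 2) := by
      rw [mul_pow, mul_pow, mul_pow N, Real.sq_sqrt (by positivity), hκ]; ring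
    rw [e]
    gcongr κ ^ 2 * k ^ 2 * ?_
    exact hwt z
  have p0 : ∀ z : EuclideanSpace ℝ (Fin d), w (√t • z) ^ 2 ≤ κ ^ 2 * (√t)⁻¹ * (1 + ‖z‖) ^ 4 :=
    fun z => by
      have h1 := sqb _ _ z hq.le (h.abs_sub_exp_heat_le hN hN0 (√t • z) ht ht1)
      rw [hq2] at h1
      refine h1.trans ?_
      have : √t ≤ (√t)⁻¹ := hst1.trans ((one_le_inv₀ hst).2 hst1)
      gcongr
      exact (hw4 z).1
  have p1 : ∀ z : EuclideanSpace ℝ (Fin d),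
      ‖z‖ ^ 2 * ∑ i, pd1 d w (√t • z) i ^ 2 ≤ d * κ ^ 2 * √t * (1 + ‖z‖) ^ 4 := fun z => by
    have h1 : ∑ i, pd1 d w (√t • z) i ^ 2 ≤ ∑ _i : Fin d, κ ^ 2 * √t * (1 + ‖z‖ ^ 2) := by
      refine Finset.sum_le_sum fun i _ => ?_
      have h1 := sqb _ _ z hq.le (h.abs_pd1_sub_exp_heat_le hN hN0 (√t • z) i ht ht1)
      rwa [hq2, ← h.pd1_heat, ← hd1] at h1
    calc _ ≤ ‖z‖ ^ 2 * ∑ _i : Fin d, κ ^ 2 * √t * (1 + ‖z‖ ^ 2) := by gcongr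
      _ = d * κ ^ 2 * √t * (‖z‖ ^ 2 * (1 + ‖z‖ ^ 2)) := by simp; ring
      _ ≤ _ := by
        have := (hw4 z).2
        gcongr
  have p2 : ∀ z : EuclideanSpace ℝ (Fin d), hsq d u (√t • z) ≤
      2 * hsq d w (√t • z) + 2 * (d ^ 2 * κ ^ 2 * (√t)⁻¹ * (1 + ‖z‖) ^ 4) := fun z => by
    have h1 : hsq d u (√t • z) ≤ ∑ i, ∑ j, (2 * pd2 d w (√t • z) i j ^ 2 +
        2 * (κ ^ 2 * (√t)⁻¹ * (1 + ‖z‖ ^ 2))) := by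
      refine Finset.sum_le_sum fun i _ => Finset.sum_le_sum fun j _ => ?_
      have h2 : |Real.exp (-t) * _root_.heat t (fun y => pd2 d u y i j) (√t • z)| ≤
          28 * gaussW d * (N * √(1 + ‖√t • z‖ ^ 2)) * (√√t)⁻¹ := by
        rw [abs_mul, Real.abs_exp, Real.exp_neg, inv_mul_le_iff₀ (Real.exp_pos _), mul_comm]
        exact h.abs_heat_pd2_le hN hN0 (√t • z) i j ht
      have h3 := sqb _ _ z (inv_pos.2 hq).le h2
      rw [inv_pow, hq2, ← h.pd2_heat] at h3
      have h4 := hd2 (√t • z) i j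
      have h5 : pd2 d u (√t • z) i j = pd2 d w (√t • z) i j +
        Real.exp (-t) * pd2 d (_root_.heat t u) (√t • z) i j := by rw [h4]; ring
      rw [h5]
      nlinarith [sq_nonneg (pd2 d w (√t • z) i j -
        Real.exp (-t) * pd2 d (_root_.heat t u) (√t • z) i j)]
    refine h1.trans ?_
    simp only [Finset.sum_add_distrib, ← Finset.mul_sum, Finset.sum_const, Finset.card_univ,
      Fintype.card_fin, nsmul_eq_mul]
    have h6 := (hw4 z).1
    have h7 : (d : ℝ) ^ 2 * κ ^ 2 * (√t)⁻¹ * (1 + ‖z‖ ^ 2) ≤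
      d ^ 2 * κ ^ 2 * (√t)⁻¹ * (1 + ‖z‖) ^ 4 := by gcongr
    unfold hsq
    linarith
  have hwc := hc.continuous
  have hwl := hc.continuous_lap
  have hw1 := hc.continuous_pd1
  have hwh := hc.continuous_hsq
  have huh := h.continuous_hsq
  have hwr := hc.continuous_res
  have iu : Integrable (fun z => hsq d u (√t • z)) (gs d) :=
    integrable_gs_of_bound (M := d ^ 2 * M ^ 2) (by fun_prop) fun z => by
      rw [Real.norm_eq_abs, abs_of_nonneg (hsq_nonneg _)]; exact h.hsq_le _
  have iwh : Integrable (fun z => hsq d w (√t • z)) (gs d) :=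
    integrable_gs_of_bound (M := d ^ 2 * (M + M) ^ 2) (by fun_prop) fun z => by
      rw [Real.norm_eq_abs, abs_of_nonneg (hsq_nonneg _)]; exact hc.hsq_le _
  have iw : Integrable (fun z => w (√t • z) ^ 2) (gs d) :=
    integrable_gs_of_bound (M := (M + M) ^ 2) (by fun_prop) fun z => by
      rw [norm_pow]; exact pow_le_pow_left₀ (norm_nonneg _) (hc.le _) 2
  have il : Integrable (fun z => lap d w (√t • z) ^ 2) (gs d) :=
    integrable_gs_of_bound (M := (d * (M + M)) ^ 2) (by fun_prop) fun z => by
      rw [norm_pow]; exact pow_le_pow_left₀ (norm_nonneg _) (hc.abs_lap_le _) 2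
  have ir : Integrable (fun z => res d w (√t • z) ^ 2) (gs d) :=
    integrable_gs_of_bound (M := ((1 + d) * (M + M)) ^ 2) (by fun_prop) fun z => by
      rw [norm_pow]; exact pow_le_pow_left₀ (norm_nonneg _) (hc.abs_res_le _) 2
  have iD : Integrable (fun z : EuclideanSpace ℝ (Fin d) =>
      ‖z‖ ^ 2 * ∑ i, pd1 d w (√t • z) i ^ 2) (gs d) :=
    integrable_gs_of_poly (C := d * κ ^ 2 * √t) (n := 4) (by fun_prop) fun z => by
      rw [Real.norm_eq_abs, abs_of_nonneg (by positivity)]; exact p1 z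
  have q0 := integral_mono iw (i4.const_mul _) p0
  have q1 := integral_mono iD (i4.const_mul _) p1
  have q2 := integral_mono iu ((iwh.const_mul 2).add ((i4.const_mul _).const_mul 2)) p2
  have q3 := hc.integral_hsq_le ht
  have hres : ∀ x, res d w x = res d u x - Real.exp (-t) * _root_.heat t (res d u) x := by
    intro x
    rw [← h.heat_res]
    unfold res lap
    simp only [hd2, Finset.sum_sub_distrib, ← Finset.mul_sum]
    ring
  have q4 : ∫ z, lap d w (√t • z) ^ 2 ∂(gs d) ≤
      ∫ z, (8 * w (√t • z) ^ 2 + 8 * res d w (√t • z) ^ 2) ∂(gs d) := by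
    refine integral_mono il ((iw.const_mul 8).add (ir.const_mul 8)) fun z => ?_
    change lap d w (√t • z) ^ 2 ≤ 8 * w (√t • z) ^ 2 + 8 * res d w (√t • z) ^ 2
    unfold res
    nlinarith [sq_nonneg (w (√t • z) + (w (√t • z) - 1 / 2 * lap d w (√t • z)))]
  have q5 := h.integral_res_sub_le hN ht ht1
  simp only [← hres] at q5
  rw [integral_add (iw.const_mul 8) (ir.const_mul 8), integral_const_mul, integral_const_mul] at q4
  rw [integral_const_mul, ← gaussW_sq] at q0 q1
  have e2 : ∫ z, (2 * hsq d w (√t • z) + 2 * (d ^ 2 * κ ^ 2 * (√t)⁻¹ * (1 + ‖z‖) ^ 4)) ∂(gs d) =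
      2 * ∫ z, hsq d w (√t • z) ∂(gs d) + 2 * (d ^ 2 * κ ^ 2 * (√t)⁻¹ * gaussW d ^ 2) := by
    rw [integral_add (iwh.const_mul 2) ((i4.const_mul _).const_mul 2), integral_const_mul,
      integral_const_mul, integral_const_mul, gaussW_sq]
  have q2' := q2.trans_eq e2
  have e3 : t⁻¹ * (d * κ ^ 2 * √t * gaussW d ^ 2) = d * κ ^ 2 * (√t)⁻¹ * gaussW d ^ 2 := by
    have : t⁻¹ * √t = (√t)⁻¹ := by
      nth_rewrite 1 [← Real.sq_sqrt ht.le]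
      field_simp
    rw [← this]; ring
  have q6 : t⁻¹ * ∫ z, ‖z‖ ^ 2 * ∑ i, pd1 d w (√t • z) i ^ 2 ∂(gs d) ≤
      d * κ ^ 2 * (√t)⁻¹ * gaussW d ^ 2 := by
    rw [← e3]
    have := inv_pos.2 ht
    gcongr
  have e4 : hessC d * N ^ 2 * (√t)⁻¹ = 576 * N ^ 2 * (√t)⁻¹ + 48 * (κ ^ 2 * (√t)⁻¹ * gaussW d ^ 2)
      + 4 * (d * κ ^ 2 * (√t)⁻¹ * gaussW d ^ 2) + 2 * (d ^ 2 * κ ^ 2 * (√t)⁻¹ * gaussW d ^ 2) := by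
    rw [hκ, hessC]; ring
  rw [e4]
  linarith

end CB2

lemma inv_abs_det_le {d : ℕ} (L : EuclideanSpace ℝ (Fin d) ≃L[ℝ] EuclideanSpace ℝ (Fin d))
    {k : ℝ} (hk : 0 < k) (hL : ∀ z, k * ‖z‖ ≤ ‖L z‖) :
    |LinearMap.det ((L : EuclideanSpace ℝ (Fin d) →L[ℝ] EuclideanSpace ℝ (Fin d)) :
        EuclideanSpace ℝ (Fin d) →ₗ[ℝ] EuclideanSpace ℝ (Fin d))|⁻¹ ≤ (k⁻¹) ^ d := by
  set f := ((L : EuclideanSpace ℝ (Fin d) →L[ℝ] EuclideanSpace ℝ (Fin d)) :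
        EuclideanSpace ℝ (Fin d) →ₗ[ℝ] EuclideanSpace ℝ (Fin d)) with hf
  have hdet : LinearMap.det f ≠ 0 := (LinearEquiv.isUnit_det' L.toLinearEquiv).ne_zero
  set μ : Measure (EuclideanSpace ℝ (Fin d)) := volume
  have h1 := Measure.addHaar_preimage_linearMap μ hdet (closedBall 0 1)
  have hsub : f ⁻¹' (closedBall 0 1) ⊆ closedBall 0 k⁻¹ := by
    intro z hz
    have hz' : ‖f z‖ ≤ 1 := by simpa using hz
    have h2 : k * ‖z‖ ≤ 1 := (hL z).trans hz'
    simp only [mem_closedBall, dist_zero_right]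
    rw [← one_div, le_div_iff₀ hk]
    linarith
  have h3 : ENNReal.ofReal |(LinearMap.det f)⁻¹| * μ (closedBall 0 1) ≤
      ENNReal.ofReal ((k⁻¹) ^ d) * μ (closedBall 0 1) := by
    rw [← h1]
    refine (measure_mono hsub).trans ?_
    rw [Measure.addHaar_closedBall μ 0 (by positivity), finrank_euclideanSpace, Fintype.card_fin]
    gcongr
    exact ball_subset_closedBall
  have hpos : μ (closedBall 0 1) ≠ 0 := (measure_closedBall_pos μ 0 one_pos).ne'
  have hfin : μ (closedBall 0 1) ≠ ⊤ := measure_closedBall_lt_top.ne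
  rw [ENNReal.mul_le_mul_iff_left hpos hfin, ENNReal.ofReal_le_ofReal_iff (by positivity),
    abs_inv] at h3
  exact h3

lemma integral_gs_comp_le_of_bound {d : ℕ} {f : EuclideanSpace ℝ (Fin d) → ℝ}
    (hf : Continuous f) {M : ℝ} (hM : ∀ z, |f z| ≤ M) (h0 : ∀ z, 0 ≤ f z)
    (L : EuclideanSpace ℝ (Fin d) ≃L[ℝ] EuclideanSpace ℝ (Fin d)) (hL : ∀ z, ‖L z‖ ≤ ‖z‖)
    {k : ℝ} (hk : 0 < k) (hL' : ∀ z, k * ‖z‖ ≤ ‖L z‖) :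
    ∫ z, f (L z) ∂(gs d) ≤ (k⁻¹) ^ d * ∫ z, f z ∂(gs d) :=
  (integral_gs_comp_le hf hM h0 L hL).trans <|
    mul_le_mul_of_nonneg_right (inv_abs_det_le L hk hL') (integral_nonneg h0)

open scoped MatrixOrder in
/-- An elliptic symmetric matrix has an invertible square root with the corresponding bounds. -/
lemma exists_sqrt_equiv {d : ℕ} {A : Matrix (Fin d) (Fin d) ℝ} (hA : A.IsSymm) {m c : ℝ}
    (hm : 0 < m) (h1 : ∀ ξ : Fin d → ℝ, m * ∑ i, ξ i ^ 2 ≤ ∑ i, ∑ j, ξ i * A i j * ξ j)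
    (h2 : ∀ ξ : Fin d → ℝ, ∑ i, ∑ j, ξ i * A i j * ξ j ≤ c * ∑ i, ξ i ^ 2) :
    ∃ σ : EuclideanSpace ℝ (Fin d) ≃L[ℝ] EuclideanSpace ℝ (Fin d),
      (∀ i j, ∑ k, (σ (EuclideanSpace.single k 1)) i * (σ (EuclideanSpace.single k 1)) j = A i j) ∧
      ∀ z, m * ‖z‖ ^ 2 ≤ ‖σ z‖ ^ 2 ∧ ‖σ z‖ ^ 2 ≤ c * ‖z‖ ^ 2 := by
  have hquad : ∀ ξ : Fin d → ℝ, ξ ⬝ᵥ (A.mulVec ξ) = ∑ i, ∑ j, ξ i * A i j * ξ j := by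
    intro ξ
    simp only [dotProduct, Matrix.mulVec, Finset.mul_sum, mul_assoc]
  have hherm : A.IsHermitian := by
    ext i j; simpa using congrFun (congrFun hA i) j
  have hps : A.PosSemidef := by
    refine Matrix.PosSemidef.of_dotProduct_mulVec_nonneg hherm fun ξ => ?_
    have : 0 ≤ m * ∑ i, ξ i ^ 2 := mul_nonneg hm.le (Finset.sum_nonneg fun i _ => sq_nonneg _)
    simpa [hquad] using this.trans (h1 ξ)
  set S := CFC.sqrt A with hS
  have hSS : S * S = A := CFC.sqrt_mul_sqrt_self A hps.nonneg
  have hSp : S.PosSemidef := Matrix.nonneg_iff_posSemidef.1 (CFC.sqrt_nonneg A)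
  have hSs : ∀ i j, S i j = S j i := fun i j => by
    have := congrFun (congrFun hSp.1 j) i
    simpa using this
  have happ : ∀ (z : EuclideanSpace ℝ (Fin d)) i,
      (Matrix.toEuclideanCLM (𝕜 := ℝ) S z) i = ∑ j, S i j * z j := by
    intro z i
    simp [Matrix.mulVec, dotProduct]
  have hAe : ∀ i j, ∑ k, S k i * S k j = A i j := by
    intro i j
    rw [← hSS, Matrix.mul_apply]
    exact Finset.sum_congr rfl fun k _ => by rw [hSs k i]
  have hnorm : ∀ z : EuclideanSpace ℝ (Fin d),
      ‖Matrix.toEuclideanCLM (𝕜 := ℝ) S z‖ ^ 2 = ∑ i, ∑ j, z i * A i j * z j := by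
    intro z
    rw [EuclideanSpace.real_norm_sq_eq]
    simp_rw [happ, ← hAe, pow_two, Finset.sum_mul_sum, Finset.mul_sum, Finset.sum_mul]
    rw [Finset.sum_comm]
    refine Finset.sum_congr rfl fun i _ => ?_
    rw [Finset.sum_comm]
    refine Finset.sum_congr rfl fun j _ => Finset.sum_congr rfl fun k _ => by ring
  have hb : ∀ z : EuclideanSpace ℝ (Fin d),
      m * ‖z‖ ^ 2 ≤ ‖Matrix.toEuclideanCLM (𝕜 := ℝ) S z‖ ^ 2 ∧
      ‖Matrix.toEuclideanCLM (𝕜 := ℝ) S z‖ ^ 2 ≤ c * ‖z‖ ^ 2 := by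
    intro z
    rw [hnorm, EuclideanSpace.real_norm_sq_eq]
    exact ⟨h1 z, h2 z⟩
  have hinj : Function.Injective
      ((Matrix.toEuclideanCLM (𝕜 := ℝ) S : EuclideanSpace ℝ (Fin d) →L[ℝ] EuclideanSpace ℝ (Fin d)) :
        EuclideanSpace ℝ (Fin d) →ₗ[ℝ] EuclideanSpace ℝ (Fin d)) := by
    rw [injective_iff_map_eq_zero]
    intro z hz
    have hz' : Matrix.toEuclideanCLM (𝕜 := ℝ) S z = 0 := hz
    have := (hb z).1
    rw [hz', norm_zero] at this
    have h0 : ‖z‖ ^ 2 ≤ 0 := by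
      by_contra! hc
      have := mul_pos hm hc
      linarith
    have : ‖z‖ = 0 := by nlinarith [norm_nonneg z]
    exact norm_eq_zero.1 this
  refine ⟨(LinearEquiv.ofInjectiveEndo _ hinj).toContinuousLinearEquiv, ?_, ?_⟩
  · intro i j
    have hs : ∀ k i, (Matrix.toEuclideanCLM (𝕜 := ℝ) S (EuclideanSpace.single k 1)) i = S i k := by
      intro k i
      rw [happ]
      simp
    have : ∀ k, ((LinearEquiv.ofInjectiveEndo _ hinj).toContinuousLinearEquiv
      (EuclideanSpace.single k (1 : ℝ))) = Matrix.toEuclideanCLM (𝕜 := ℝ) S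
        (EuclideanSpace.single k 1) := fun k => rfl
    simp_rw [this, hs]
    rw [← hAe i j]
    exact Finset.sum_congr rfl fun k _ => by rw [hSs i k, hSs j k]
  · exact hb

/-- Scaled `L²` bound for the Hessian with respect to Gaussian measures at every scale. -/
def HB (d : ℕ) (ρ : ℝ) (w : EuclideanSpace ℝ (Fin d) → ℝ) (K : ℝ) : Prop :=
  ∀ x t, 0 < t → heat (t / ρ) (hsq d w) x ≤ K ^ 2 * (1 + (√t)⁻¹)

lemma HB.mono {d : ℕ} {ρ : ℝ} {w : EuclideanSpace ℝ (Fin d) → ℝ} {K K' : ℝ} (h : HB d ρ w K)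
    (hK : 0 ≤ K) (hKK : K ≤ K') : HB d ρ w K' := fun x t ht =>
  (h x t ht).trans (by gcongr)

lemma eq_sum_smul_single {d : ℕ} (v : EuclideanSpace ℝ (Fin d)) :
    v = ∑ i, v i • EuclideanSpace.single i (1 : ℝ) := by
  ext j
  simp [Pi.single_apply]

lemma bilin_apply_eq_sum {d : ℕ}
    (B : EuclideanSpace ℝ (Fin d) →L[ℝ] EuclideanSpace ℝ (Fin d) →L[ℝ] ℝ)
    (T : EuclideanSpace ℝ (Fin d) →L[ℝ] EuclideanSpace ℝ (Fin d)) (v w : EuclideanSpace ℝ (Fin d)) :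
    B (T v) (T w) = ∑ i, ∑ j, v i * w j *
      B (T (EuclideanSpace.single i 1)) (T (EuclideanSpace.single j 1)) := by
  conv_lhs => rw [eq_sum_smul_single v, eq_sum_smul_single w]
  simp only [map_sum, map_smul, _root_.sum_apply, _root_.smul_apply,
    smul_eq_mul, Finset.mul_sum]
  rw [Finset.sum_comm]
  refine Finset.sum_congr rfl fun i _ => Finset.sum_congr rfl fun j _ => by ring

namespace CB2

variable {d : ℕ} {w : EuclideanSpace ℝ (Fin d) → ℝ} {M : ℝ}

lemma affine (h : CB2 d w M) (a : ℝ) (x0 : EuclideanSpace ℝ (Fin d))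
    (T : EuclideanSpace ℝ (Fin d) →L[ℝ] EuclideanSpace ℝ (Fin d)) :
    (∃ M', CB2 d (fun z => a * w (x0 + T z)) M') ∧
    (∀ z v, fderiv ℝ (fun z => a * w (x0 + T z)) z v = a * fderiv ℝ w (x0 + T z) (T v)) ∧
    (∀ z u v, fderiv ℝ (fderiv ℝ (fun z => a * w (x0 + T z))) z u v =
      a * fderiv ℝ (fderiv ℝ w) (x0 + T z) (T u) (T v)) := by
  set G := (ContinuousLinearMap.compL ℝ (EuclideanSpace ℝ (Fin d)) (EuclideanSpace ℝ (Fin d)) ℝ).flip T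
    with hG
  have hT : ∀ z, HasFDerivAt (fun z => x0 + T z) T z := fun z => T.hasFDerivAt.const_add x0
  have d1 : ∀ z, HasFDerivAt (fun z => a * w (x0 + T z)) (a • (fderiv ℝ w (x0 + T z)).comp T) z :=
    fun z => ((h.hasFDerivAt _).comp z (hT z)).const_mul a
  have d2 : ∀ z, HasFDerivAt (fun z => a • (fderiv ℝ w (x0 + T z)).comp T)
      (a • G.comp ((fderiv ℝ (fderiv ℝ w) (x0 + T z)).comp T)) z := fun z =>
    ((G.hasFDerivAt (x := fderiv ℝ w (x0 + T z))).comp z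
      ((h.hasFDerivAt_fderiv _).comp z (hT z))).const_smul a
  have hM := h.nonneg
  have hc := h.continuous_fderiv2
  have e1 : fderiv ℝ (fun z => a * w (x0 + T z)) =
    fun z => a • (fderiv ℝ w (x0 + T z)).comp T := funext fun z => (d1 z).fderiv
  refine ⟨⟨|a| * M * (1 + ‖T‖ + ‖G‖ * ‖T‖), CB2.of_hasFDerivAt d1 d2 ?_ ?_ ?_ ?_⟩, ?_, ?_⟩
  · fun_prop
  · intro z
    rw [abs_mul, mul_assoc]
    refine mul_le_mul_of_nonneg_left ((h.le _).trans ?_) (abs_nonneg a)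
    nlinarith [mul_nonneg hM (norm_nonneg T), mul_nonneg hM (mul_nonneg (norm_nonneg G) (norm_nonneg T))]
  · intro z
    rw [norm_smul, Real.norm_eq_abs, mul_assoc]
    refine mul_le_mul_of_nonneg_left ((ContinuousLinearMap.opNorm_comp_le _ _).trans ?_) (abs_nonneg a)
    have := mul_le_mul_of_nonneg_right (h.fderiv_le (x0 + T z)) (norm_nonneg T)
    nlinarith [mul_nonneg hM (mul_nonneg (norm_nonneg G) (norm_nonneg T))]
  · intro z
    refine (ContinuousLinearMap.opNorm_smul_le _ _).trans ?_
    rw [Real.norm_eq_abs, mul_assoc]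
    refine mul_le_mul_of_nonneg_left ((ContinuousLinearMap.opNorm_comp_le _ _).trans ?_) (abs_nonneg a)
    have h1 := (ContinuousLinearMap.opNorm_comp_le (fderiv ℝ (fderiv ℝ w) (x0 + T z)) T).trans
      (mul_le_mul_of_nonneg_right (h.fderiv2_le (x0 + T z)) (norm_nonneg T))
    have h2 := mul_le_mul_of_nonneg_left h1 (norm_nonneg G)
    nlinarith [mul_nonneg hM (norm_nonneg T)]
  · intro z v
    rw [(d1 z).fderiv]; rfl
  · intro z u v
    rw [e1, (d2 z).fderiv]; rfl

/-- The normalising change of variables for a constant-coefficient operator. -/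
def normalized (ρ : ℝ) (w : EuclideanSpace ℝ (Fin d) → ℝ)
    (σ : EuclideanSpace ℝ (Fin d) ≃L[ℝ] EuclideanSpace ℝ (Fin d)) (x0 : EuclideanSpace ℝ (Fin d)) :
    EuclideanSpace ℝ (Fin d) → ℝ :=
  fun z => ρ * w (x0 + ((√ρ)⁻¹ • (σ : EuclideanSpace ℝ (Fin d) →L[ℝ] EuclideanSpace ℝ (Fin d))) z)

section normalized

variable {ρ m : ℝ} {σ : EuclideanSpace ℝ (Fin d) ≃L[ℝ] EuclideanSpace ℝ (Fin d)}
  {x0 : EuclideanSpace ℝ (Fin d)}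

lemma exists_normalized (h : CB2 d w M) : ∃ M', CB2 d (normalized ρ w σ x0) M' :=
  (h.affine ρ x0 _).1

lemma pd2_normalized (h : CB2 d w M) (hρ : 0 < ρ) (z) (i j : Fin d) :
    pd2 d (normalized ρ w σ x0) z i j =
      fderiv ℝ (fderiv ℝ w) (x0 + (√ρ)⁻¹ • σ z) (σ (EuclideanSpace.single i 1))
        (σ (EuclideanSpace.single j 1)) := by
  obtain ⟨M', h'⟩ := h.exists_normalized (ρ := ρ) (σ := σ) (x0 := x0)
  rw [h'.pd2_eq]
  unfold normalized
  rw [(h.affine ρ x0 _).2.2]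
  simp only [_root_.smul_apply, ContinuousLinearEquiv.coe_coe, map_smul, smul_eq_mul]
  have : √ρ * √ρ = ρ := Real.mul_self_sqrt hρ.le
  have h0 : √ρ ≠ 0 := (Real.sqrt_pos.2 hρ).ne'
  nth_rewrite 1 [← this]
  field_simp

lemma res_normalized (h : CB2 d w M) (hρ : 0 < ρ) {A : Matrix (Fin d) (Fin d) ℝ}
    (hA : ∀ i j, ∑ k, (σ (EuclideanSpace.single k 1)) i * (σ (EuclideanSpace.single k 1)) j = A i j)
    (z) : res d (normalized ρ w σ x0) z = ρ * w (x0 + (√ρ)⁻¹ • σ z) -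
      1 / 2 * ∑ i, ∑ j, A i j * pd2 d w (x0 + (√ρ)⁻¹ • σ z) i j := by
  unfold res lap
  have h1 : normalized ρ w σ x0 z = ρ * w (x0 + (√ρ)⁻¹ • σ z) := rfl
  rw [h1]
  congr 2
  simp_rw [h.pd2_normalized hρ, ← hA, h.pd2_eq, Finset.sum_mul]
  have : ∀ k, fderiv ℝ (fderiv ℝ w) (x0 + (√ρ)⁻¹ • σ z) (σ (EuclideanSpace.single k 1))
      (σ (EuclideanSpace.single k 1)) = _ := fun k =>
    bilin_apply_eq_sum _ (ContinuousLinearMap.id ℝ _) (σ (EuclideanSpace.single k 1))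
      (σ (EuclideanSpace.single k 1))
  simp_rw [this, ContinuousLinearMap.id_apply]
  rw [Finset.sum_comm]
  refine Finset.sum_congr rfl fun i _ => ?_
  rw [Finset.sum_comm]

lemma norm_symm_sq_le (hm : 0 < m) (hσ : ∀ z, m * ‖z‖ ^ 2 ≤ ‖σ z‖ ^ 2) (v) :
    ‖σ.symm v‖ ^ 2 ≤ m⁻¹ * ‖v‖ ^ 2 := by
  have := hσ (σ.symm v)
  rw [σ.apply_symm_apply] at this
  rw [inv_mul_eq_div, le_div_iff₀ hm]
  linarith

lemma hsq_le_normalized (h : CB2 d w M) (hρ : 0 < ρ) (hm : 0 < m)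
    (hσ : ∀ z, m * ‖z‖ ^ 2 ≤ ‖σ z‖ ^ 2) (z) :
    hsq d w (x0 + (√ρ)⁻¹ • σ z) ≤ d ^ 2 * (m⁻¹) ^ 2 * hsq d (normalized ρ w σ x0) z := by
  set B := fderiv ℝ (fderiv ℝ w) (x0 + (√ρ)⁻¹ • σ z) with hB
  have hτ : ∀ i, ‖σ.symm (EuclideanSpace.single i 1)‖ ^ 2 ≤ m⁻¹ := fun i => by
    simpa using norm_symm_sq_le hm hσ (EuclideanSpace.single i (1 : ℝ))
  have key : ∀ i j, pd2 d w (x0 + (√ρ)⁻¹ • σ z) i j ^ 2 ≤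
      (m⁻¹) ^ 2 * hsq d (normalized ρ w σ x0) z := by
    intro i j
    set a := σ.symm (EuclideanSpace.single i (1 : ℝ)) with ha
    set b := σ.symm (EuclideanSpace.single j (1 : ℝ)) with hb
    have e1 : pd2 d w (x0 + (√ρ)⁻¹ • σ z) i j = ∑ k, ∑ l, (a k * b l) *
        pd2 d (normalized ρ w σ x0) z k l := by
      simp_rw [h.pd2_normalized hρ, h.pd2_eq]
      have := bilin_apply_eq_sum B
        (σ : EuclideanSpace ℝ (Fin d) →L[ℝ] EuclideanSpace ℝ (Fin d)) a b
      simpa [ha, hb] using this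
    rw [e1, ← Finset.sum_product', hsq, ← Finset.sum_product' (f := fun i j => pd2 d _ z i j ^ 2)]
    refine (Finset.sum_mul_sq_le_sq_mul_sq _ _ _).trans ?_
    refine mul_le_mul_of_nonneg_right ?_ (Finset.sum_nonneg fun _ _ => sq_nonneg _)
    rw [Finset.sum_product' (f := fun k l => (a k * b l) ^ 2)]
    simp_rw [mul_pow, ← Finset.mul_sum]
    rw [← Finset.sum_mul, ← EuclideanSpace.real_norm_sq_eq, ← EuclideanSpace.real_norm_sq_eq, pow_two m⁻¹]
    exact mul_le_mul (hτ i) (hτ j) (sq_nonneg _) (inv_nonneg.2 hm.le)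
  calc hsq d w (x0 + (√ρ)⁻¹ • σ z)
      ≤ ∑ _i : Fin d, ∑ _j : Fin d, (m⁻¹) ^ 2 * hsq d (normalized ρ w σ x0) z :=
        Finset.sum_le_sum fun i _ => Finset.sum_le_sum fun j _ => key i j
    _ = _ := by simp; ring

lemma norm_fderiv_le_normalized (h : CB2 d w M) (hρ : 0 < ρ) (hm : 0 < m)
    (hσ : ∀ z, m * ‖z‖ ^ 2 ≤ ‖σ z‖ ^ 2) {P : ℝ} (hP0 : 0 ≤ P)
    (hP : ∀ k, |pd1 d (normalized ρ w σ x0) 0 k| ≤ P) :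
    √ρ * ‖fderiv ℝ w x0‖ ≤ d * √m⁻¹ * P := by
  have h0 : 0 < √ρ := Real.sqrt_pos.2 hρ
  rw [mul_comm, ← le_div_iff₀ h0]
  refine ContinuousLinearMap.opNorm_le_bound _ (by positivity) fun v => ?_
  have e2 : ∀ k, pd1 d (normalized ρ w σ x0) 0 k =
      √ρ * fderiv ℝ w x0 (σ (EuclideanSpace.single k 1)) := by
    intro k
    unfold pd1 normalized
    rw [(h.affine ρ x0 _).2.1]
    simp only [_root_.smul_apply, ContinuousLinearEquiv.coe_coe, map_smul, smul_eq_mul,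
      map_zero, add_zero]
    have : √ρ * √ρ = ρ := Real.mul_self_sqrt hρ.le
    nth_rewrite 1 [← this]
    field_simp
  have e1 : √ρ * fderiv ℝ w x0 v = ∑ k, (σ.symm v) k * pd1 d (normalized ρ w σ x0) 0 k := by
    conv_lhs => rw [← σ.apply_symm_apply v, eq_sum_smul_single (σ.symm v)]
    simp only [map_sum, map_smul, smul_eq_mul, e2, Finset.mul_sum]
    exact Finset.sum_congr rfl fun k _ => by ring
  have hτ : ‖σ.symm v‖ ≤ √m⁻¹ * ‖v‖ := by
    refine le_of_sq_le_sq ?_ (by positivity)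
    rw [mul_pow, Real.sq_sqrt (inv_nonneg.2 hm.le)]
    exact norm_symm_sq_le hm hσ v
  rw [Real.norm_eq_abs, div_mul_eq_mul_div, le_div_iff₀ h0, mul_comm |_|, ← abs_of_pos h0, ← abs_mul,
    e1]
  calc |∑ k, (σ.symm v) k * pd1 d (normalized ρ w σ x0) 0 k|
      ≤ ∑ _k : Fin d, (√m⁻¹ * ‖v‖) * P := by
        refine (Finset.abs_sum_le_sum_abs _ _).trans (Finset.sum_le_sum fun k _ => ?_)
        rw [abs_mul]
        exact mul_le_mul ((abs_apply_le_norm _ _).trans hτ) (hP k) (abs_nonneg _) (by positivity)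
    _ = _ := by simp; ring

end normalized

end CB2

/-- Jacobian constant for elliptic linear maps. -/
def detK (d : ℕ) (m c : ℝ) : ℝ := ((√(m / c))⁻¹) ^ d

lemma one_le_detK (d : ℕ) {m c : ℝ} (hm : 0 < m) (hm1 : m ≤ 1) (hc : 1 ≤ c) : 1 ≤ detK d m c := by
  have hc0 : 0 < c := by linarith
  refine one_le_pow₀ ((one_le_inv₀ (Real.sqrt_pos.2 (by positivity))).2 ?_)
  rw [Real.sqrt_le_one]
  rw [div_le_one hc0]
  linarith

section elliptic

variable {d : ℕ} {m c ρ K M : ℝ} {σ : EuclideanSpace ℝ (Fin d) ≃L[ℝ] EuclideanSpace ℝ (Fin d)}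
  {f : EuclideanSpace ℝ (Fin d) → ℝ}

lemma integral_comp_elliptic_le (hm : 0 < m) (hc : 1 ≤ c) (hρ : 0 < ρ)
    (hσ : ∀ z, m * ‖z‖ ^ 2 ≤ ‖σ z‖ ^ 2 ∧ ‖σ z‖ ^ 2 ≤ c * ‖z‖ ^ 2)
    (hf : Continuous f) (hM : ∀ z, |f z| ≤ M) (h0 : ∀ z, 0 ≤ f z)
    (hK : ∀ x t, 0 < t → heat (t / ρ) f x ≤ K ^ 2 * (1 + (√t)⁻¹))
    (y0 : EuclideanSpace ℝ (Fin d)) {s : ℝ} (hs : 0 < s) :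
    ∫ z, f (y0 + (√ρ)⁻¹ • σ (√s • z)) ∂(gs d) ≤ detK d m c * (K ^ 2 * (1 + (√s)⁻¹)) := by
  have hc0 : 0 < c := by linarith
  have hsc : 0 < √c := Real.sqrt_pos.2 hc0
  set L : EuclideanSpace ℝ (Fin d) ≃L[ℝ] EuclideanSpace ℝ (Fin d) :=
    σ.trans (ContinuousLinearEquiv.smulLeft (Units.mk0 (√c)⁻¹ (inv_ne_zero hsc.ne'))) with hL
  have hLz : ∀ z, L z = (√c)⁻¹ • σ z := fun z => rfl
  have hn : ∀ z, ‖L z‖ ^ 2 = c⁻¹ * ‖σ z‖ ^ 2 := by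
    intro z
    rw [hLz, norm_smul, mul_pow, Real.norm_eq_abs, sq_abs, inv_pow, Real.sq_sqrt hc0.le]
  have hL1 : ∀ z, ‖L z‖ ≤ ‖z‖ := by
    intro z
    refine le_of_sq_le_sq ?_ (norm_nonneg _)
    rw [hn, inv_mul_le_iff₀ hc0]
    exact (hσ z).2
  have hL2 : ∀ z, √(m / c) * ‖z‖ ≤ ‖L z‖ := by
    intro z
    refine le_of_sq_le_sq ?_ (norm_nonneg _)
    rw [hn, mul_pow, Real.sq_sqrt (by positivity), div_eq_inv_mul, mul_assoc]
    exact mul_le_mul_of_nonneg_left (hσ z).1 (by positivity)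
  have h1 := integral_gs_comp_le_of_bound (f := fun z => f (y0 + √(c * s / ρ) • z))
    (by fun_prop) (fun z => hM _) (fun z => h0 _) L hL1 (k := √(m / c))
    (Real.sqrt_pos.2 (by positivity)) hL2
  have e1 : ∀ z, y0 + √(c * s / ρ) • L z = y0 + (√ρ)⁻¹ • σ (√s • z) := by
    intro z
    rw [hLz, map_smul, smul_smul, smul_smul, Real.sqrt_div (by positivity), Real.sqrt_mul hc0.le]
    congr 2
    field_simp
  simp only [e1] at h1
  refine h1.trans (mul_le_mul_of_nonneg_left ?_ (by positivity))
  refine (hK y0 (c * s) (by positivity)).trans ?_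
  gcongr
  nlinarith

lemma integral_weight_comp_elliptic_le (hm : 0 < m) (hm1 : m ≤ 1) (hc : 1 ≤ c) (hρ : 0 < ρ)
    (hσ : ∀ z, m * ‖z‖ ^ 2 ≤ ‖σ z‖ ^ 2 ∧ ‖σ z‖ ^ 2 ≤ c * ‖z‖ ^ 2)
    (hf : Continuous f) (hM : ∀ z, |f z| ≤ M) (h0 : ∀ z, 0 ≤ f z)
    (hK : ∀ x t, 0 < t → heat (t / ρ) f x ≤ K ^ 2 * (1 + (√t)⁻¹))
    (y0 : EuclideanSpace ℝ (Fin d)) {s : ℝ} (hs : 0 < s) :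
    ∫ z, (1 + ‖z‖ ^ 2) * f (y0 + (√ρ)⁻¹ • σ (√s • z)) ∂(gs d) ≤
      4 * √2 ^ d * (detK d m c * (K ^ 2 * (1 + (√s)⁻¹))) := by
  have h1 := integral_gs_weight_le (f := fun z => f (y0 + (√ρ)⁻¹ • σ (√s • z)))
    (by fun_prop) (fun z => hM _) (fun z => h0 _)
  have h2 := integral_comp_elliptic_le hm hc hρ hσ hf hM h0 hK y0 (s := s * 2) (by positivity)
  have hd := one_le_detK d hm hm1 hc
  refine h1.trans (mul_le_mul_of_nonneg_left ?_ (by positivity))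
  simp_rw [smul_smul, ← Real.sqrt_mul hs.le]
  refine h2.trans ?_
  gcongr
  linarith

end elliptic

lemma one_add_mul_le_exp {s : ℝ} (hs : 0 < s) :
    (1 + s) * (1 + (√s)⁻¹) ≤ 24 * ((√s)⁻¹ * Real.exp (s / 2)) := by
  have h1 := Real.quadratic_le_exp_of_nonneg (x := s / 2) (by positivity)
  have hq : 0 < √s := Real.sqrt_pos.2 hs
  have h2 : √s ^ 2 = s := Real.sq_sqrt hs.le
  have e : (1 + s) * (1 + (√s)⁻¹) = (√s)⁻¹ * ((1 + s) * (1 + √s)) := by field_simp; ring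
  rw [e, mul_left_comm (24 : ℝ)]
  refine mul_le_mul_of_nonneg_left ?_ (by positivity)
  have h3 : 1 + √s ≤ 3 / 2 + s / 2 := by nlinarith [sq_nonneg (√s - 1)]
  nlinarith [mul_le_mul_of_nonneg_left h3 (by positivity : (0 : ℝ) ≤ 1 + s)]

/-- Constant in the residual bound. -/
def resC (d : ℕ) (m c : ℝ) : ℝ := 1152 * √2 ^ d * c * detK d m c

lemma one_le_resC (d : ℕ) {m c : ℝ} (hm : 0 < m) (hm1 : m ≤ 1) (hc : 1 ≤ c) : 1 ≤ resC d m c := by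
  have h1 := one_le_detK d hm hm1 hc
  have h2 : (1 : ℝ) ≤ √2 ^ d := one_le_pow₀ (by rw [Real.one_le_sqrt]; norm_num)
  unfold resC
  have h3 : 1 ≤ 1152 * √2 ^ d := by linarith
  exact one_le_mul_of_one_le_of_one_le (one_le_mul_of_one_le_of_one_le h3 hc) h1

lemma resBound_numeric {d : ℕ} {m c K K' R1 R2 δ s X : ℝ} (hm : 0 < m) (hm1 : m ≤ 1) (hc : 1 ≤ c)
    (hs : 0 < s) (hX1 : 1 ≤ X) (hK : 0 ≤ K) (hK' : 0 ≤ K') (hR1 : 0 ≤ R1) (hR2 : 0 ≤ R2)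
    (hδ : 0 ≤ δ) :
    3 * R1 ^ 2 + 3 * R2 ^ 2 * (detK d m c * (K' ^ 2 * (1 + (√s)⁻¹))) +
      12 * c * δ ^ 2 * X * (1 + s) * (4 * √2 ^ d * (detK d m c * (K ^ 2 * (1 + (√s)⁻¹)))) ≤
    (resC d m c * (R1 + R2 * K' + δ * K)) ^ 2 * X * (√s)⁻¹ * Real.exp (s / 2) := by
  have hC1 := one_le_resC d hm hm1 hc
  have hC0 : resC d m c = 48 * (√2 ^ d * c * detK d m c) * 24 := by unfold resC; ring
  have hexp := one_add_mul_le_exp hs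
  have hD := one_le_detK d hm hm1 hc
  have h2d : (1 : ℝ) ≤ √2 ^ d := one_le_pow₀ (by rw [Real.one_le_sqrt]; norm_num)
  set D := detK d m c with hDdef
  set q := (1 + s) * (1 + (√s)⁻¹) with hq
  have hq1 : 1 + (√s)⁻¹ ≤ q := by
    rw [hq]; nlinarith [(by positivity : 0 < 1 + (√s)⁻¹)]
  have hq2 : 1 ≤ q := by
    have : 0 ≤ (√s)⁻¹ := by positivity
    linarith
  set T := √2 ^ d with hT
  have hTc : 1 ≤ T * c := one_le_mul_of_one_le_of_one_le h2d hc
  have hTcD : 1 ≤ T * c * D := one_le_mul_of_one_le_of_one_le hTc hD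
  have hXq : 1 ≤ X * q := one_le_mul_of_one_le_of_one_le hX1 hq2
  have b1 : 3 * R1 ^ 2 ≤ 48 * (T * c * D) * (X * q) * R1 ^ 2 := by
    have : 3 ≤ 48 * (T * c * D) * (X * q) := by 
      have := one_le_mul_of_one_le_of_one_le hTcD hXq
      linarith
    exact mul_le_mul_of_nonneg_right this (sq_nonneg _)
  have b2 : 3 * R2 ^ 2 * (D * (K' ^ 2 * (1 + (√s)⁻¹))) ≤
      48 * (T * c * D) * (X * q) * (R2 * K') ^ 2 := by
    have e1 : D * (1 + (√s)⁻¹) ≤ (T * c * D) * (X * q) := by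
      refine mul_le_mul ?_ ?_ (by positivity) (by positivity)
      · exact le_mul_of_one_le_left (by positivity) hTc
      · exact hq1.trans (le_mul_of_one_le_left (by positivity) hX1)
    have e2 := mul_le_mul_of_nonneg_right e1 (sq_nonneg (R2 * K'))
    have e3 : 0 ≤ (T * c * D) * (X * q) * (R2 * K') ^ 2 := by positivity
    calc _ = 3 * (D * (1 + (√s)⁻¹) * (R2 * K') ^ 2) := by ring
      _ ≤ 3 * ((T * c * D) * (X * q) * (R2 * K') ^ 2) := by gcongr
      _ ≤ _ := by linarith
  have b3 : 12 * c * δ ^ 2 * X * (1 + s) * (4 * T * (D * (K ^ 2 * (1 + (√s)⁻¹)))) =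
      48 * (T * c * D) * (X * q) * (δ * K) ^ 2 := by rw [hq]; ring
  have b4 : R1 ^ 2 + (R2 * K') ^ 2 + (δ * K) ^ 2 ≤ (R1 + R2 * K' + δ * K) ^ 2 := by
    have := mul_nonneg hR1 (mul_nonneg hR2 hK')
    have := mul_nonneg hR1 (mul_nonneg hδ hK)
    have := mul_nonneg (mul_nonneg hR2 hK') (mul_nonneg hδ hK)
    nlinarith
  have hC : 48 * (T * c * D) * 24 ≤ resC d m c ^ 2 := by
    rw [← hC0]; nlinarith
  calc _ ≤ 48 * (T * c * D) * (X * q) * (R1 ^ 2 + (R2 * K') ^ 2 + (δ * K) ^ 2) := by linarith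
    _ ≤ 48 * (T * c * D) * (X * q) * (R1 + R2 * K' + δ * K) ^ 2 := by gcongr
    _ ≤ 48 * (T * c * D) * (X * (24 * ((√s)⁻¹ * Real.exp (s / 2)))) *
        (R1 + R2 * K' + δ * K) ^ 2 := by gcongr
    _ = (48 * (T * c * D) * 24) * ((R1 + R2 * K' + δ * K) ^ 2 *
        (X * (√s)⁻¹ * Real.exp (s / 2))) := by ring
    _ ≤ resC d m c ^ 2 * ((R1 + R2 * K' + δ * K) ^ 2 *
        (X * (√s)⁻¹ * Real.exp (s / 2))) := by gcongr
    _ = _ := by ring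

namespace CB2

variable {d : ℕ} {w w' : EuclideanSpace ℝ (Fin d) → ℝ} {M M' m c ρ K K' R1 R2 δ : ℝ}

lemma resBound_normalized (h : CB2 d w M) (h' : CB2 d w' M') (hm : 0 < m) (hm1 : m ≤ 1)
    (hc : 1 ≤ c) (hρ : 0 < ρ) (hw : HB d ρ w K) (hw' : HB d ρ w' K') (hK : 0 ≤ K) (hK' : 0 ≤ K')
    (hR1 : 0 ≤ R1) (hR2 : 0 ≤ R2) (hδ : 0 ≤ δ) {x0 : EuclideanSpace ℝ (Fin d)}
    {A : Matrix (Fin d) (Fin d) ℝ} {σ : EuclideanSpace ℝ (Fin d) ≃L[ℝ] EuclideanSpace ℝ (Fin d)}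
    (hA : ∀ i j, ∑ k, (σ (EuclideanSpace.single k 1)) i * (σ (EuclideanSpace.single k 1)) j = A i j)
    (hσ : ∀ z, m * ‖z‖ ^ 2 ≤ ‖σ z‖ ^ 2 ∧ ‖σ z‖ ^ 2 ≤ c * ‖z‖ ^ 2)
    (hres : ∀ y, |ρ * w y - 1 / 2 * ∑ i, ∑ j, A i j * pd2 d w y i j| ≤
      R1 + R2 * √(hsq d w' y) + δ * (1 + √ρ * dist y x0) * √(hsq d w y)) :
    ResBound d (normalized ρ w σ x0) (resC d m c * (R1 + R2 * K' + δ * K)) := by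
  intro x s hs
  obtain ⟨MU, hU⟩ := h.exists_normalized (ρ := ρ) (σ := σ) (x0 := x0)
  have hsρ : 0 < √ρ := Real.sqrt_pos.2 hρ
  have hc0 : 0 < c := by linarith
  set Y : EuclideanSpace ℝ (Fin d) → EuclideanSpace ℝ (Fin d) :=
    fun z => x0 + (√ρ)⁻¹ • σ z with hY
  have hptw : ∀ z, res d (normalized ρ w σ x0) z ^ 2 ≤ 3 * R1 ^ 2 + 3 * R2 ^ 2 * hsq d w' (Y z) +
      6 * c * δ ^ 2 * (1 + ‖z‖ ^ 2) * hsq d w (Y z) := by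
    intro z
    have hdist : √ρ * dist (Y z) x0 = ‖σ z‖ := by
      rw [hY, dist_eq_norm, add_sub_cancel_left, norm_smul, norm_inv, Real.norm_of_nonneg hsρ.le,
        mul_inv_cancel_left₀ hsρ.ne']
    have h1 := hres (Y z)
    rw [← h.res_normalized hρ hA z, hdist] at h1
    set a := √(hsq d w' (Y z)) with ha
    set b := √(hsq d w (Y z)) with hb
    have ha2 : a ^ 2 = hsq d w' (Y z) := Real.sq_sqrt (hsq_nonneg _)
    have hb2 : b ^ 2 = hsq d w (Y z) := Real.sq_sqrt (hsq_nonneg _)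
    have h2 : res d (normalized ρ w σ x0) z ^ 2 ≤ (R1 + R2 * a + δ * (1 + ‖σ z‖) * b) ^ 2 := by
      rw [← sq_abs]
      exact pow_le_pow_left₀ (abs_nonneg _) h1 2
    have h3 : (1 + ‖σ z‖) ^ 2 ≤ 2 * c * (1 + ‖z‖ ^ 2) := by
      nlinarith [sq_nonneg (1 - ‖σ z‖), (hσ z).2]
    rw [← ha2, ← hb2]
    have h4 : (R1 + R2 * a + δ * (1 + ‖σ z‖) * b) ^ 2 ≤
        3 * R1 ^ 2 + 3 * (R2 * a) ^ 2 + 3 * (δ * (1 + ‖σ z‖) * b) ^ 2 := by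
      nlinarith [sq_nonneg (R1 - R2 * a), sq_nonneg (R1 - δ * (1 + ‖σ z‖) * b),
        sq_nonneg (R2 * a - δ * (1 + ‖σ z‖) * b)]
    have h5 := mul_le_mul_of_nonneg_left h3 (by positivity : 0 ≤ 3 * (δ ^ 2 * b ^ 2))
    calc _ ≤ _ := h2.trans h4
      _ = 3 * R1 ^ 2 + 3 * R2 ^ 2 * a ^ 2 + 3 * (δ ^ 2 * b ^ 2) * (1 + ‖σ z‖) ^ 2 := by ring
      _ ≤ 3 * R1 ^ 2 + 3 * R2 ^ 2 * a ^ 2 + 3 * (δ ^ 2 * b ^ 2) * (2 * c * (1 + ‖z‖ ^ 2)) := by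
        linarith
      _ = _ := by ring
  set X := 1 + ‖x‖ ^ 2 with hX
  have hX1 : 1 ≤ X := by rw [hX]; nlinarith [sq_nonneg ‖x‖]
  have hweight : ∀ z : EuclideanSpace ℝ (Fin d),
      1 + ‖x + √s • z‖ ^ 2 ≤ 2 * X * (1 + s) * (1 + ‖z‖ ^ 2) := by
    intro z
    have h1 := norm_add_le x (√s • z)
    rw [norm_smul, Real.norm_of_nonneg (Real.sqrt_nonneg s)] at h1
    have h2 := pow_le_pow_left₀ (norm_nonneg _) h1 2
    have h3 : (‖x‖ + √s * ‖z‖) ^ 2 ≤ 2 * ‖x‖ ^ 2 + 2 * (s * ‖z‖ ^ 2) := by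
      nlinarith [sq_nonneg (‖x‖ - √s * ‖z‖), Real.sq_sqrt hs.le]
    have e1 : 2 * X * (1 + s) * (1 + ‖z‖ ^ 2) = 2 + 2 * ‖x‖ ^ 2 + 2 * (s * ‖z‖ ^ 2) +
        (2 * s + 2 * ‖z‖ ^ 2 + 2 * ‖x‖ ^ 2 * (s + ‖z‖ ^ 2 + s * ‖z‖ ^ 2)) := by rw [hX]; ring
    have e2 : 0 ≤ 2 * s + 2 * ‖z‖ ^ 2 + 2 * ‖x‖ ^ 2 * (s + ‖z‖ ^ 2 + s * ‖z‖ ^ 2) := by positivity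
    linarith
  have hYadd : ∀ z, Y (x + √s • z) = Y x + (√ρ)⁻¹ • σ (√s • z) := by
    intro z
    simp only [hY, map_add, smul_add, add_assoc]
  have hb : ∀ z, |hsq d w z| ≤ d ^ 2 * M ^ 2 := fun z => by
    rw [abs_of_nonneg (hsq_nonneg _)]; exact h.hsq_le z
  have hb' : ∀ z, |hsq d w' z| ≤ d ^ 2 * M' ^ 2 := fun z => by
    rw [abs_of_nonneg (hsq_nonneg _)]; exact h'.hsq_le z
  have I1 := integral_comp_elliptic_le hm hc hρ hσ h'.continuous_hsq hb' (fun z => hsq_nonneg _)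
    hw' (Y x) hs
  have I2 := integral_weight_comp_elliptic_le hm hm1 hc hρ hσ h.continuous_hsq hb
    (fun z => hsq_nonneg _) hw (Y x) hs
  have hcw := h.continuous_hsq
  have hcw' := h'.continuous_hsq
  have i1 : Integrable (fun z => hsq d w' (Y x + (√ρ)⁻¹ • σ (√s • z))) (gs d) :=
    integrable_gs_of_bound (M := d ^ 2 * M' ^ 2) (by fun_prop) fun z => hb' _
  have i2 : Integrable (fun z => (1 + ‖z‖ ^ 2) * hsq d w (Y x + (√ρ)⁻¹ • σ (√s • z))) (gs d) := by
    refine integrable_gs_of_poly (C := d ^ 2 * M ^ 2) (n := 2) (by fun_prop) fun z => ?_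
    rw [norm_mul, mul_comm]
    refine mul_le_mul (hb _) ?_ (norm_nonneg _) (by positivity)
    rw [Real.norm_of_nonneg (by positivity)]
    nlinarith [norm_nonneg z]
  have i0 : Integrable (fun z => res d (normalized ρ w σ x0) (x + √s • z) ^ 2) (gs d) := by
    have := hU.continuous_res
    refine integrable_gs_of_bound (M := ((1 + d) * MU) ^ 2) (by fun_prop) fun z => ?_
    rw [Real.norm_of_nonneg (sq_nonneg _), ← sq_abs]
    exact pow_le_pow_left₀ (abs_nonneg _) (hU.abs_res_le _) 2
  have i3 : Integrable (fun z => 3 * R1 ^ 2 + 3 * R2 ^ 2 *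
      hsq d w' (Y x + (√ρ)⁻¹ • σ (√s • z))) (gs d) :=
    (integrable_const _).add (i1.const_mul _)
  have i4 : Integrable (fun z => 12 * c * δ ^ 2 * X * (1 + s) *
      ((1 + ‖z‖ ^ 2) * hsq d w (Y x + (√ρ)⁻¹ • σ (√s • z)))) (gs d) := i2.const_mul _
  have main : _root_.heat s (fun y => res d (normalized ρ w σ x0) y ^ 2) x ≤
      3 * R1 ^ 2 + 3 * R2 ^ 2 * (detK d m c * (K' ^ 2 * (1 + (√s)⁻¹))) +
      12 * c * δ ^ 2 * X * (1 + s) * (4 * √2 ^ d * (detK d m c * (K ^ 2 * (1 + (√s)⁻¹)))) := by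
    calc _ ≤ ∫ z, (3 * R1 ^ 2 + 3 * R2 ^ 2 * hsq d w' (Y x + (√ρ)⁻¹ • σ (√s • z))) +
          12 * c * δ ^ 2 * X * (1 + s) *
            ((1 + ‖z‖ ^ 2) * hsq d w (Y x + (√ρ)⁻¹ • σ (√s • z))) ∂(gs d) := by
          refine integral_mono i0 (i3.add i4) fun z => ?_
          refine (hptw (x + √s • z)).trans ?_
          rw [hYadd]
          have h1 := mul_le_mul_of_nonneg_left (hweight z) (by positivity : 0 ≤ 6 * c * δ ^ 2)
          have h2 := mul_le_mul_of_nonneg_right h1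
            (hsq_nonneg (u := w) (Y x + (√ρ)⁻¹ • σ (√s • z)))
          linarith
      _ = 3 * R1 ^ 2 + 3 * R2 ^ 2 * (∫ z, hsq d w' (Y x + (√ρ)⁻¹ • σ (√s • z)) ∂(gs d)) +
          12 * c * δ ^ 2 * X * (1 + s) *
            ∫ z, (1 + ‖z‖ ^ 2) * hsq d w (Y x + (√ρ)⁻¹ • σ (√s • z)) ∂(gs d) := by
          rw [integral_add i3 i4, integral_add (integrable_const _) (i1.const_mul _),
            integral_const_mul (3 * R2 ^ 2), integral_const_mul (12 * c * δ ^ 2 * X * (1 + s))]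
          simp
      _ ≤ _ := by gcongr
  exact main.trans (resBound_numeric hm hm1 hc hs hX1 hK hK' hR1 hR2 hδ)

end CB2

/-- Constant in the one-step estimate for the frozen-coefficient equation. -/
def stepC (d : ℕ) (m c : ℝ) : ℝ :=
  resC d m c * (56 * gaussW d + d * √m⁻¹ * (56 * gaussW d) + d * m⁻¹ * √(detK d m c * hessC d))

lemma stepC_pos (d : ℕ) {m c : ℝ} (hm : 0 < m) (hm1 : m ≤ 1) (hc : 1 ≤ c) : 0 < stepC d m c := by
  have h1 := one_le_resC d hm hm1 hc
  have h2 := gaussW_pos d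
  unfold stepC
  positivity

namespace CB2

variable {d : ℕ} {w w' : EuclideanSpace ℝ (Fin d) → ℝ} {M M' m c ρ K K' R1 R2 δ N t : ℝ}
  {x0 : EuclideanSpace ℝ (Fin d)} {σ : EuclideanSpace ℝ (Fin d) ≃L[ℝ] EuclideanSpace ℝ (Fin d)}

lemma heat_hsq_le_normalized (h : CB2 d w M) (hm : 0 < m) (hc : 1 ≤ c) (hρ : 0 < ρ)
    (hσ : ∀ z, m * ‖z‖ ^ 2 ≤ ‖σ z‖ ^ 2 ∧ ‖σ z‖ ^ 2 ≤ c * ‖z‖ ^ 2)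
    (hN : ResBound d (normalized ρ w σ x0) N) (hN0 : 0 ≤ N) (ht : 0 < t) (htm : t ≤ m) :
    _root_.heat (t / ρ) (hsq d w) x0 ≤
      (d * m⁻¹ * √(detK d m c * hessC d) * N) ^ 2 * (√(t / m))⁻¹ := by
  obtain ⟨MU, hU⟩ := h.exists_normalized (ρ := ρ) (σ := σ) (x0 := x0)
  have hc0 : 0 < c := by linarith
  have hsm : 0 < √m := Real.sqrt_pos.2 hm
  have hsρ : 0 < √ρ := Real.sqrt_pos.2 hρ
  set L : EuclideanSpace ℝ (Fin d) ≃L[ℝ] EuclideanSpace ℝ (Fin d) :=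
    σ.symm.trans (ContinuousLinearEquiv.smulLeft (Units.mk0 (√m) hsm.ne')) with hL
  have hLz : ∀ z, L z = √m • σ.symm z := fun z => rfl
  have hn : ∀ z, ‖L z‖ ^ 2 = m * ‖σ.symm z‖ ^ 2 := by
    intro z
    rw [hLz, norm_smul, mul_pow, Real.norm_eq_abs, sq_abs, Real.sq_sqrt hm.le]
  have hL1 : ∀ z, ‖L z‖ ≤ ‖z‖ := by
    intro z
    refine le_of_sq_le_sq ?_ (norm_nonneg _)
    rw [hn]
    simpa using (hσ (σ.symm z)).1
  have hL2 : ∀ z, √(m / c) * ‖z‖ ≤ ‖L z‖ := by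
    intro z
    refine le_of_sq_le_sq ?_ (norm_nonneg _)
    rw [hn, mul_pow, Real.sq_sqrt (by positivity), div_mul_eq_mul_div, div_le_iff₀ hc0, mul_assoc,
      mul_comm _ c]
    refine mul_le_mul_of_nonneg_left ?_ hm.le
    simpa using (hσ (σ.symm z)).2
  have hq0 : 0 < t / m := by positivity
  have hcU := hU.continuous_hsq
  have hcw := h.continuous_hsq
  have hbU : ∀ z, |hsq d (normalized ρ w σ x0) z| ≤ d ^ 2 * MU ^ 2 := fun z => by
    rw [abs_of_nonneg (hsq_nonneg _)]; exact hU.hsq_le z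
  have h1 := integral_gs_comp_le_of_bound (f := fun z => hsq d (normalized ρ w σ x0) (√(t / m) • z))
    (by fun_prop) (fun z => hbU _) (fun z => hsq_nonneg _) L hL1 (k := √(m / c))
    (Real.sqrt_pos.2 (by positivity)) hL2
  have h2 := hU.integral_hsq_le_resBound hN hN0 hq0 ((div_le_one hm).2 htm)
  have e1 : ∀ z, x0 + √(t / ρ) • z = x0 + (√ρ)⁻¹ • σ (√(t / m) • L z) := by
    intro z
    rw [hLz, map_smul, map_smul, σ.apply_symm_apply, smul_smul, smul_smul,
      Real.sqrt_div ht.le, Real.sqrt_div ht.le]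
    congr 2
    field_simp
  have i1 : Integrable (fun z => hsq d w (x0 + √(t / ρ) • z)) (gs d) :=
    integrable_gs_of_bound (M := d ^ 2 * M ^ 2) (by fun_prop) fun z => by
      rw [Real.norm_of_nonneg (hsq_nonneg _)]; exact h.hsq_le _
  have i2 : Integrable (fun z => d ^ 2 * (m⁻¹) ^ 2 *
      hsq d (normalized ρ w σ x0) (√(t / m) • L z)) (gs d) :=
    (integrable_gs_of_bound (M := d ^ 2 * MU ^ 2) (by fun_prop) fun z => hbU _).const_mul _
  have hD0 : 0 ≤ detK d m c := by unfold detK; positivity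
  calc _root_.heat (t / ρ) (hsq d w) x0
      ≤ ∫ z, d ^ 2 * (m⁻¹) ^ 2 * hsq d (normalized ρ w σ x0) (√(t / m) • L z) ∂(gs d) := by
        refine integral_mono i1 i2 fun z => ?_
        simp only [e1]
        exact h.hsq_le_normalized hρ hm (fun z => (hσ z).1) _
    _ = d ^ 2 * (m⁻¹) ^ 2 * ∫ z, hsq d (normalized ρ w σ x0) (√(t / m) • L z) ∂(gs d) :=
        integral_const_mul _ _
    _ ≤ d ^ 2 * (m⁻¹) ^ 2 * (detK d m c * (hessC d * N ^ 2 * (√(t / m))⁻¹)) := by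
        refine mul_le_mul_of_nonneg_left (h1.trans ?_) (by positivity)
        exact mul_le_mul_of_nonneg_left h2 hD0
    _ = _ := by
        rw [mul_pow, mul_pow, Real.sq_sqrt (mul_nonneg hD0 (hessC_pos d).le)]; ring

lemma hb_of_normalized (h : CB2 d w M) (hm : 0 < m) (hm1 : m ≤ 1) (hc : 1 ≤ c) (hρ : 0 < ρ)
    (hN0 : 0 ≤ N)
    (hN : ∀ x0, ∃ σ : EuclideanSpace ℝ (Fin d) ≃L[ℝ] EuclideanSpace ℝ (Fin d),
      (∀ z, m * ‖z‖ ^ 2 ≤ ‖σ z‖ ^ 2 ∧ ‖σ z‖ ^ 2 ≤ c * ‖z‖ ^ 2) ∧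
      ResBound d (normalized ρ w σ x0) N) :
    HB d ρ w (d * m⁻¹ * √(detK d m c * hessC d) * N) := by
  set Q := (d * m⁻¹ * √(detK d m c * hessC d) * N) ^ 2 with hQ
  have hQ0 : 0 ≤ Q := sq_nonneg _
  intro x t ht
  rw [← hQ]
  have hst : 0 < (√t)⁻¹ := inv_pos.2 (Real.sqrt_pos.2 ht)
  rcases le_total t m with htm | htm
  · obtain ⟨σ, hσ, hR⟩ := hN x
    refine (h.heat_hsq_le_normalized hm hc hρ hσ hR hN0 ht htm).trans ?_
    refine mul_le_mul_of_nonneg_left ?_ hQ0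
    have : (√(t / m))⁻¹ ≤ (√t)⁻¹ := by
      gcongr
      rw [le_div_iff₀ hm]
      nlinarith
    linarith
  · have hb : ∀ z, ‖hsq d w z‖ ≤ d ^ 2 * M ^ 2 := fun z => by
      rw [Real.norm_of_nonneg (hsq_nonneg _)]; exact h.hsq_le z
    have e1 := heat_heat (s := (t - m) / ρ) (t := m / ρ) h.continuous_hsq hb
      (div_nonneg (by linarith) hρ.le) (by positivity) x
    have e2 : (t - m) / ρ + m / ρ = t / ρ := by field_simp; ring
    rw [e2] at e1
    rw [← e1]
    have h3 : ∀ y, ‖_root_.heat (m / ρ) (hsq d w) y‖ ≤ Q := by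
      intro y
      obtain ⟨σ, hσ, hR⟩ := hN y
      have := h.heat_hsq_le_normalized hm hc hρ hσ hR hN0 hm le_rfl
      rw [div_self hm.ne', Real.sqrt_one, inv_one, mul_one] at this
      have h0 : 0 ≤ _root_.heat (m / ρ) (hsq d w) y := integral_nonneg fun z => hsq_nonneg _
      rwa [Real.norm_of_nonneg h0]
    refine (le_abs_self _).trans ((heat_norm_le (V := ℝ) h3 x).trans ?_)
    nlinarith

/-- The one-step estimate: freezing the coefficients at each point. -/
lemma step_estimate (h : CB2 d w M) (h' : CB2 d w' M') (hm : 0 < m) (hm1 : m ≤ 1)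
    (hc : 1 ≤ c) (hρ : 0 < ρ) (hw : HB d ρ w K) (hw' : HB d ρ w' K') (hK : 0 ≤ K) (hK' : 0 ≤ K')
    (hR1 : 0 ≤ R1) (hR2 : 0 ≤ R2) (hδ : 0 ≤ δ)
    (hA : ∀ x0, ∃ A : Matrix (Fin d) (Fin d) ℝ, A.IsSymm ∧
      (∀ ξ : Fin d → ℝ, m * ∑ i, ξ i ^ 2 ≤ ∑ i, ∑ j, ξ i * A i j * ξ j) ∧
      (∀ ξ : Fin d → ℝ, ∑ i, ∑ j, ξ i * A i j * ξ j ≤ c * ∑ i, ξ i ^ 2) ∧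
      ∀ y, |ρ * w y - 1 / 2 * ∑ i, ∑ j, A i j * pd2 d w y i j| ≤
        R1 + R2 * √(hsq d w' y) + δ * (1 + √ρ * dist y x0) * √(hsq d w y))
    (hN : stepC d m c * (R1 + R2 * K' + δ * K) ≤ N) :
    (∀ x, ρ * |w x| ≤ N) ∧ (∀ x, √ρ * ‖fderiv ℝ w x‖ ≤ N) ∧ HB d ρ w N := by
  have hres1 := one_le_resC d hm hm1 hc
  have hg := gaussW_pos d
  set N₀ := resC d m c * (R1 + R2 * K' + δ * K) with hN₀
  have hN0 : 0 ≤ N₀ := by positivity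
  have key : ∀ x0, ∃ σ : EuclideanSpace ℝ (Fin d) ≃L[ℝ] EuclideanSpace ℝ (Fin d),
      (∀ z, m * ‖z‖ ^ 2 ≤ ‖σ z‖ ^ 2 ∧ ‖σ z‖ ^ 2 ≤ c * ‖z‖ ^ 2) ∧
      ResBound d (normalized ρ w σ x0) N₀ := by
    intro x0
    obtain ⟨A, hs, hA1, hA2, hA3⟩ := hA x0
    obtain ⟨σ, hσ, hσ'⟩ := exists_sqrt_equiv hs hm hA1 hA2
    exact ⟨σ, hσ', h.resBound_normalized h' hm hm1 hc hρ hw hw' hK hK' hR1 hR2 hδ hσ hσ' hA3⟩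
  have hsplit : 56 * gaussW d * N₀ + d * √m⁻¹ * (56 * gaussW d) * N₀ +
      d * m⁻¹ * √(detK d m c * hessC d) * N₀ ≤ N := by
    refine le_of_eq_of_le ?_ hN
    rw [hN₀]; unfold stepC; ring
  have p1 : 0 ≤ 56 * gaussW d * N₀ := by positivity
  have p2 : 0 ≤ d * √m⁻¹ * (56 * gaussW d) * N₀ := by positivity
  have p3 : 0 ≤ d * m⁻¹ * √(detK d m c * hessC d) * N₀ := by positivity
  refine ⟨fun x => ?_, fun x => ?_, ?_⟩
  · obtain ⟨σ, hσ, hR⟩ := key x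
    obtain ⟨MU, hU⟩ := h.exists_normalized (ρ := ρ) (σ := σ) (x0 := x)
    have h1 := hU.abs_le_resBound hR hN0 0
    have e : normalized ρ w σ x 0 = ρ * w x := by simp [normalized]
    rw [e, abs_mul, abs_of_pos hρ] at h1
    simp only [norm_zero, ne_eq, OfNat.ofNat_ne_zero, not_false_eq_true, zero_pow, add_zero,
      Real.sqrt_one, mul_one] at h1
    linarith
  · obtain ⟨σ, hσ, hR⟩ := key x
    obtain ⟨MU, hU⟩ := h.exists_normalized (ρ := ρ) (σ := σ) (x0 := x)
    have h1 := h.norm_fderiv_le_normalized hρ hm (fun z => (hσ z).1) (P := 56 * gaussW d * N₀) p1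
      (x0 := x) fun k => by
        have h2 := hU.abs_pd1_le_resBound hR hN0 0 k
        simpa using h2
    linarith
  · exact (h.hb_of_normalized hm hm1 hc hρ hN0 key).mono p3 (by linarith)

end CB2

section gibbs

variable {Ω : Type*} [MeasurableSpace Ω] {μ : Measure Ω} [IsProbabilityMeasure μ]
  {φ ψ f : Ω → ℝ} {C C' κ G : ℝ}

lemma integrable_exp_of_bound (hm : Measurable ψ) (hb : ∀ᵐ u ∂μ, |ψ u| ≤ C) :
    Integrable (fun u => Real.exp (ψ u)) μ := by
  refine Integrable.of_bound (by fun_prop) (Real.exp C) (hb.mono fun u hu => ?_)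
  rw [Real.norm_of_nonneg (Real.exp_pos _).le]
  exact Real.exp_le_exp.2 ((le_abs_self _).trans hu)

lemma integral_exp_pos_of_bound (hm : Measurable ψ) (hb : ∀ᵐ u ∂μ, |ψ u| ≤ C) :
    0 < ∫ u, Real.exp (ψ u) ∂μ :=
  integral_exp_pos (integrable_exp_of_bound hm hb)

lemma integrable_mul_gibbs (hm : Measurable ψ) (hb : ∀ᵐ u ∂μ, |ψ u| ≤ C) (hf : Measurable f)
    (hfb : ∀ᵐ u ∂μ, |f u| ≤ C') :
    Integrable (fun u => f u * (Real.exp (ψ u) / ∫ u, Real.exp (ψ u) ∂μ)) μ :=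
  ((integrable_exp_of_bound hm hb).div_const _).bdd_mul (c := C') (by fun_prop) hfb

lemma integral_gibbs (hm : Measurable ψ) (hb : ∀ᵐ u ∂μ, |ψ u| ≤ C) :
    ∫ u, Real.exp (ψ u) / (∫ u, Real.exp (ψ u) ∂μ) ∂μ = 1 := by
  rw [integral_div, div_self (integral_exp_pos_of_bound hm hb).ne']

/-- Averages against the Gibbs density stay in the range of the integrand. -/
lemma abs_integral_mul_gibbs_sub_le (hm : Measurable ψ) (hb : ∀ᵐ u ∂μ, |ψ u| ≤ C)
    (hf : Measurable f) (hfb : ∀ᵐ u ∂μ, |f u - κ| ≤ G) :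
    |∫ u, f u * (Real.exp (ψ u) / ∫ u, Real.exp (ψ u) ∂μ) ∂μ - κ| ≤ G := by
  set Z := ∫ u, Real.exp (ψ u) ∂μ with hZ
  have hZ0 : 0 < Z := integral_exp_pos_of_bound hm hb
  have hf' : ∀ᵐ u ∂μ, |f u| ≤ G + |κ| := hfb.mono fun u hu => by
    have := abs_add_le (f u - κ) κ
    rw [sub_add_cancel] at this
    linarith
  have i1 := integrable_mul_gibbs hm hb hf hf'
  have ip := (integrable_exp_of_bound hm hb).div_const Z
  have i2 : Integrable (fun u => (f u - κ) * (Real.exp (ψ u) / Z)) μ :=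
    integrable_mul_gibbs hm hb (hf.sub_const κ) hfb
  have e1 : ∫ u, f u * (Real.exp (ψ u) / Z) ∂μ - κ =
      ∫ u, (f u - κ) * (Real.exp (ψ u) / Z) ∂μ := by
    simp_rw [sub_mul]
    rw [integral_sub i1 (ip.const_mul κ), integral_const_mul, integral_gibbs hm hb, mul_one]
  rw [e1, ← Real.norm_eq_abs]
  refine (norm_integral_le_of_norm_le (ip.const_mul G) (hfb.mono fun u hu => ?_)).trans ?_
  · have hp : 0 ≤ Real.exp (ψ u) / Z := by positivity
    rw [norm_mul, Real.norm_of_nonneg hp]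
    exact mul_le_mul_of_nonneg_right hu hp
  · rw [integral_const_mul, integral_gibbs hm hb, mul_one]

lemma integral_log_gibbs (hm : Measurable ψ) (hb : ∀ᵐ u ∂μ, |ψ u| ≤ C) :
    ∫ u, Real.log (Real.exp (ψ u) / ∫ u, Real.exp (ψ u) ∂μ) *
        (Real.exp (ψ u) / ∫ u, Real.exp (ψ u) ∂μ) ∂μ =
      ∫ u, ψ u * (Real.exp (ψ u) / ∫ u, Real.exp (ψ u) ∂μ) ∂μ -
        Real.log (∫ u, Real.exp (ψ u) ∂μ) := by
  set Z := ∫ u, Real.exp (ψ u) ∂μ with hZ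
  have hZ0 : 0 < Z := integral_exp_pos_of_bound hm hb
  have i1 := integrable_mul_gibbs hm hb hm hb
  have ip := (integrable_exp_of_bound hm hb).div_const Z
  simp_rw [Real.log_div (Real.exp_pos _).ne' hZ0.ne', Real.log_exp, sub_mul]
  rw [integral_sub i1 (ip.const_mul _), integral_const_mul, integral_gibbs hm hb, mul_one]

lemma log_integral_exp_le (hφ : Measurable φ) (hφb : ∀ᵐ u ∂μ, |φ u| ≤ C')
    (hm : Measurable ψ) (hb : ∀ᵐ u ∂μ, |ψ u| ≤ C) (h : ∀ᵐ u ∂μ, φ u ≤ ψ u + κ) :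
    Real.log (∫ u, Real.exp (φ u) ∂μ) ≤ Real.log (∫ u, Real.exp (ψ u) ∂μ) + κ := by
  have hZ := integral_exp_pos_of_bound hm hb
  have h1 : ∫ u, Real.exp (φ u) ∂μ ≤ (∫ u, Real.exp (ψ u) ∂μ) * Real.exp κ := by
    rw [← integral_mul_const]
    refine integral_mono_ae (integrable_exp_of_bound hφ hφb)
      ((integrable_exp_of_bound hm hb).mul_const _) (h.mono fun u hu => ?_)
    simp only []
    rw [← Real.exp_add]
    exact Real.exp_le_exp.2 hu
  have := Real.log_le_log (integral_exp_pos_of_bound hφ hφb) h1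
  rwa [Real.log_mul hZ.ne' (Real.exp_pos _).ne', Real.log_exp] at this

/-- The first-order Taylor remainder of the log-partition function. -/
lemma abs_log_integral_exp_sub_le (hφ : Measurable φ) (hφb : ∀ᵐ u ∂μ, |φ u| ≤ C')
    (hm : Measurable ψ) (hb : ∀ᵐ u ∂μ, |ψ u| ≤ C) (h : ∀ᵐ u ∂μ, |φ u - ψ u - κ| ≤ G) :
    |Real.log (∫ u, Real.exp (φ u) ∂μ) - Real.log (∫ u, Real.exp (ψ u) ∂μ) -
      ∫ u, (φ u - ψ u) * (Real.exp (ψ u) / ∫ u, Real.exp (ψ u) ∂μ) ∂μ| ≤ 2 * G := by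
  have h1 := log_integral_exp_le (κ := κ + G) hφ hφb hm hb
    (h.mono fun u hu => by linarith [(abs_le.1 hu).2])
  have h2 := log_integral_exp_le (κ := G - κ) hm hb hφ hφb
    (h.mono fun u hu => by linarith [(abs_le.1 hu).1])
  have h3 := abs_le.1 (abs_integral_mul_gibbs_sub_le hm hb (hφ.sub hm) h)
  simp only [Pi.sub_apply] at h3
  rw [abs_le]
  constructor <;> linarith [h3.1, h3.2]

end gibbs

/-- The standing assumptions on the coefficients that are used in the estimates. -/
structure ControlData (d l : ℕ) (C₀ α ε₀ : ℝ) (U : Set (EuclideanSpace ℝ (Fin l)))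
    (r : EuclideanSpace ℝ (Fin d) → EuclideanSpace ℝ (Fin l) → ℝ)
    (b : EuclideanSpace ℝ (Fin d) → EuclideanSpace ℝ (Fin l) → Fin d → ℝ)
    (S : EuclideanSpace ℝ (Fin d) → EuclideanSpace ℝ (Fin l) → Matrix (Fin d) (Fin d) ℝ)
    (S0 : EuclideanSpace ℝ (Fin d) → Matrix (Fin d) (Fin d) ℝ) : Prop where
  measurableSet : MeasurableSet U
  volume_eq : volume U = 1
  measurable_r : ∀ x, Measurable fun u => r x u
  measurable_b : ∀ x i, Measurable fun u => b x u i
  measurable_S : ∀ x i j, Measurable fun u => S x u i j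
  elliptic : ∀ u ∈ U, ∀ x (ξ : Fin d → ℝ),
    (1 / C₀) * ∑ i, ξ i ^ 2 ≤ ∑ i, ∑ j, ξ i * S x u i j * ξ j
  r_le : ∀ u ∈ U, ∀ x, |r x u| ≤ C₀
  b_le : ∀ u ∈ U, ∀ x i, |b x u i| ≤ C₀
  S_le : ∀ u ∈ U, ∀ x i j, |S x u i j| ≤ C₀
  S_holder : ∀ u ∈ U, ∀ x y, dist x y ≤ 1 → ∀ i j, |S x u i j - S y u i j| ≤ C₀ * dist x y ^ α
  S_sub_le : ∀ u ∈ U, ∀ x i j, |S x u i j - S0 x i j| ≤ ε₀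

namespace ControlData

variable {d l : ℕ} {C₀ α ε₀ lam ρ : ℝ} {U : Set (EuclideanSpace ℝ (Fin l))}
  {r : EuclideanSpace ℝ (Fin d) → EuclideanSpace ℝ (Fin l) → ℝ}
  {b : EuclideanSpace ℝ (Fin d) → EuclideanSpace ℝ (Fin l) → Fin d → ℝ}
  {S : EuclideanSpace ℝ (Fin d) → EuclideanSpace ℝ (Fin l) → Matrix (Fin d) (Fin d) ℝ}
  {S0 : EuclideanSpace ℝ (Fin d) → Matrix (Fin d) (Fin d) ℝ}

lemma ae_of (H : ControlData d l C₀ α ε₀ U r b S S0) {p : EuclideanSpace ℝ (Fin l) → Prop}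
    (h : ∀ u ∈ U, p u) : ∀ᵐ u ∂(volume.restrict U), p u :=
  ae_restrict_of_forall_mem H.measurableSet h

lemma isProbabilityMeasure (H : ControlData d l C₀ α ε₀ U r b S S0) :
    IsProbabilityMeasure (volume.restrict U) :=
  ⟨by simpa using H.volume_eq⟩

lemma measurable_gibbsExponent (H : ControlData d l C₀ α ε₀ U r b S S0) (x) (p : Fin d → ℝ)
    (X : Matrix (Fin d) (Fin d) ℝ) : Measurable (gibbsExponent d l lam r b S x p X) := by
  have h1 := H.measurable_r x
  have h2 := H.measurable_b x
  have h3 := H.measurable_S x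
  unfold gibbsExponent
  fun_prop

lemma abs_gibbsExponent_le (H : ControlData d l C₀ α ε₀ U r b S S0) (x) (p : Fin d → ℝ)
    (X : Matrix (Fin d) (Fin d) ℝ) : ∀ u ∈ U, |gibbsExponent d l lam r b S x p X u| ≤
      |1 / lam| * (C₀ + ∑ i, C₀ * |p i| + 1 / 2 * ∑ i, ∑ j, C₀ * |X j i|) := by
  intro u hu
  unfold gibbsExponent
  rw [abs_mul]
  refine mul_le_mul_of_nonneg_left ?_ (abs_nonneg _)
  have h1 : |∑ i, b x u i * p i| ≤ ∑ i, C₀ * |p i| :=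
    (Finset.abs_sum_le_sum_abs _ _).trans <| Finset.sum_le_sum fun i _ => by
      rw [abs_mul]; exact mul_le_mul_of_nonneg_right (H.b_le u hu x i) (abs_nonneg _)
  have h2 : |∑ i, ∑ j, S x u i j * X j i| ≤ ∑ i, ∑ j, C₀ * |X j i| :=
    (Finset.abs_sum_le_sum_abs _ _).trans <| Finset.sum_le_sum fun i _ =>
      (Finset.abs_sum_le_sum_abs _ _).trans <| Finset.sum_le_sum fun j _ => by
        rw [abs_mul]; exact mul_le_mul_of_nonneg_right (H.S_le u hu x i j) (abs_nonneg _)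
  have h3 := H.r_le u hu x
  rw [abs_le] at *
  constructor <;> linarith [h1.1, h1.2, h2.1, h2.2, h3.1, h3.2]

section average

variable {x : EuclideanSpace ℝ (Fin d)} {ψ : EuclideanSpace ℝ (Fin l) → ℝ} {C : ℝ}

lemma integral_gibbsExponent_mul (H : ControlData d l C₀ α ε₀ U r b S S0) (hψ : Measurable ψ)
    (hψb : ∀ u ∈ U, |ψ u| ≤ C) (q : Fin d → ℝ) (Y : Matrix (Fin d) (Fin d) ℝ)
    {P : EuclideanSpace ℝ (Fin l) → ℝ}
    (hP : P = fun u => Real.exp (ψ u) / ∫ u in U, Real.exp (ψ u)) :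
    ∫ u in U, gibbsExponent d l lam r b S x q Y u * P u =
      (1 / lam) * ((∫ u in U, r x u * P u) + ∑ i, (∫ u in U, b x u i * P u) * q i +
        (1 / 2) * ∑ i, ∑ j, (∫ u in U, S x u i j * P u) * Y j i) := by
  have := H.isProbabilityMeasure
  have hψb' := H.ae_of hψb
  have ir : Integrable (fun u => r x u * P u) (volume.restrict U) := by
    rw [hP]; exact integrable_mul_gibbs hψ hψb' (H.measurable_r x) (H.ae_of fun u hu => H.r_le u hu x)
  have ib : ∀ i, Integrable (fun u => b x u i * P u) (volume.restrict U) := fun i => by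
    rw [hP]
    exact integrable_mul_gibbs hψ hψb' (H.measurable_b x i) (H.ae_of fun u hu => H.b_le u hu x i)
  have iS : ∀ i j, Integrable (fun u => S x u i j * P u) (volume.restrict U) := fun i j => by
    rw [hP]
    exact integrable_mul_gibbs hψ hψb' (H.measurable_S x i j)
      (H.ae_of fun u hu => H.S_le u hu x i j)
  have e : ∀ u, gibbsExponent d l lam r b S x q Y u * P u = (1 / lam) * ((r x u * P u +
      ∑ i, (b x u i * P u) * q i) + (1 / 2) * ∑ i, ∑ j, (S x u i j * P u) * Y j i) := by
    intro u
    have e1 : ∑ i, (b x u i * P u) * q i = (∑ i, b x u i * q i) * P u := by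
      rw [Finset.sum_mul]; exact Finset.sum_congr rfl fun i _ => by ring
    have e2 : ∑ i, ∑ j, (S x u i j * P u) * Y j i = (∑ i, ∑ j, S x u i j * Y j i) * P u := by
      simp_rw [Finset.sum_mul]
      exact Finset.sum_congr rfl fun i _ => Finset.sum_congr rfl fun j _ => by ring
    rw [e1, e2, gibbsExponent]; ring
  have i1 : Integrable (fun u => ∑ i, (b x u i * P u) * q i) (volume.restrict U) :=
    integrable_finsetSum _ fun i _ => (ib i).mul_const _
  have i2 : Integrable (fun u => ∑ i, ∑ j, (S x u i j * P u) * Y j i) (volume.restrict U) :=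
    integrable_finsetSum _ fun i _ => integrable_finsetSum _ fun j _ => (iS i j).mul_const _
  have i3 : Integrable (fun u => r x u * P u + ∑ i, (b x u i * P u) * q i) (volume.restrict U) :=
    ir.add i1
  simp_rw [e]
  rw [integral_const_mul, integral_add i3 (i2.const_mul _), integral_add ir i1, integral_const_mul,
    integral_finsetSum _ fun i _ => (ib i).mul_const _,
    integral_finsetSum _ fun i _ => integrable_finsetSum _ fun j _ => (iS i j).mul_const _]
  congr 3
  · exact Finset.sum_congr rfl fun i _ => integral_mul_const _ _
  · refine Finset.sum_congr rfl fun i _ => ?_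
    rw [integral_finsetSum _ fun j _ => (iS i j).mul_const _]
    exact Finset.sum_congr rfl fun j _ => integral_mul_const _ _

end average

/-- One step of policy iteration, compared pointwise with the solution of the HJB equation. -/
lemma abs_policy_step_le (H : ControlData d l C₀ α ε₀ U r b S S0)
    (hlam : 0 < lam) {x : EuclideanSpace ℝ (Fin d)} {p q s : Fin d → ℝ}
    {X Y T : Matrix (Fin d) (Fin d) ℝ} {V W : ℝ} {P : EuclideanSpace ℝ (Fin l) → ℝ}
    (hP : P = gibbsDensity d l lam U r b S x p X)
    (hV : V = expF d l lam U r b S x q Y)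
    (hW : W - (∫ u in U, r x u * P u) - (∑ i, (∫ u in U, b x u i * P u) * s i) -
      (1 / 2) * (∑ i, ∑ j, (∫ u in U, S x u i j * P u) * T j i) +
      lam * (∫ u in U, Real.log (P u) * P u) = 0) :
    |(V - W) - (∑ i, (∫ u in U, b x u i * P u) * (q i - s i)) -
      (1 / 2) * (∑ i, ∑ j, (∫ u in U, S x u i j * P u) * (Y j i - T j i))| ≤
    2 * (C₀ * ∑ i, |q i - p i| + 1 / 2 * ε₀ * ∑ i, ∑ j, |Y j i - X j i|) := by
  have := H.isProbabilityMeasure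
  set φ := gibbsExponent d l lam r b S x q Y with hφ
  set ψ := gibbsExponent d l lam r b S x p X with hψ
  have mφ : Measurable φ := H.measurable_gibbsExponent x q Y
  have mψ : Measurable ψ := H.measurable_gibbsExponent x p X
  have bφ := H.abs_gibbsExponent_le (lam := lam) x q Y
  have bψ := H.abs_gibbsExponent_le (lam := lam) x p X
  have hP' : P = fun u => Real.exp (ψ u) / ∫ u in U, Real.exp (ψ u) := hP
  have a1 := H.integral_gibbsExponent_mul (lam := lam) (x := x) mψ bψ q Y hP'
  have a2 := H.integral_gibbsExponent_mul (lam := lam) (x := x) mψ bψ p X hP'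
  have a3 := integral_log_gibbs mψ (H.ae_of bψ)
  have i1 := integrable_mul_gibbs mψ (H.ae_of bψ) mφ (H.ae_of bφ)
  have i2 := integrable_mul_gibbs mψ (H.ae_of bψ) mψ (H.ae_of bψ)
  have key := abs_log_integral_exp_sub_le
    (κ := 1 / lam * (1 / 2 * ∑ i, ∑ j, S0 x i j * (Y j i - X j i)))
    (G := 1 / lam * (C₀ * ∑ i, |q i - p i| + 1 / 2 * ε₀ * ∑ i, ∑ j, |Y j i - X j i|))
    mφ (H.ae_of bφ) mψ (H.ae_of bψ) (H.ae_of fun u hu => by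
      have e : φ u - ψ u - 1 / lam * (1 / 2 * ∑ i, ∑ j, S0 x i j * (Y j i - X j i)) =
          1 / lam * (∑ i, b x u i * (q i - p i) +
            1 / 2 * ∑ i, ∑ j, (S x u i j - S0 x i j) * (Y j i - X j i)) := by
        simp only [hφ, hψ, gibbsExponent, mul_sub, sub_mul, Finset.sum_sub_distrib]
        ring
      rw [e, abs_mul, abs_of_pos (by positivity)]
      refine mul_le_mul_of_nonneg_left ?_ (by positivity)
      have h1 : |∑ i, b x u i * (q i - p i)| ≤ C₀ * ∑ i, |q i - p i| := by
        rw [Finset.mul_sum]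
        refine (Finset.abs_sum_le_sum_abs _ _).trans <| Finset.sum_le_sum fun i _ => ?_
        rw [abs_mul]; exact mul_le_mul_of_nonneg_right (H.b_le u hu x i) (abs_nonneg _)
      have h2 : |∑ i, ∑ j, (S x u i j - S0 x i j) * (Y j i - X j i)| ≤
          ε₀ * ∑ i, ∑ j, |Y j i - X j i| := by
        simp_rw [Finset.mul_sum]
        refine (Finset.abs_sum_le_sum_abs _ _).trans <| Finset.sum_le_sum fun i _ =>
          (Finset.abs_sum_le_sum_abs _ _).trans <| Finset.sum_le_sum fun j _ => ?_
        rw [abs_mul]; exact mul_le_mul_of_nonneg_right (H.S_sub_le u hu x i j) (abs_nonneg _)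
      rw [abs_le] at *
      constructor <;> linarith [h1.1, h1.2, h2.1, h2.2])
  simp_rw [sub_mul] at key
  rw [integral_sub i1 i2] at key
  have key' := mul_le_mul_of_nonneg_left key hlam.le
  rw [← abs_of_pos hlam, ← abs_mul, abs_of_pos hlam] at key'
  have hP'' : ∀ u, Real.exp (ψ u) / (∫ u in U, Real.exp (ψ u)) = P u := fun u => by rw [hP']
  simp only [hP''] at key' a3
  rw [a3, a2] at hW
  rw [a1, a2] at key'
  have hV' : V = lam * Real.log (∫ u in U, Real.exp (φ u)) := hV
  have e1 : lam * (2 * (1 / lam * (C₀ * ∑ i, |q i - p i| +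
      1 / 2 * ε₀ * ∑ i, ∑ j, |Y j i - X j i|))) =
      2 * (C₀ * ∑ i, |q i - p i| + 1 / 2 * ε₀ * ∑ i, ∑ j, |Y j i - X j i|) := by
    field_simp
  rw [e1] at key'
  refine le_of_eq_of_le (congrArg _ ?_) key'
  rw [hV']
  simp only [mul_sub, Finset.sum_sub_distrib]
  have hl : lam * (1 / lam) = 1 := by field_simp
  simp only [mul_sub, ← mul_assoc, hl] at hW ⊢
  linarith

end ControlData

lemma sum_sum_abs_le {d : ℕ} (a : Fin d → Fin d → ℝ) :
    ∑ i, ∑ j, |a i j| ≤ d * √(∑ i, ∑ j, a i j ^ 2) := by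
  refine abs_le_of_sq_le_sq' ?_ (by positivity) |>.2
  rw [mul_pow, Real.sq_sqrt (by positivity)]
  calc (∑ i, ∑ j, |a i j|) ^ 2 ≤ d * ∑ i, (∑ j, |a i j|) ^ 2 := by
        simpa using sq_sum_le_card_mul_sum_sq (s := Finset.univ) (f := fun i => ∑ j, |a i j|)
    _ ≤ d * ∑ i, d * ∑ j, a i j ^ 2 := by
        gcongr with i _
        simpa using sq_sum_le_card_mul_sum_sq (s := Finset.univ) (f := fun j => |a i j|)
    _ = _ := by rw [← Finset.mul_sum]; ring

lemma rpow_le_rpow_mul_one_add {α ρ t : ℝ} (hα : 0 < α) (hα1 : α < 1) (hρ : 0 < ρ) (ht : 0 ≤ t) :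
    t ^ α ≤ ρ ^ (-(α / 2)) * (1 + √ρ * t) := by
  have h0 : 0 ≤ √ρ * t := by positivity
  have h1 : (√ρ * t) ^ α ≤ 1 + √ρ * t := by
    rcases le_total (√ρ * t) 1 with h | h
    · exact (Real.rpow_le_one h0 h hα.le).trans (by linarith)
    · calc (√ρ * t) ^ α ≤ (√ρ * t) ^ (1 : ℝ) := Real.rpow_le_rpow_of_exponent_le h hα1.le
        _ ≤ _ := by rw [Real.rpow_one]; linarith
  rw [Real.mul_rpow (Real.sqrt_nonneg _) ht, Real.sqrt_eq_rpow, ← Real.rpow_mul hρ.le] at h1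
  have h2 : 0 < ρ ^ (-(α / 2)) := Real.rpow_pos_of_pos hρ _
  have h3 := mul_le_mul_of_nonneg_left h1 h2.le
  rwa [← mul_assoc, ← Real.rpow_add hρ, show -(α / 2) + 1 / 2 * α = 0 by ring, Real.rpow_zero,
    one_mul, ← Real.sqrt_eq_rpow] at h3

namespace CB2

lemma of_iteratedFDeriv {d : ℕ} {u : EuclideanSpace ℝ (Fin d) → ℝ} {M : ℝ} (h : ContDiff ℝ 2 u)
    (hM : ∀ x, |u x| + ‖fderiv ℝ u x‖ + ‖iteratedFDeriv ℝ 2 u x‖ ≤ M) : CB2 d u M where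
  contDiff := h
  le x := by linarith [hM x, norm_nonneg (fderiv ℝ u x), norm_nonneg (iteratedFDeriv ℝ 2 u x)]
  fderiv_le x := by linarith [hM x, abs_nonneg (u x), norm_nonneg (iteratedFDeriv ℝ 2 u x)]
  fderiv2_le x := by
    have e : ‖iteratedFDeriv ℝ 2 u x‖ = ‖fderiv ℝ (fderiv ℝ u) x‖ := by
      rw [← norm_iteratedFDeriv_fderiv, ← norm_iteratedFDeriv_fderiv, norm_iteratedFDeriv_zero]
    linarith [hM x, norm_nonneg (fderiv ℝ u x), abs_nonneg (u x)]

lemma sum_abs_pd1_le {d : ℕ} {u : EuclideanSpace ℝ (Fin d) → ℝ} {D : ℝ}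
    (hD : ∀ x, ‖fderiv ℝ u x‖ ≤ D) (x) : ∑ i, |pd1 d u x i| ≤ d * D := by
  calc ∑ i, |pd1 d u x i| ≤ ∑ _i : Fin d, D := Finset.sum_le_sum fun i _ => by
        have := (fderiv ℝ u x).le_opNorm (EuclideanSpace.single i 1)
        simp only [PiLp.norm_single, norm_one, mul_one] at this
        exact this.trans (hD x)
    _ = d * D := by simp

end CB2

namespace ControlData

variable {d l : ℕ} {C₀ α ε₀ lam ρ : ℝ} {U : Set (EuclideanSpace ℝ (Fin l))}
  {r : EuclideanSpace ℝ (Fin d) → EuclideanSpace ℝ (Fin l) → ℝ}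
  {b : EuclideanSpace ℝ (Fin d) → EuclideanSpace ℝ (Fin l) → Fin d → ℝ}
  {S : EuclideanSpace ℝ (Fin d) → EuclideanSpace ℝ (Fin l) → Matrix (Fin d) (Fin d) ℝ}
  {S0 : EuclideanSpace ℝ (Fin d) → Matrix (Fin d) (Fin d) ℝ}

lemma abs_S_sub_le (H : ControlData d l C₀ α ε₀ U r b S S0) (hC₀ : 0 ≤ C₀) (hε : 0 ≤ ε₀)
    (hα : 0 < α) {u u0} (hu : u ∈ U) (hu0 : u0 ∈ U) (x0 y) (i j : Fin d) :
    |S y u i j - S x0 u0 i j| ≤ 2 * ε₀ + 2 * C₀ * dist y x0 ^ α := by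
  rcases le_or_gt (dist y x0) 1 with h | h
  · have h1 := abs_le.1 (H.S_sub_le u hu y i j)
    have h2 := abs_le.1 (H.S_sub_le u0 hu0 y i j)
    have h3 := abs_le.1 (H.S_holder u0 hu0 y x0 h i j)
    have h4 : 0 ≤ C₀ * dist y x0 ^ α := mul_nonneg hC₀ (Real.rpow_nonneg dist_nonneg _)
    rw [abs_le]
    constructor <;> linarith [h1.1, h1.2, h2.1, h2.2, h3.1, h3.2]
  · have h1 := abs_le.1 (H.S_le u hu y i j)
    have h2 := abs_le.1 (H.S_le u0 hu0 x0 i j)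
    have h3 : 1 ≤ dist y x0 ^ α := Real.one_le_rpow h.le hα.le
    have h4 : C₀ * 1 ≤ C₀ * dist y x0 ^ α := mul_le_mul_of_nonneg_left h3 hC₀
    rw [abs_le]
    constructor <;> linarith [h1.1, h1.2, h2.1, h2.2]

/-- The linear equation for the error of policy iteration, with leading coefficients frozen
at a point. -/
lemma exists_frozen (H : ControlData d l C₀ α ε₀ U r b S S0) (hC₀ : 1 ≤ C₀) (hε : 0 ≤ ε₀)
    (hα : 0 < α) (hα1 : α < 1) (hρ : 0 < ρ) {w w' : EuclideanSpace ℝ (Fin d) → ℝ} {M D D' : ℝ}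
    (hw : CB2 d w M) (hD : ∀ x, ‖fderiv ℝ w x‖ ≤ D) (hD' : ∀ x, ‖fderiv ℝ w' x‖ ≤ D')
    (hstep : ∀ y, ∃ (p : Fin d → ℝ) (X : Matrix (Fin d) (Fin d) ℝ),
      |ρ * w y - (∑ i, (∫ u in U, b y u i * gibbsDensity d l lam U r b S y p X u) * pd1 d w y i) -
        (1 / 2) * (∑ i, ∑ j, (∫ u in U, S y u i j * gibbsDensity d l lam U r b S y p X u) *
          pd2 d w y j i)| ≤
      2 * (C₀ * ∑ i, |pd1 d w' y i| + 1 / 2 * ε₀ * ∑ i, ∑ j, |pd2 d w' y j i|)) (x0) :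
    ∃ A : Matrix (Fin d) (Fin d) ℝ, A.IsSymm ∧
      (∀ ξ : Fin d → ℝ, 1 / C₀ * ∑ i, ξ i ^ 2 ≤ ∑ i, ∑ j, ξ i * A i j * ξ j) ∧
      (∀ ξ : Fin d → ℝ, ∑ i, ∑ j, ξ i * A i j * ξ j ≤ (d + 1) * C₀ * ∑ i, ξ i ^ 2) ∧
      ∀ y, |ρ * w y - 1 / 2 * ∑ i, ∑ j, A i j * pd2 d w y i j| ≤
        (2 * d * C₀ * D' + d * C₀ * D) + d * ε₀ * √(hsq d w' y) +
          d * (ε₀ + C₀ * ρ ^ (-(α / 2))) * (1 + √ρ * dist y x0) * √(hsq d w y) := by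
  have hprob := H.isProbabilityMeasure
  have hC0 : 0 ≤ C₀ := by linarith
  obtain ⟨u0, hu0⟩ : U.Nonempty := by
    rw [Set.nonempty_iff_ne_empty]
    rintro rfl
    simpa using H.volume_eq
  have hform : ∀ ξ : Fin d → ℝ,
      ∑ i, ∑ j, ξ i * ((S x0 u0 i j + S x0 u0 j i) / 2) * ξ j =
        ∑ i, ∑ j, ξ i * S x0 u0 i j * ξ j := by
    intro ξ
    have e : ∑ i, ∑ j, ξ i * S x0 u0 j i * ξ j = ∑ i, ∑ j, ξ i * S x0 u0 i j * ξ j := by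
      rw [Finset.sum_comm]
      exact Finset.sum_congr rfl fun i _ => Finset.sum_congr rfl fun j _ => by ring
    calc _ = (∑ i, ∑ j, ξ i * S x0 u0 i j * ξ j) / 2 + (∑ i, ∑ j, ξ i * S x0 u0 j i * ξ j) / 2 := by
          simp_rw [Finset.sum_div, ← Finset.sum_add_distrib]
          exact Finset.sum_congr rfl fun i _ => Finset.sum_congr rfl fun j _ => by ring
      _ = _ := by rw [e]; ring
  refine ⟨Matrix.of fun i j => (S x0 u0 i j + S x0 u0 j i) / 2, ?_, fun ξ => ?_, fun ξ => ?_,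
    fun y => ?_⟩
  · ext i j; simp [add_comm]
  · simp only [Matrix.of_apply, hform]; exact H.elliptic u0 hu0 x0 ξ
  · simp only [Matrix.of_apply, hform]
    calc ∑ i, ∑ j, ξ i * S x0 u0 i j * ξ j ≤ ∑ i, ∑ j, |ξ i| * C₀ * |ξ j| := by
          refine Finset.sum_le_sum fun i _ => Finset.sum_le_sum fun j _ => ?_
          refine (le_abs_self _).trans ?_
          rw [abs_mul, abs_mul]
          gcongr
          exact H.S_le u0 hu0 x0 i j
      _ = C₀ * (∑ i, |ξ i|) ^ 2 := by
          rw [sq, Finset.sum_mul_sum, Finset.mul_sum]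
          refine Finset.sum_congr rfl fun i _ => ?_
          rw [Finset.mul_sum]
          exact Finset.sum_congr rfl fun j _ => by ring
      _ ≤ C₀ * (d * ∑ i, ξ i ^ 2) := by
          gcongr
          simpa using sq_sum_le_card_mul_sum_sq (s := Finset.univ) (f := fun i => |ξ i|)
      _ ≤ _ := by
          have : 0 ≤ C₀ * ∑ i, ξ i ^ 2 := by positivity
          linarith
  · obtain ⟨p, X, h⟩ := hstep y
    have mψ := H.measurable_gibbsExponent (lam := lam) y p X
    have bψ := H.ae_of (H.abs_gibbsExponent_le (lam := lam) y p X)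
    set P := gibbsDensity d l lam U r b S y p X with hP
    set G := 2 * ε₀ + 2 * C₀ * dist y x0 ^ α with hG
    have hG0 : 0 ≤ G := by positivity
    have hb : ∀ i, |∫ u in U, b y u i * P u| ≤ C₀ := fun i => by
      have := abs_integral_mul_gibbs_sub_le (κ := 0) (G := C₀) mψ bψ (H.measurable_b y i)
        (H.ae_of fun u hu => by rw [sub_zero]; exact H.b_le u hu y i)
      rwa [sub_zero] at this
    have hS : ∀ i j, |(∫ u in U, S y u i j * P u) - S x0 u0 i j| ≤ G := fun i j =>
      abs_integral_mul_gibbs_sub_le mψ bψ (H.measurable_S y i j)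
        (H.ae_of fun u hu => H.abs_S_sub_le hC0 hε hα hu hu0 x0 y i j)
    have h2 : ∀ v : EuclideanSpace ℝ (Fin d) → ℝ, ∑ i, ∑ j, |pd2 d v y j i| ≤ d * √(hsq d v y) :=
      fun v => by rw [Finset.sum_comm]; exact sum_sum_abs_le _
    have e1 : |∑ i, (∫ u in U, b y u i * P u) * pd1 d w y i| ≤ C₀ * (d * D) := by
      refine (Finset.abs_sum_le_sum_abs _ _).trans ?_
      refine le_trans ?_ (mul_le_mul_of_nonneg_left (CB2.sum_abs_pd1_le hD y) hC0)
      rw [Finset.mul_sum]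
      refine Finset.sum_le_sum fun i _ => ?_
      rw [abs_mul]; exact mul_le_mul_of_nonneg_right (hb i) (abs_nonneg _)
    have e2 : |∑ i, ∑ j, ((∫ u in U, S y u i j * P u) - S x0 u0 i j) * pd2 d w y j i| ≤
        G * (d * √(hsq d w y)) := by
      refine le_trans ?_ (mul_le_mul_of_nonneg_left (h2 w) hG0)
      simp_rw [Finset.mul_sum]
      refine (Finset.abs_sum_le_sum_abs _ _).trans <| Finset.sum_le_sum fun i _ =>
        (Finset.abs_sum_le_sum_abs _ _).trans <| Finset.sum_le_sum fun j _ => ?_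
      rw [abs_mul]; exact mul_le_mul_of_nonneg_right (hS i j) (abs_nonneg _)
    have e3 : ∑ i, ∑ j, ((∫ u in U, S y u i j * P u) - S x0 u0 i j) * pd2 d w y j i =
        (∑ i, ∑ j, (∫ u in U, S y u i j * P u) * pd2 d w y j i) -
          ∑ i, ∑ j, (Matrix.of fun i j => (S x0 u0 i j + S x0 u0 j i) / 2) i j * pd2 d w y i j := by
      have f1 : ∑ i, ∑ j, S x0 u0 j i * pd2 d w y i j = ∑ i, ∑ j, S x0 u0 i j * pd2 d w y j i :=
        Finset.sum_comm
      have f2 : ∑ i, ∑ j, S x0 u0 i j * pd2 d w y i j = ∑ i, ∑ j, S x0 u0 i j * pd2 d w y j i :=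
        Finset.sum_congr rfl fun i _ => Finset.sum_congr rfl fun j _ => by rw [hw.pd2_symm y i j]
      have f3 : ∑ i, ∑ j, (Matrix.of fun i j => (S x0 u0 i j + S x0 u0 j i) / 2) i j *
          pd2 d w y i j = (∑ i, ∑ j, S x0 u0 i j * pd2 d w y i j) / 2 +
            (∑ i, ∑ j, S x0 u0 j i * pd2 d w y i j) / 2 := by
        simp_rw [Finset.sum_div, ← Finset.sum_add_distrib]
        refine Finset.sum_congr rfl fun i _ => Finset.sum_congr rfl fun j _ => ?_
        rw [Matrix.of_apply]; ring
      rw [f3, f1, f2]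
      simp only [sub_mul, Finset.sum_sub_distrib]
      ring
    have e4 := mul_le_mul_of_nonneg_left (CB2.sum_abs_pd1_le hD' y) hC0
    have e5 := mul_le_mul_of_nonneg_left (h2 w') hε
    have e6 : G * (d * √(hsq d w y)) ≤
        2 * (d * (ε₀ + C₀ * ρ ^ (-(α / 2))) * (1 + √ρ * dist y x0) * √(hsq d w y)) := by
      have g1 := rpow_le_rpow_mul_one_add hα hα1 hρ (dist_nonneg (x := y) (y := x0))
      have g2 : 0 ≤ √ρ * dist y x0 := by positivity
      have g3 : G ≤ 2 * ((ε₀ + C₀ * ρ ^ (-(α / 2))) * (1 + √ρ * dist y x0)) := by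
        have g4 := mul_le_mul_of_nonneg_left g1 hC0
        have g5 := mul_nonneg hε g2
        rw [hG]; linarith
      have g6 := mul_le_mul_of_nonneg_right g3 (show 0 ≤ d * √(hsq d w y) by positivity)
      linarith
    rw [e3] at e2
    rw [abs_le] at *
    constructor <;> linarith [h.1, h.2, e1.1, e1.2, e2.1, e2.2]

end ControlData

/-- An upward closed bound that improves under an affine contraction. -/
lemma bound_of_contraction {P : ℝ → Prop} {K₀ K' : ℝ} (hP : ∀ a b, 0 ≤ a → a ≤ b → P a → P b)
    (hK₀ : 0 ≤ K₀) (h₀ : P K₀) (hK' : 0 < K') (hstep : ∀ K, 0 ≤ K → P K → P ((K + K') / 4)) :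
    P (K' / 2) := by
  have key : ∀ k : ℕ, P (K' / 3 + K₀ * (1 / 4) ^ k) := by
    intro k
    induction k with
    | zero => exact hP _ _ hK₀ (by simp; linarith) h₀
    | succ k ih =>
      have := hstep _ (by positivity) ih
      refine hP _ _ (by positivity) (le_of_eq ?_) this
      rw [pow_succ]; ring
  obtain ⟨k, hk⟩ := exists_pow_lt_of_lt_one (show 0 < K' / (6 * (K₀ + 1)) by positivity)
    (show (1 / 4 : ℝ) < 1 by norm_num)
  refine hP _ _ (by positivity) ?_ (key k)
  have h1 : (1 / 4 : ℝ) ^ k * (6 * (K₀ + 1)) < K' := (lt_div_iff₀ (by positivity)).1 hk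
  have h2 : (0 : ℝ) < (1 / 4) ^ k := by positivity
  linarith

/-- The scaled bounds on a function, its gradient and the Gaussian averages of its Hessian. -/
def ScaledBound (d : ℕ) (ρ : ℝ) (w : EuclideanSpace ℝ (Fin d) → ℝ) (K : ℝ) : Prop :=
  (∀ x, ρ * |w x| ≤ K) ∧ (∀ x, √ρ * ‖fderiv ℝ w x‖ ≤ K) ∧ HB d ρ w K

lemma CB2.hb {d : ℕ} {u : EuclideanSpace ℝ (Fin d) → ℝ} {M : ℝ} (h : CB2 d u M) (ρ : ℝ) :
    HB d ρ u (d * M) := fun x t ht => by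
  have h1 := heat_norm_le (V := ℝ) (s := t / ρ) (f := hsq d u) (M := d ^ 2 * M ^ 2)
    (fun z => by rw [Real.norm_of_nonneg (CB2.hsq_nonneg z)]; exact h.hsq_le z) x
  refine (le_abs_self _).trans (h1.trans ?_)
  have : 0 ≤ (d * M) ^ 2 * (√t)⁻¹ := by positivity
  linarith

lemma CB2.exists_scaledBound {d : ℕ} {u : EuclideanSpace ℝ (Fin d) → ℝ} {M ρ : ℝ}
    (h : CB2 d u M) (hρ : 0 < ρ) : ∃ K, 0 ≤ K ∧ ScaledBound d ρ u K := by
  have hM := h.nonneg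
  have h1 : 0 ≤ ρ * M := by positivity
  have h2 : 0 ≤ √ρ * M := by positivity
  have h3 : 0 ≤ d * M := by positivity
  refine ⟨ρ * M + √ρ * M + d * M, by positivity, fun x => ?_, fun x => ?_, ?_⟩
  · have := mul_le_mul_of_nonneg_left (h.le x) hρ.le
    linarith
  · have := mul_le_mul_of_nonneg_left (h.fderiv_le x) (Real.sqrt_nonneg ρ)
    linarith
  · exact (h.hb ρ).mono h3 (by linarith)

namespace ControlData

variable {d l : ℕ} {C₀ α ε₀ lam ρ : ℝ} {U : Set (EuclideanSpace ℝ (Fin l))}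
  {r : EuclideanSpace ℝ (Fin d) → EuclideanSpace ℝ (Fin l) → ℝ}
  {b : EuclideanSpace ℝ (Fin d) → EuclideanSpace ℝ (Fin l) → Fin d → ℝ}
  {S : EuclideanSpace ℝ (Fin d) → EuclideanSpace ℝ (Fin l) → Matrix (Fin d) (Fin d) ℝ}
  {S0 : EuclideanSpace ℝ (Fin d) → Matrix (Fin d) (Fin d) ℝ}

/-- One step of policy iteration halves the scaled bound of the error. -/
lemma scaledBound_half (H : ControlData d l C₀ α ε₀ U r b S S0) (hC₀ : 1 ≤ C₀) (hε : 0 ≤ ε₀)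
    (hα : 0 < α) (hα1 : α < 1) (hρ : 0 < ρ) {w w' : EuclideanSpace ℝ (Fin d) → ℝ}
    {M M' K' D' Q : ℝ} (hQ : Q = stepC d (1 / C₀) ((d + 1) * C₀))
    (hw : CB2 d w M) (hw' : CB2 d w' M') (hD' : ∀ x, ‖fderiv ℝ w' x‖ ≤ D') (hK' : 0 < K')
    (hHB : HB d ρ w' K') (h1 : Q * (2 * d * C₀ * D') ≤ K' / 8) (h2 : Q * (d * C₀) ≤ √ρ / 8)
    (h3 : Q * (d * ε₀) ≤ 1 / 8) (h4 : Q * (d * (ε₀ + C₀ * ρ ^ (-(α / 2)))) ≤ 1 / 8)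
    (hstep : ∀ y, ∃ (p : Fin d → ℝ) (X : Matrix (Fin d) (Fin d) ℝ),
      |ρ * w y - (∑ i, (∫ u in U, b y u i * gibbsDensity d l lam U r b S y p X u) * pd1 d w y i) -
        (1 / 2) * (∑ i, ∑ j, (∫ u in U, S y u i j * gibbsDensity d l lam U r b S y p X u) *
          pd2 d w y j i)| ≤
      2 * (C₀ * ∑ i, |pd1 d w' y i| + 1 / 2 * ε₀ * ∑ i, ∑ j, |pd2 d w' y j i|)) :
    ScaledBound d ρ w (K' / 2) := by
  obtain ⟨K₀, hK₀, hb⟩ := hw.exists_scaledBound hρ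
  have hC0 : 0 < C₀ := by linarith
  have hsρ : 0 < √ρ := Real.sqrt_pos.2 hρ
  have hm1 : 1 / C₀ ≤ 1 := (div_le_one hC0).2 hC₀
  have hc : 1 ≤ (d + 1) * C₀ := by
    have : (0 : ℝ) ≤ d * C₀ := by positivity
    linarith
  have hQ0 : 0 < Q := hQ ▸ stepC_pos d (by positivity) hm1 hc
  have hD0 : 0 ≤ D' := (norm_nonneg _).trans (hD' 0)
  refine bound_of_contraction (P := ScaledBound d ρ w) (fun a b ha hab h => ?_) hK₀ hb hK'
    fun K hK hP => ?_
  · exact ⟨fun x => (h.1 x).trans hab, fun x => (h.2.1 x).trans hab, h.2.2.mono ha hab⟩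
  · have hD : ∀ x, ‖fderiv ℝ w x‖ ≤ K / √ρ := fun x => by
      rw [le_div_iff₀ hsρ, mul_comm]; exact hP.2.1 x
    have hρα : 0 < ρ ^ (-(α / 2)) := Real.rpow_pos_of_pos hρ _
    refine hw.step_estimate hw' (m := 1 / C₀) (by positivity) hm1 hc hρ hP.2.2 hHB hK hK'.le
      (by positivity) (by positivity) (by positivity)
      (H.exists_frozen hC₀ hε hα hα1 hρ hw hD hD' hstep) ?_
    rw [← hQ]
    have e1 : Q * (d * C₀ * (K / √ρ)) ≤ K / 8 := by
      have : Q * (d * C₀ * (K / √ρ)) = Q * (d * C₀) / √ρ * K := by ring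
      rw [this]
      have h5 : Q * (d * C₀) / √ρ ≤ 1 / 8 := by
        rw [div_le_iff₀ hsρ]; linarith
      have := mul_le_mul_of_nonneg_right h5 hK
      linarith
    have e2 := mul_le_mul_of_nonneg_right h3 hK'.le
    have e3 := mul_le_mul_of_nonneg_right h4 hK
    linarith

end ControlData

lemma half_pow_le_rpow {n : ℕ} (hn : 1 ≤ n) {e x : ℝ} (he : 0 ≤ e) (he1 : e ≤ 1) (hx : 0 ≤ x) :
    (1 / 2 : ℝ) ^ n ≤ (2 * (2 : ℝ) ^ (-(n : ℝ)) + x) ^ e := by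
  have e1 : (2 : ℝ) ^ (-(n : ℝ)) = (1 / 2) ^ n := by
    rw [Real.rpow_neg (by norm_num), Real.rpow_natCast, one_div, inv_pow]
  rw [e1]
  have h0 : (0 : ℝ) < (1 / 2) ^ n := by positivity
  have h1 : (1 / 2 : ℝ) ^ n ≤ 1 / 2 := by
    simpa using pow_le_pow_of_le_one (by norm_num : (0 : ℝ) ≤ 1 / 2) (by norm_num) hn
  calc (1 / 2 : ℝ) ^ n ≤ (2 * (1 / 2) ^ n) ^ (1 : ℝ) := by rw [Real.rpow_one]; linarith
    _ ≤ (2 * (1 / 2) ^ n) ^ e :=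
        Real.rpow_le_rpow_of_exponent_ge (by linarith) (by linarith) he1
    _ ≤ _ := Real.rpow_le_rpow (by linarith) (by linarith) he

/-- The sup-norm rates follow from geometric decay of the scaled bounds. -/
lemma ScaledBound.rates {d n : ℕ} {ρ Z t : ℝ} {u vs : EuclideanSpace ℝ (Fin d) → ℝ} {M : ℝ}
    (hu : CB2 d u M) (hvs : CB2 d vs M) (hn : 1 ≤ n) (hρ : 1 ≤ ρ) (hZ : Z ≤ √ρ) (ht : 0 ≤ t)
    (h : ScaledBound d ρ (fun x => vs x - 1 * u x) (Z * (1 / 2) ^ n)) :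
    (∀ x, ‖fderiv ℝ u x - fderiv ℝ vs x‖ ≤
      (2 * (2 : ℝ) ^ (-(n : ℝ)) + t) ^ ((1 : ℝ) / ((d : ℝ) + 2))) ∧
    (∀ x, |u x - vs x| ≤ ρ ^ (-(1 : ℝ) / ((d : ℝ) + 2)) *
      (2 * (2 : ℝ) ^ (-(n : ℝ)) + t) ^
        ((1 : ℝ) / ((d : ℝ) + 2) + (d : ℝ) / ((d : ℝ) + 2) ^ 2)) := by
  have hρ0 : 0 < ρ := by linarith
  have hs : 0 < √ρ := Real.sqrt_pos.2 hρ0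
  have hd : (0 : ℝ) ≤ d := d.cast_nonneg
  have hp : (0 : ℝ) < (1 / 2) ^ n := by positivity
  have hZp : Z * (1 / 2) ^ n ≤ √ρ * (1 / 2) ^ n := mul_le_mul_of_nonneg_right hZ hp.le
  refine ⟨fun x => ?_, fun x => ?_⟩
  · refine le_trans ?_ (half_pow_le_rpow (n := n) hn (by positivity) ?_ ht)
    · have e : fderiv ℝ (fun x => vs x - 1 * u x) x = fderiv ℝ vs x - fderiv ℝ u x := by
        simp_rw [one_mul]; exact ((hvs.hasFDerivAt x).sub (hu.hasFDerivAt x)).fderiv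
      have h1 := (h.2.1 x).trans hZp
      rw [e, norm_sub_rev] at h1
      exact le_of_mul_le_mul_left h1 hs
    · rw [div_le_one (by positivity)]; linarith
  · refine le_trans ?_ (mul_le_mul_of_nonneg_left (half_pow_le_rpow (n := n) hn (by positivity) ?_ ht)
      (Real.rpow_nonneg hρ0.le _))
    · have h1 := (h.1 x).trans hZp
      simp only [one_mul] at h1
      rw [abs_sub_comm] at h1
      have h2 : |u x - vs x| ≤ (√ρ)⁻¹ * (1 / 2) ^ n := by
        have h3 : ρ = √ρ * √ρ := (Real.mul_self_sqrt hρ0.le).symm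
        have h4 : √ρ * |u x - vs x| ≤ (1 / 2) ^ n := by
          refine le_of_mul_le_mul_left ?_ hs
          rw [← mul_assoc, ← h3]; exact h1
        rw [inv_mul_eq_div, le_div_iff₀ hs, mul_comm]; exact h4
      refine h2.trans (mul_le_mul_of_nonneg_right ?_ hp.le)
      rw [Real.sqrt_eq_rpow, ← Real.rpow_neg hρ0.le]
      refine Real.rpow_le_rpow_of_exponent_le hρ ?_
      rw [neg_div, neg_le_neg_iff]
      exact one_div_le_one_div_of_le (by norm_num) (by linarith)
    · rw [div_add_div _ _ (by positivity) (by positivity), div_le_one (by positivity)]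
      have : (0 : ℝ) ≤ (d + 2) * d ^ 2 := by positivity
      nlinarith

/-- Elementary consequences of the largeness of `ρ` and the smallness of `ε₀`. -/
lemma smallness_of_large {E A α ρ ε : ℝ} (hE : 1 ≤ E) (hα : 0 < α) (hα1 : α < 1)
    (hA : A = E ^ (1 / α)) (hρ : A ^ (2 / (1 - α)) ≤ ρ) (hε : 0 < ε)
    (hερ : ε * A * ρ ^ (α / 2) ≤ 1) :
    1 ≤ ρ ∧ E ≤ √ρ ∧ E * ε ≤ 1 ∧ E * ρ ^ (-(α / 2)) ≤ 1 := by
  have hE0 : 0 < E := by linarith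
  have hEA : E ≤ A := by
    rw [hA]
    simpa using Real.rpow_le_rpow_of_exponent_le hE ((one_le_div hα).2 hα1.le)
  have hA1 : 1 ≤ A := hE.trans hEA
  have hA2 : A ^ 2 ≤ ρ := by
    refine le_trans ?_ hρ
    rw [← Real.rpow_natCast]
    refine Real.rpow_le_rpow_of_exponent_le hA1 ?_
    rw [le_div_iff₀ (by linarith)]
    push_cast; linarith
  have hρ1 : 1 ≤ ρ := by nlinarith
  have hρα : E ≤ ρ ^ (α / 2) := by
    calc E = A ^ α := by
          rw [hA, ← Real.rpow_mul hE0.le, one_div_mul_cancel hα.ne', Real.rpow_one]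
      _ = (A ^ 2) ^ (α / 2) := by
          rw [← Real.rpow_natCast, ← Real.rpow_mul (by linarith)]
          congr 1; push_cast; ring
      _ ≤ _ := Real.rpow_le_rpow (by positivity) hA2 (by linarith)
  refine ⟨hρ1, hEA.trans (Real.le_sqrt_of_sq_le hA2), ?_, ?_⟩
  · have h1 : 1 ≤ ρ ^ (α / 2) := hE.trans hρα
    have h2 : ε * A * 1 ≤ ε * A * ρ ^ (α / 2) := mul_le_mul_of_nonneg_left h1 (by positivity)
    have h3 : ε * E ≤ ε * A := mul_le_mul_of_nonneg_left hEA hε.le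
    linarith
  · rw [Real.rpow_neg (by linarith), ← div_eq_mul_inv]
    exact (div_le_one (by linarith)).2 hρα

/-- Theorem 3.2 (sup-norm rates): under the hypotheses of the quantitative convergence
theorem, the gradient and the value converge in sup norm with the stated algebraic rates. -/
theorem stmt8 (d l : ℕ) (B : ℝ) (hB : 1 ≤ B) :
    ∃ C : ℝ, 0 < C ∧
    ∀ (α lam C₀ : ℝ), 0 < α → α < 1 → 0 < lam → 1 ≤ C₀ →
    ∃ A₁ : ℝ, 1 ≤ A₁ ∧ ∃ C' : ℝ, 0 < C' ∧
    ∀ (U : Set (EuclideanSpace ℝ (Fin l)))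
      (r : EuclideanSpace ℝ (Fin d) → EuclideanSpace ℝ (Fin l) → ℝ)
      (b : EuclideanSpace ℝ (Fin d) → EuclideanSpace ℝ (Fin l) → Fin d → ℝ)
      (S : EuclideanSpace ℝ (Fin d) → EuclideanSpace ℝ (Fin l) → Matrix (Fin d) (Fin d) ℝ)
      (S0 : EuclideanSpace ℝ (Fin d) → Matrix (Fin d) (Fin d) ℝ)
      (ε₀ ε₁ ρ : ℝ)
      (vstar : EuclideanSpace ℝ (Fin d) → ℝ)
      (v : ℕ → EuclideanSpace ℝ (Fin d) → ℝ),
      MeasurableSet U → Bornology.IsBounded U → volume U = 1 →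
      -- measurability in the control variable
      (∀ x, Measurable fun u => r x u) →
      (∀ x i, Measurable fun u => b x u i) →
      (∀ x i j, Measurable fun u => S x u i j) →
      -- (cond1)
      (∀ u ∈ U, ∀ x (ξ : Fin d → ℝ),
        (1 / C₀) * ∑ i, ξ i ^ 2 ≤ ∑ i, ∑ j, ξ i * S x u i j * ξ j) →
      (∀ u ∈ U, ∀ x, |r x u| ≤ C₀) →
      (∀ u ∈ U, ∀ x y, dist x y ≤ 1 → |r x u - r y u| ≤ C₀ * dist x y ^ α) →
      (∀ u ∈ U, ∀ x i, |b x u i| ≤ C₀) →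
      (∀ u ∈ U, ∀ x y, dist x y ≤ 1 → ∀ i, |b x u i - b y u i| ≤ C₀ * dist x y ^ α) →
      (∀ u ∈ U, ∀ x i j, |S x u i j| ≤ C₀) →
      (∀ u ∈ U, ∀ x y, dist x y ≤ 1 → ∀ i j, |S x u i j - S y u i j| ≤ C₀ * dist x y ^ α) →
      -- (cond2)
      0 < ε₀ → ε₀ < 1 → 0 < ε₁ → ε₁ < 1 →
      (∀ u ∈ U, ∀ x i j, |S x u i j - S0 x i j| ≤ ε₀) →
      (∀ u ∈ U, ∀ x y, dist x y ≤ 1 → ∀ i j,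
        |(S x u i j - S0 x i j) - (S y u i j - S0 y i j)| ≤ ε₁ * dist x y ^ α) →
      -- Σ₀ is Lipschitz continuous
      (∃ K, ∀ x y i j, |S0 x i j - S0 y i j| ≤ K * dist x y) →
      -- v* is a bounded C^{2,α} classical solution of the exploratory HJB equation
      ContDiff ℝ 2 vstar →
      (∃ K, ∀ x y, dist x y ≤ 1 →
        ‖iteratedFDeriv ℝ 2 vstar x - iteratedFDeriv ℝ 2 vstar y‖ ≤ K * dist x y ^ α) →
      (∀ x, ρ * vstar x =
        expF d l lam U r b S x (fun i => pd1 d vstar x i) (hessian d vstar x)) →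
      -- v⁰ ∈ C^{2,α}(ℝ^d)
      ContDiff ℝ 2 (v 0) →
      (∃ K, ∀ x y, dist x y ≤ 1 →
        ‖iteratedFDeriv ℝ 2 (v 0) x - iteratedFDeriv ℝ 2 (v 0) y‖ ≤ K * dist x y ^ α) →
      -- ‖v⁰‖₂ + ‖v*‖₂ ≤ B
      (∀ x, (|v 0 x| + ‖fderiv ℝ (v 0) x‖ + ‖iteratedFDeriv ℝ 2 (v 0) x‖) +
        (|vstar x| + ‖fderiv ℝ vstar x‖ + ‖iteratedFDeriv ℝ 2 vstar x‖) ≤ B) →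
      -- the iterates are bounded classical solutions of the linearized equations
      (∀ n : ℕ, 1 ≤ n → ContDiff ℝ 2 (v n) ∧ ∃ M, ∀ x, |v n x| ≤ M) →
      (∀ n : ℕ, 1 ≤ n → ∀ x,
        ρ * v n x
          - (∫ u in U, r x u * gibbsPolicy d l lam U r b S (v (n - 1)) x u)
          - (∑ i, (∫ u in U, b x u i * gibbsPolicy d l lam U r b S (v (n - 1)) x u) *
              pd1 d (v n) x i)
          - (1/2) * (∑ i, ∑ j,
              (∫ u in U, S x u i j * gibbsPolicy d l lam U r b S (v (n - 1)) x u) *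
                pd2 d (v n) x j i)
          + lam * (∫ u in U, Real.log (gibbsPolicy d l lam U r b S (v (n - 1)) x u) *
              gibbsPolicy d l lam U r b S (v (n - 1)) x u) = 0) →
      -- (cond3)
      A₁ ^ (2 / (1 - α)) ≤ ρ → ε₀ * A₁ * ρ ^ (α/2) ≤ 1 → ε₁ * A₁ ≤ 1 →
      -- uniform C^{2,α} bound on the iterates
      (∃ K : ℝ, ∀ (n : ℕ) (x y : EuclideanSpace ℝ (Fin d)), dist x y ≤ 1 →
        (|v n x| + ‖fderiv ℝ (v n) x‖ + ‖iteratedFDeriv ℝ 2 (v n) x‖ ≤ K) ∧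
        ‖iteratedFDeriv ℝ 2 (v n) x - iteratedFDeriv ℝ 2 (v n) y‖ ≤ K * dist x y ^ α) →
      -- conclusions: sup-norm convergence rates
      ∀ n : ℕ, 1 ≤ n →
        (∀ x, ‖fderiv ℝ (v n) x - fderiv ℝ vstar x‖ ≤
          (C * (2 : ℝ) ^ (-(n : ℝ)) + C' * ε₀ ^ 2 / ρ) ^ ((1 : ℝ) / ((d : ℝ) + 2))) ∧
        (∀ x, |v n x - vstar x| ≤
          ρ ^ (-(1 : ℝ) / ((d : ℝ) + 2)) *
            (C * (2 : ℝ) ^ (-(n : ℝ)) + C' * ε₀ ^ 2 / ρ) ^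
              ((1 : ℝ) / ((d : ℝ) + 2) + (d : ℝ) / ((d : ℝ) + 2) ^ 2)) := by
  refine ⟨2, two_pos, fun α lam C₀ hα hα1 hlam hC₀ => ?_⟩
  have hC0 : 0 < C₀ := by linarith
  have hB0 : 0 < B := by linarith
  have hQ0 : 0 < stepC d (1 / C₀) ((d + 1) * C₀) := by
    refine stepC_pos d (by positivity) ((div_le_one hC0).2 hC₀) ?_
    have : (0 : ℝ) ≤ d * C₀ := by positivity
    linarith
  obtain ⟨Q, hQ⟩ : ∃ Q, Q = stepC d (1 / C₀) ((d + 1) * C₀) := ⟨_, rfl⟩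
  rw [← hQ] at hQ0
  have hq : 0 ≤ Q * (d * C₀) := by positivity
  have hq' : Q * d ≤ Q * (d * C₀) := by
    have : (d : ℝ) * 1 ≤ d * C₀ := mul_le_mul_of_nonneg_left hC₀ d.cast_nonneg
    exact mul_le_mul_of_nonneg_left (by linarith) hQ0.le
  set Z := 1 + d * (B + B) + 32 * (Q * (d * C₀)) * B with hZ
  have hZ0 : 0 < Z := by positivity
  set E := Z + 32 * (Q * (d * C₀)) with hE
  have hE1 : 1 ≤ E := by
    have : 0 ≤ d * (B + B) + 32 * (Q * (d * C₀)) * B := by positivity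
    linarith
  refine ⟨E ^ (1 / α), Real.one_le_rpow hE1 (by positivity), 1, one_pos, ?_⟩
  intro U r b S S0 ε₀ ε₁ ρ vstar v hU _ hvol hmr hmb hmS hell hr _ hbb _ hS hSH hε _ _ _ hS0 _ _
    hvs _ hHJB hv0 _ hvB hv hpde hρ hερ _ hK n hn
  obtain ⟨K, hK⟩ := hK
  have H : ControlData d l C₀ α ε₀ U r b S S0 :=
    ⟨hU, hvol, hmr, hmb, hmS, hell, hr, hbb, hS, hSH, hS0⟩
  obtain ⟨hρ1, hEρ, hEε, hEα⟩ := smallness_of_large hE1 hα hα1 rfl hρ hε hερ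
  have hρ0 : 0 < ρ := by linarith
  have hc : ∀ k, ContDiff ℝ 2 (v k) := fun k => by
    rcases Nat.eq_zero_or_pos k with rfl | hk
    · exact hv0
    · exact (hv k hk).1
  have hCv : ∀ k, CB2 d (v k) (max K B) := fun k => CB2.of_iteratedFDeriv (hc k) fun x =>
    (hK k x x (by simp)).1.trans (le_max_left _ _)
  have hCs : CB2 d vstar B := CB2.of_iteratedFDeriv hvs fun x => by
    linarith [hvB x, abs_nonneg (v 0 x), norm_nonneg (fderiv ℝ (v 0) x),
      norm_nonneg (iteratedFDeriv ℝ 2 (v 0) x)]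
  have hCs' : CB2 d vstar (max K B) := CB2.of_iteratedFDeriv hvs fun x =>
    le_trans (by linarith [hvB x, abs_nonneg (v 0 x), norm_nonneg (fderiv ℝ (v 0) x),
      norm_nonneg (iteratedFDeriv ℝ 2 (v 0) x)]) (le_max_right _ _)
  have hC0' : CB2 d (v 0) B := CB2.of_iteratedFDeriv hv0 fun x => by
    linarith [hvB x, abs_nonneg (vstar x), norm_nonneg (fderiv ℝ vstar x),
      norm_nonneg (iteratedFDeriv ℝ 2 vstar x)]
  have h11 : |(1 : ℝ)| ≤ 1 := by simp
  have hw := fun k => hCs'.sub_smul (hCv k) h11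
  have hstep : ∀ k y, ∃ (p : Fin d → ℝ) (X : Matrix (Fin d) (Fin d) ℝ),
      |ρ * (vstar y - 1 * v (k + 1) y) - (∑ i, (∫ u in U, b y u i *
          gibbsDensity d l lam U r b S y p X u) * pd1 d (fun x => vstar x - 1 * v (k + 1) x) y i) -
        (1 / 2) * (∑ i, ∑ j, (∫ u in U, S y u i j * gibbsDensity d l lam U r b S y p X u) *
          pd2 d (fun x => vstar x - 1 * v (k + 1) x) y j i)| ≤
      2 * (C₀ * ∑ i, |pd1 d (fun x => vstar x - 1 * v k x) y i| +
        1 / 2 * ε₀ * ∑ i, ∑ j, |pd2 d (fun x => vstar x - 1 * v k x) y j i|) := by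
    intro k y
    have := H.abs_policy_step_le hlam (x := y) (s := fun i => pd1 d (v (k + 1)) y i)
      (T := hessian d (v (k + 1)) y) rfl (hHJB y) (hpde (k + 1) (by omega) y)
    refine ⟨fun i => pd1 d (v k) y i, hessian d (v k) y, ?_⟩
    simp only [(hw _).2.1, (hw _).2.2]
    simp only [one_mul]
    rw [mul_sub ρ]
    exact this
  have hsmall : Q * (d * (ε₀ + C₀ * ρ ^ (-(α / 2)))) ≤ 1 / 8 := by
    have h1 : 32 * (Q * (d * C₀)) ≤ E := by linarith
    have h2 : 0 < ρ ^ (-(α / 2)) := Real.rpow_pos_of_pos hρ0 _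
    have h3 := mul_le_mul_of_nonneg_right h1 h2.le
    have h4 := mul_le_mul_of_nonneg_right h1 hε.le
    have h5 := mul_le_mul_of_nonneg_right hq' hε.le
    linarith
  have hsmall' : Q * (d * ε₀) ≤ 1 / 8 := by
    have : 0 ≤ Q * (d * C₀) * ρ ^ (-(α / 2)) := mul_nonneg hq (Real.rpow_nonneg hρ0.le _)
    linarith
  have hsmall'' : 32 * (Q * (d * C₀)) ≤ √ρ := by linarith
  have main : ∀ k : ℕ, ScaledBound d ρ (fun x => vstar x - 1 * v (k + 1) x)
      (Z * (1 / 2) ^ (k + 1)) := by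
    intro k
    induction k with
    | zero =>
      have hw0 := (hCs.sub_smul hC0' h11).1
      have := H.scaledBound_half hC₀ hε.le hα hα1 hρ0 hQ (hw 1).1 hw0 hw0.fderiv_le hZ0
        ((hw0.hb ρ).mono (by positivity) (by
          have : 0 ≤ 32 * (Q * (d * C₀)) * B := by positivity
          linarith)) (by
          have : 0 ≤ d * (B + B) := by positivity
          linarith) (by linarith) hsmall' hsmall (hstep 0)
      simpa [div_eq_mul_inv] using this
    | succ k ih =>
      have hZk : 0 < Z * (1 / 2) ^ (k + 1) := by positivity
      have hs : 0 < √ρ := Real.sqrt_pos.2 hρ0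
      have := H.scaledBound_half hC₀ hε.le hα hα1 hρ0 hQ (hw (k + 1 + 1)).1 (hw (k + 1)).1
        (D' := Z * (1 / 2) ^ (k + 1) / √ρ)
        (fun x => by rw [le_div_iff₀ hs, mul_comm]; exact ih.2.1 x) hZk ih.2.2 (by
          have h1 : 2 * (Q * (d * C₀)) / √ρ ≤ 1 / 8 := by
            rw [div_le_iff₀ hs]; linarith
          have h2 := mul_le_mul_of_nonneg_right h1 hZk.le
          calc _ = 2 * (Q * (d * C₀)) / √ρ * (Z * (1 / 2) ^ (k + 1)) := by ring
            _ ≤ _ := by linarith) (by linarith) hsmall' hsmall (hstep (k + 1))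
      rw [pow_succ, ← mul_assoc]
      simpa [div_eq_mul_inv] using this
  obtain ⟨k, rfl⟩ : ∃ k, n = k + 1 := ⟨n - 1, by omega⟩
  exact ScaledBound.rates (hCv (k + 1)) hCs' hn hρ1 (by linarith) (by positivity) (main k)
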